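/- Let 1 < p < ∞ and c₀ > 0. There is a constant C_p, depending only on p, c₀ and the flag seminorm constants 𝒞, such that for every M ∈ C_c^∞(ℝ²) satisfying the flag-F₁ seminorm bounds with constants 𝒞, the kernel K(x,y) = M(x, y − c₀x²) satisfies ‖f * K‖_{L^p(ℝ²)} ≤ C_p ‖f‖_{L^p(ℝ²)} for every Schwartz function f on ℝ². Equivalently, the Fourier transform of the curved flag kernel K is an L^p Fourier multiplier for all 1 < p < ∞, with multiplier norm controlled by the flag seminorms of M. -/

import Mathlib

open Real Filter Topology MeasureTheory ENNReal NNReal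

noncomputable section

/-- `eI r = exp(i r)`. -/
def eI (r : ℝ) : ℂ := Complex.exp (Complex.I * r)

/-- A normalized bump function on `ℝ`: a `C^∞` function supported in `[-1,1]`
with `|φ| ≤ 1` and `|φ'| ≤ 1`. -/
def IsNormalizedBump (φ : ℝ → ℝ) : Prop :=
  ContDiff ℝ (⊤ : ℕ∞) φ ∧ (∀ t : ℝ, 1 < |t| → φ t = 0) ∧
  (∀ t, |φ t| ≤ 1) ∧ (∀ t, |deriv φ t| ≤ 1)

/-- A compactly supported smooth function `M` on `ℝ²` satisfies the flag-`F₁` seminorm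
bounds with constants `𝒞 = (Cab, C1, C2)` if:
(i) `|∂_x^α ∂_y^β M(x,y)| ≤ Cab α β (|x|+|y|^{1/2})^{-1-α} |y|^{-1-β}` for `y ≠ 0`;
(ii) for every normalized bump `φ` and `R > 0`, the functions
`y ↦ ∫ M(x,y) φ(Rx) dx` and `x ↦ ∫ M(x,y) φ(Ry) dy` are CZ kernels on `ℝ`
with constants `(C1, C2)` (decay and cancellation), uniformly in `φ` and `R`. -/
def FlagF1FunBounds (Cab : ℕ → ℕ → ℝ) (C1 : ℕ → ℝ) (C2 : ℝ) (M : ℝ → ℝ → ℂ) : Prop :=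
  ContDiff ℝ (⊤ : ℕ∞) (fun p : ℝ × ℝ => M p.1 p.2) ∧
  HasCompactSupport (fun p : ℝ × ℝ => M p.1 p.2) ∧
  (∀ (α β : ℕ) (x y : ℝ), y ≠ 0 →
    ‖iteratedDeriv α (fun x' : ℝ => iteratedDeriv β (fun y' : ℝ => M x' y') y) x‖
      ≤ Cab α β * (|x| + |y| ^ ((1:ℝ)/2)) ^ (-1 - (α : ℝ)) * |y| ^ (-1 - (β : ℝ))) ∧
  (∀ φ : ℝ → ℝ, IsNormalizedBump φ → ∀ R : ℝ, 0 < R →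
    (∀ (α : ℕ) (y : ℝ), y ≠ 0 →
      ‖iteratedDeriv α (fun y' : ℝ => ∫ x : ℝ, M x y' * (φ (R * x) : ℂ)) y‖
        ≤ C1 α * |y| ^ (-1 - (α : ℝ))) ∧
    (∀ δ : ℝ, 0 < δ → ∀ ψ : ℝ → ℝ, IsNormalizedBump ψ →
      ‖∫ y : ℝ, (∫ x : ℝ, M x y * (φ (R * x) : ℂ)) * (ψ (δ * y) : ℂ)‖ ≤ C2) ∧
    (∀ (α : ℕ) (x : ℝ), x ≠ 0 →
      ‖iteratedDeriv α (fun x' : ℝ => ∫ y : ℝ, M x' y * (φ (R * y) : ℂ)) x‖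
        ≤ C1 α * |x| ^ (-1 - (α : ℝ))) ∧
    (∀ δ : ℝ, 0 < δ → ∀ ψ : ℝ → ℝ, IsNormalizedBump ψ →
      ‖∫ x : ℝ, (∫ y : ℝ, M x y * (φ (R * y) : ℂ)) * (ψ (δ * x) : ℂ)‖ ≤ C2))

set_option maxHeartbeats 1000000 in
open FourierTransform in
theorem fourier_toLp_ae_eq {E : Type*} [NormedAddCommGroup E] [InnerProductSpace ℝ E]
    [FiniteDimensional ℝ E] [MeasurableSpace E] [BorelSpace E] {f : E → ℂ}
    (h1 : Integrable f) (h2 : MemLp f 2) :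
    ((𝓕 (h2.toLp f) : Lp (α := E) ℂ 2) : E → ℂ) =ᵐ[volume] 𝓕 f := by
  have hF : Continuous (𝓕 f) := by
    exact VectorFourier.fourierIntegral_continuous Real.continuous_fourierChar
      (by exact continuous_inner) h1
  refine ae_eq_of_integral_contDiff_smul_eq
    ((Lp.memLp _).locallyIntegrable (by norm_num)) hF.locallyIntegrable ?_
  intro g hg hgs
  have hgc : ContDiff ℝ (⊤ : ℕ∞) (fun x => (g x : ℂ)) := Complex.ofRealCLM.contDiff.comp hg
  have hgcs : HasCompactSupport (fun x => (g x : ℂ)) := 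
    hgs.comp_left (g := fun r : ℝ => (r : ℂ)) Complex.ofReal_zero
  let G : SchwartzMap E ℂ := hgcs.toSchwartzMap hgc
  have hG : ∀ x, G x = (g x : ℂ) := fun x => rfl
  have e1 := congrArg (fun T => T G) (Lp.fourier_toTemperedDistribution_eq (h2.toLp f))
  simp only [TemperedDistribution.fourier_apply, Lp.toTemperedDistribution_apply] at e1
  have e2 : ∫ x, (𝓕 G) x • (h2.toLp f) x = ∫ x, (𝓕 G) x • f x := by
    apply integral_congr_ae
    filter_upwards [h2.coeFn_toLp] with x hx
    rw [hx]
  have e3 : ∫ x, (𝓕 G) x • f x = ∫ x, G x • (𝓕 f) x := by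
    have := VectorFourier.integral_fourierIntegral_smul_eq_flip (L := innerₗ E) (μ := volume)
      (ν := volume) (f := (G : E → ℂ)) (g := f) Real.continuous_fourierChar
      (by exact continuous_inner) G.integrable h1
    simpa using! this
  rw [e2, e3] at e1
  simpa [hG, Complex.real_smul] using e1.symm

open FourierTransform in
theorem eLpNorm_two_fourier_eq {E : Type*} [NormedAddCommGroup E] [InnerProductSpace ℝ E]
    [FiniteDimensional ℝ E] [MeasurableSpace E] [BorelSpace E] {f : E → ℂ}
    (h1 : Integrable f) (h2 : MemLp f 2) :
    eLpNorm (𝓕 f) 2 volume = eLpNorm f 2 volume := by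
  rw [← eLpNorm_congr_ae (fourier_toLp_ae_eq h1 h2), ← eLpNorm_congr_ae h2.coeFn_toLp,
    ← Lp.enorm_def, ← Lp.enorm_def, ← ofReal_norm, ← ofReal_norm,
    Lp.norm_fourier_eq]

/-- Convolution of `f` with the kernel `k` on the plane. -/
def cv (k f : ℝ × ℝ → ℂ) (z : ℝ × ℝ) : ℂ := ∫ w : ℝ × ℝ, f (z - w) * k w

theorem cv_eq (k f : ℝ × ℝ → ℂ) (z : ℝ × ℝ) : cv k f z = ∫ w : ℝ × ℝ, f w * k (z - w) := by
  unfold cv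
  rw [← integral_sub_left_eq_self (fun w => f w * k (z - w)) volume z]
  simp

theorem enorm_cv_le (k f : ℝ × ℝ → ℂ) (z : ℝ × ℝ) :
    ‖cv k f z‖ₑ ≤ ∫⁻ w, ‖f (z - w)‖ₑ * ‖k w‖ₑ := by
  refine (enorm_integral_le_lintegral_enorm _).trans (le_of_eq ?_)
  simp [enorm_mul]

theorem lintegral_cv_rpow_le {k f : ℝ × ℝ → ℂ} (hk : Measurable k) (hf : Measurable f)
    {p : ℝ} (hp : 1 ≤ p) :
    ∫⁻ z, ‖cv k f z‖ₑ ^ p ≤ (∫⁻ w, ‖k w‖ₑ) ^ p * ∫⁻ z, ‖f z‖ₑ ^ p := by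
  have hp0 : 0 < p := by linarith
  have hκ : Measurable fun w => ‖k w‖ₑ := hk.enorm
  have hF : Measurable fun w => ‖f w‖ₑ := hf.enorm
  have key : ∀ z, ‖cv k f z‖ₑ ^ p ≤
      (∫⁻ w, ‖k w‖ₑ) ^ (p - 1) * ∫⁻ w, ‖f (z - w)‖ₑ ^ p * ‖k w‖ₑ := by
    intro z
    set ν : Measure (ℝ × ℝ) := volume.withDensity fun w => ‖k w‖ₑ with hν
    have hFz : Measurable fun w => ‖f (z - w)‖ₑ := hF.comp (measurable_const.sub measurable_id)
    have h1 : ∫⁻ w, ‖f (z - w)‖ₑ * ‖k w‖ₑ = ∫⁻ w, ‖f (z - w)‖ₑ ∂ν := by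
      rw [hν, lintegral_withDensity_eq_lintegral_mul _ hκ hFz]
      simp [mul_comm]
    have h2 : ∫⁻ w, ‖f (z - w)‖ₑ ^ p * ‖k w‖ₑ = ∫⁻ w, ‖f (z - w)‖ₑ ^ p ∂ν := by
      rw [hν, lintegral_withDensity_eq_lintegral_mul _ hκ (hFz.pow_const p)]
      simp [mul_comm]
    have h3 : ν Set.univ = ∫⁻ w, ‖k w‖ₑ := by simp [hν]
    have h4 := eLpNorm'_le_eLpNorm'_mul_rpow_measure_univ (μ := ν) (f := fun w => f (z - w))
      zero_lt_one hp (hf.comp (measurable_const.sub measurable_id)).aestronglyMeasurable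
    simp only [eLpNorm'_eq_lintegral_enorm, ENNReal.rpow_one, div_one] at h4
    calc ‖cv k f z‖ₑ ^ p ≤ (∫⁻ w, ‖f (z - w)‖ₑ ∂ν) ^ p := by
          rw [← h1]; gcongr; exact enorm_cv_le k f z
      _ ≤ ((∫⁻ w, ‖f (z - w)‖ₑ ^ p ∂ν) ^ (1 / p) * ν Set.univ ^ (1 - 1 / p)) ^ p := by
          gcongr
      _ = (∫⁻ w, ‖k w‖ₑ) ^ (p - 1) * ∫⁻ w, ‖f (z - w)‖ₑ ^ p * ‖k w‖ₑ := by
          rw [ENNReal.mul_rpow_of_nonneg _ _ hp0.le, ← ENNReal.rpow_mul, ← ENNReal.rpow_mul,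
            h2, h3, mul_comm]
          congr 2
          · field_simp
          · field_simp; simp
  calc ∫⁻ z, ‖cv k f z‖ₑ ^ p
      ≤ ∫⁻ z, (∫⁻ w, ‖k w‖ₑ) ^ (p - 1) * ∫⁻ w, ‖f (z - w)‖ₑ ^ p * ‖k w‖ₑ := by
        gcongr with z; exact key z
    _ = (∫⁻ w, ‖k w‖ₑ) ^ (p - 1) * ∫⁻ z, ∫⁻ w, ‖f (z - w)‖ₑ ^ p * ‖k w‖ₑ := by
        have hm : Measurable (Function.uncurry fun z w : ℝ × ℝ => ‖f (z - w)‖ₑ ^ p * ‖k w‖ₑ) := by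
          unfold Function.uncurry
          exact ((hF.comp (measurable_fst.sub measurable_snd)).pow_const p).mul
            (hκ.comp measurable_snd)
        exact lintegral_const_mul _ hm.lintegral_prod_right
    _ = (∫⁻ w, ‖k w‖ₑ) ^ (p - 1) * ∫⁻ w, ∫⁻ z, ‖f (z - w)‖ₑ ^ p * ‖k w‖ₑ := by
        rw [lintegral_lintegral_swap]
        exact (((hF.comp (measurable_fst.sub measurable_snd)).pow_const p).mul
            (hκ.comp measurable_snd)).aemeasurable
    _ = (∫⁻ w, ‖k w‖ₑ) ^ (p - 1) * ((∫⁻ w, ‖k w‖ₑ) * ∫⁻ z, ‖f z‖ₑ ^ p) := by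
        congr 1
        rw [← lintegral_mul_const _ hκ]
        refine lintegral_congr fun w => ?_
        have hm : Measurable fun z => ‖f (z - w)‖ₑ ^ p :=
          (hF.comp (measurable_id.sub_const w)).pow_const p
        rw [lintegral_mul_const _ hm,
          lintegral_sub_right_eq_self (fun z => ‖f z‖ₑ ^ p) w, mul_comm]
    _ = _ := by
        rw [← mul_assoc]
        congr 1
        rcases eq_or_ne p 1 with rfl | h
        · simp
        · nth_rewrite 2 [← ENNReal.rpow_one (∫⁻ w, ‖k w‖ₑ)]
          rw [← ENNReal.rpow_add_of_nonneg _ _ (by linarith) zero_le_one]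
          congr 1; ring

theorem eLpNorm_ofReal_eq {g : ℝ × ℝ → ℂ} {p : ℝ} (hp : 0 < p) :
    eLpNorm g (ENNReal.ofReal p) volume = (∫⁻ z, ‖g z‖ₑ ^ p) ^ (1 / p) := by
  rw [eLpNorm_eq_lintegral_rpow_enorm_toReal (by simpa using hp) (by simp),
    ENNReal.toReal_ofReal hp.le]

theorem eLpNorm_cv_le {k f : ℝ × ℝ → ℂ} (hk : Measurable k) (hf : Measurable f)
    {p : ℝ} (hp : 1 ≤ p) :
    eLpNorm (cv k f) (ENNReal.ofReal p) volume
      ≤ (∫⁻ w, ‖k w‖ₑ) * eLpNorm f (ENNReal.ofReal p) volume := by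
  have hp0 : 0 < p := by linarith
  rw [eLpNorm_ofReal_eq hp0, eLpNorm_ofReal_eq hp0]
  calc _ ≤ ((∫⁻ w, ‖k w‖ₑ) ^ p * ∫⁻ z, ‖f z‖ₑ ^ p) ^ (1 / p) := by
        gcongr; exact lintegral_cv_rpow_le hk hf hp
    _ = _ := by
        rw [ENNReal.mul_rpow_of_nonneg _ _ (by positivity), ← ENNReal.rpow_mul]
        congr 1
        rw [mul_one_div_cancel hp0.ne', ENNReal.rpow_one]

/-- The Fourier integral of a kernel on the plane. -/
def ft (k : ℝ × ℝ → ℂ) (ξ η : ℝ) : ℂ := ∫ z : ℝ × ℝ, k z * eI (ξ * z.1 + η * z.2)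

theorem measurable_cv {k f : ℝ × ℝ → ℂ} (hk : Measurable k) (hf : Measurable f) :
    Measurable (cv k f) := by
  have : StronglyMeasurable (Function.uncurry fun z w : ℝ × ℝ => f (z - w) * k w) :=
    ((hf.comp (measurable_fst.sub measurable_snd)).mul (hk.comp measurable_snd)).stronglyMeasurable
  exact this.integral_prod_right.measurable

theorem integrable_cv {k f : ℝ × ℝ → ℂ} (hk : Measurable k) (hf : Measurable f)
    (hki : Integrable k) (hfi : Integrable f) : Integrable (cv k f) := by
  refine ⟨(measurable_cv hk hf).aestronglyMeasurable, ?_⟩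
  have := lintegral_cv_rpow_le hk hf (le_refl (1 : ℝ))
  simp only [ENNReal.rpow_one] at this
  exact this.trans_lt (ENNReal.mul_lt_top hki.2 hfi.2)

open FourierTransform in
/-- Plancherel bound for convolution operators. -/
theorem eLpNorm_two_cv_le {k f : ℝ × ℝ → ℂ} (hk : Measurable k) (hf : Measurable f)
    (hki : Integrable k) (hfi : Integrable f) (hf2 : MemLp f 2) {B : ℝ}
    (hB : ∀ ξ η, ‖ft k ξ η‖ ≤ B) :
    eLpNorm (cv k f) 2 volume ≤ ENNReal.ofReal B * eLpNorm f 2 volume := by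
  let E := WithLp 2 (ℝ × ℝ)
  let o : E → ℝ × ℝ := WithLp.ofLp
  have ho : MeasurePreserving o := WithLp.volume_preserving_ofLp ℝ ℝ
  have hoe : MeasurableEmbedding o :=
    (MeasurableEquiv.toLp 2 (ℝ × ℝ)).symm.measurableEmbedding
  have hcv2 : MemLp (cv k f) 2 := by
    refine ⟨(measurable_cv hk hf).aestronglyMeasurable, ?_⟩
    have := eLpNorm_cv_le hk hf (p := 2) (by norm_num)
    rw [ENNReal.ofReal_ofNat] at this
    exact this.trans_lt (ENNReal.mul_lt_top hki.2 hf2.2)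
  have hcvi := integrable_cv hk hf hki hfi
  have tr : ∀ g : ℝ × ℝ → ℂ, Measurable g → eLpNorm (g ∘ o) 2 volume = eLpNorm g 2 volume :=
    fun g hg => eLpNorm_comp_measurePreserving hg.aestronglyMeasurable ho
  have hconv : (cv k f) ∘ o = convolution (k ∘ o) (f ∘ o) (ContinuousLinearMap.mul ℂ ℂ) volume := by
    ext x
    simp only [Function.comp, cv, convolution, ContinuousLinearMap.mul_apply']
    rw [← ho.integral_comp hoe]
    refine integral_congr_ae (Eventually.of_forall fun y => ?_)
    simp only
    rw [mul_comm]
    rfl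
  have i1 : Integrable (k ∘ o) := ho.integrable_comp_of_integrable hki
  have i2 : Integrable (f ∘ o) := ho.integrable_comp_of_integrable hfi
  have hft : ∀ ξ, ‖𝓕 (k ∘ o) ξ‖ ≤ B := by
    intro ξ
    have : 𝓕 (k ∘ o) ξ = ft k (-(2 * π) * ξ.fst) (-(2 * π) * ξ.snd) := by
      rw [Real.fourier_eq', ft, ← ho.integral_comp hoe]
      refine integral_congr_ae (Eventually.of_forall fun y => ?_)
      have hin : inner ℝ y ξ = y.fst * ξ.fst + y.snd * ξ.snd := by
        rw [WithLp.prod_inner_apply]; simp [mul_comm]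
      replace hin : inner ℝ y ξ = y.ofLp.1 * ξ.fst + y.ofLp.2 * ξ.snd := hin
      simp only [hin, smul_eq_mul, Function.comp, eI, o]
      rw [mul_comm]
      congr 2
      push_cast
      ring
    rw [this]
    exact hB _ _
  rw [← tr _ (measurable_cv hk hf), ← tr _ hf, ← eLpNorm_two_fourier_eq
    (ho.integrable_comp_of_integrable hcvi) (hcv2.comp_measurePreserving ho),
    ← eLpNorm_two_fourier_eq i2 (hf2.comp_measurePreserving ho), hconv]
  refine eLpNorm_le_mul_eLpNorm_of_ae_le_mul (Eventually.of_forall fun ξ => ?_) 2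
  rw [Real.fourier_mul_convolution_eq i1 i2, norm_mul]
  gcongr
  exact hft ξ

/-- The label of the parabolic dyadic rectangle of scale `j` containing `z`. -/
def dkey (j : ℤ) (z : ℝ × ℝ) : ℤ × ℤ := (⌊z.1 / 2 ^ j⌋, ⌊z.2 / 4 ^ j⌋)

/-- Parabolic dyadic rectangles. -/
def dcube (j : ℤ) (a : ℤ × ℤ) : Set (ℝ × ℝ) := {z | dkey j z = a}

theorem floor_div_zpow_eq {b : ℕ} (hb : 0 < b) {x y : ℝ} {i j : ℤ} (hij : i ≤ j)
    (h : ⌊x / (b : ℝ) ^ i⌋ = ⌊y / (b : ℝ) ^ i⌋) : ⌊x / (b : ℝ) ^ j⌋ = ⌊y / (b : ℝ) ^ j⌋ := by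
  obtain ⟨n, rfl⟩ := Int.le.dest hij
  have hb' : (b : ℝ) ≠ 0 := by positivity
  have e : ∀ x : ℝ, x / (b : ℝ) ^ (i + n) = x / (b : ℝ) ^ i / ((b ^ n : ℕ) : ℝ) := by
    intro x
    rw [zpow_add₀ hb', div_div]; simp
  rw [e, e, Int.floor_div_natCast, Int.floor_div_natCast, h]

theorem dkey_mono {i j : ℤ} (hij : i ≤ j) {z w : ℝ × ℝ} (h : dkey i z = dkey i w) :
    dkey j z = dkey j w := by
  simp only [dkey, Prod.mk.injEq] at h ⊢
  have h2 := floor_div_zpow_eq (b := 2) (by norm_num) hij (x := z.1) (y := w.1)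
  have h4 := floor_div_zpow_eq (b := 4) (by norm_num) hij (x := z.2) (y := w.2)
  push_cast at h2 h4
  exact ⟨h2 h.1, h4 h.2⟩

theorem dcube_eq (j : ℤ) (a : ℤ × ℤ) :
    dcube j a = Set.Ico ((a.1 : ℝ) * 2 ^ j) ((a.1 + 1) * 2 ^ j) ×ˢ
      Set.Ico ((a.2 : ℝ) * 4 ^ j) ((a.2 + 1) * 4 ^ j) := by
  ext z
  have h2 : (0 : ℝ) < 2 ^ j := by positivity
  have h4 : (0 : ℝ) < 4 ^ j := by positivity
  simp only [dcube, dkey, Set.mem_ofPred_eq, Prod.ext_iff, Int.floor_eq_iff, Set.mem_prod,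
    Set.mem_Ico, le_div_iff₀ h2, div_lt_iff₀ h2, le_div_iff₀ h4, div_lt_iff₀ h4]

theorem mem_dcube_dkey (j : ℤ) (z : ℝ × ℝ) : z ∈ dcube j (dkey j z) := rfl

theorem measurableSet_dcube (j : ℤ) (a : ℤ × ℤ) : MeasurableSet (dcube j a) := by
  rw [dcube_eq]; exact measurableSet_Ico.prod measurableSet_Ico

theorem volume_dcube (j : ℤ) (a : ℤ × ℤ) : volume (dcube j a) = ENNReal.ofReal (8 ^ j) := by
  rw [dcube_eq, Measure.volume_eq_prod, Measure.prod_prod, Real.volume_Ico, Real.volume_Ico,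
    ← ENNReal.ofReal_mul (by ring_nf; positivity)]
  congr 1
  have : (8 : ℝ) ^ j = 2 ^ j * 4 ^ j := by rw [← mul_zpow]; norm_num
  rw [this]; ring

/-- The mean of `F` over the rectangle exceeds `t`. -/
def Heavy (F : ℝ × ℝ → ℝ≥0∞) (t : ℝ) (j : ℤ) (a : ℤ × ℤ) : Prop :=
  ENNReal.ofReal t * volume (dcube j a) < ∫⁻ w in dcube j a, F w

/-- Maximal heavy rectangles. -/
def MaxHeavy (F : ℝ × ℝ → ℝ≥0∞) (t : ℝ) (q : ℤ × (ℤ × ℤ)) : Prop :=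
  Heavy F t q.1 q.2 ∧ ∀ i, q.1 < i → ∀ z ∈ dcube q.1 q.2, ¬ Heavy F t i (dkey i z)

/-- The rectangle of a label. -/
def qcube (q : ℤ × (ℤ × ℤ)) : Set (ℝ × ℝ) := dcube q.1 q.2

theorem MaxHeavy.eq_of_mem {F : ℝ × ℝ → ℝ≥0∞} {t : ℝ} {q r : ℤ × (ℤ × ℤ)}
    (hq : MaxHeavy F t q) (hr : MaxHeavy F t r) {z : ℝ × ℝ} (hzq : z ∈ qcube q)
    (hzr : z ∈ qcube r) : q = r := by
  have eq : dkey q.1 z = q.2 := hzq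
  have er : dkey r.1 z = r.2 := hzr
  rcases lt_trichotomy q.1 r.1 with h | h | h
  · exact absurd (er ▸ hr.1) (hq.2 _ h z hzq)
  · refine Prod.ext h ?_
    rw [← eq, ← er, h]
  · exact absurd (eq ▸ hq.1) (hr.2 _ h z hzr)

theorem exists_nat_lt_eight_zpow (C : ℝ) : ∃ N : ℤ, ∀ j : ℤ, N ≤ j → C < 8 ^ j := by
  obtain ⟨n, hn⟩ := pow_unbounded_of_one_lt C (by norm_num : (1 : ℝ) < 8)
  refine ⟨n, fun j hj => hn.trans_le ?_⟩
  rw [← zpow_natCast]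
  exact zpow_le_zpow_right₀ (by norm_num) hj

theorem exists_maxHeavy {F : ℝ × ℝ → ℝ≥0∞} {t : ℝ} (ht : 0 < t) (hF : ∫⁻ w, F w ≠ ∞)
    {j : ℤ} {z : ℝ × ℝ} (h : Heavy F t j (dkey j z)) :
    ∃ q, MaxHeavy F t q ∧ z ∈ qcube q := by
  obtain ⟨N, hN⟩ := exists_nat_lt_eight_zpow ((∫⁻ w, F w).toReal / t)
  have hb : ∀ i, Heavy F t i (dkey i z) → i ≤ N := by
    intro i hi
    by_contra hcon
    have h1 := hN i (by omega)
    have h2 : ENNReal.ofReal t * ENNReal.ofReal (8 ^ i) < ∫⁻ w, F w := by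
      have := hi.trans_le (setLIntegral_le_lintegral _ _)
      rwa [volume_dcube] at this
    rw [← ENNReal.ofReal_mul ht.le, ENNReal.ofReal_lt_iff_lt_toReal (by positivity) hF] at h2
    rw [div_lt_iff₀ ht] at h1
    linarith
  obtain ⟨m, hm, hmax⟩ := Int.exists_greatest_of_bdd ⟨N, hb⟩ ⟨j, h⟩
  refine ⟨(m, dkey m z), ⟨hm, ?_⟩, mem_dcube_dkey m z⟩
  intro i hi w hw hH
  have : dkey i w = dkey i z := dkey_mono (le_of_lt hi) hw
  rw [this] at hH
  exact absurd (hmax i hH) (not_le.2 hi)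

theorem MaxHeavy.lintegral_le {F : ℝ × ℝ → ℝ≥0∞} {t : ℝ} (ht : 0 < t) {q : ℤ × (ℤ × ℤ)}
    (hq : MaxHeavy F t q) :
    ∫⁻ w in qcube q, F w ≤ ENNReal.ofReal (8 * t) * volume (qcube q) := by
  have hne : ∃ z, z ∈ qcube q := by
    have : (0 : ℝ≥0∞) < volume (qcube q) := by
      rw [qcube, volume_dcube]; simp; positivity
    exact nonempty_of_measure_ne_zero this.ne'
  obtain ⟨z, hz⟩ := hne
  have h1 := hq.2 (q.1 + 1) (by omega) z hz
  rw [Heavy, not_lt, volume_dcube, ← ENNReal.ofReal_mul ht.le] at h1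
  have hsub : qcube q ⊆ dcube (q.1 + 1) (dkey (q.1 + 1) z) := by
    intro w hw
    have e : dkey q.1 w = dkey q.1 z := (show dkey q.1 w = q.2 from hw).trans
      (show dkey q.1 z = q.2 from hz).symm
    exact dkey_mono (by omega) e
  refine (lintegral_mono_set hsub).trans (h1.trans (le_of_eq ?_))
  rw [qcube, volume_dcube, ← ENNReal.ofReal_mul (by positivity), zpow_add_one₀ (by norm_num)]
  congr 1; ring

theorem MaxHeavy.volume_le {F : ℝ × ℝ → ℝ≥0∞} (hF : Measurable F) {t : ℝ} (ht : 0 < t)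
    {q : ℤ × (ℤ × ℤ)} (hq : MaxHeavy F t q) :
    volume (qcube q) ≤
      ENNReal.ofReal (2 / t) * ∫⁻ w in qcube q ∩ {w | ENNReal.ofReal (t / 2) < F w}, F w := by
  have h1 : ENNReal.ofReal t * volume (qcube q) < ∫⁻ w in qcube q, F w := hq.1
  have hms : MeasurableSet {w | ENNReal.ofReal (t / 2) < F w} := measurableSet_lt measurable_const hF
  rw [← lintegral_inter_add_sdiff F (qcube q) hms] at h1
  have h2 : ∫⁻ w in qcube q \ {w | ENNReal.ofReal (t / 2) < F w}, F w ≤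
      ENNReal.ofReal (t / 2) * volume (qcube q) := by
    calc _ ≤ ∫⁻ w in qcube q \ {w | ENNReal.ofReal (t / 2) < F w}, ENNReal.ofReal (t / 2) := by
          refine setLIntegral_mono' ((measurableSet_dcube _ _).diff hms) fun w hw => ?_
          simpa using hw.2
      _ = ENNReal.ofReal (t / 2) * volume (qcube q \ {w | ENNReal.ofReal (t / 2) < F w}) := by simp
      _ ≤ _ := by gcongr; exact Set.sdiff_subset
  have hv : volume (qcube q) ≠ ∞ := by rw [qcube, volume_dcube]; simp
  have h3 : ENNReal.ofReal (t / 2) * volume (qcube q) ≤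
      ∫⁻ w in qcube q ∩ {w | ENNReal.ofReal (t / 2) < F w}, F w := by
    have h4 := h1.le.trans (add_le_add_right h2 _)
    have : ENNReal.ofReal t * volume (qcube q) = ENNReal.ofReal (t / 2) * volume (qcube q) +
        ENNReal.ofReal (t / 2) * volume (qcube q) := by
      rw [← add_mul, ← ENNReal.ofReal_add (by positivity) (by positivity)]; simp
    rw [this] at h4
    exact (ENNReal.add_le_add_iff_right (ENNReal.mul_ne_top (by simp) hv)).1 h4
  calc volume (qcube q) = ENNReal.ofReal (2 / t) * (ENNReal.ofReal (t / 2) * volume (qcube q)) := by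
        rw [← mul_assoc, ← ENNReal.ofReal_mul (by positivity)]
        have : 2 / t * (t / 2) = 1 := by field_simp
        simp [this]
    _ ≤ _ := by gcongr

theorem exists_dcube_subset_ball (z : ℝ × ℝ) {ε : ℝ} (hε : 0 < ε) :
    ∃ j : ℤ, dcube j (dkey j z) ⊆ Metric.ball z ε := by
  obtain ⟨n, hn⟩ := exists_pow_lt_of_lt_one hε (by norm_num : (1 / 2 : ℝ) < 1)
  refine ⟨-(n : ℤ), fun w hw => ?_⟩
  have hz := mem_dcube_dkey (-(n : ℤ)) z
  rw [dcube_eq] at hw hz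
  have e2 : (2 : ℝ) ^ (-(n : ℤ)) = (1 / 2) ^ n := by simp
  have e4 : (4 : ℝ) ^ (-(n : ℤ)) ≤ (1 / 2) ^ n := by
    simp only [zpow_neg, zpow_natCast, one_div, inv_pow]
    gcongr; norm_num
  simp only [Set.mem_prod, Set.mem_Ico] at hw hz
  rw [Metric.mem_ball, Prod.dist_eq, max_lt_iff, Real.dist_eq, Real.dist_eq]
  constructor
  · rw [abs_lt]; constructor <;> nlinarith
  · rw [abs_lt]; constructor <;> nlinarith

theorem le_of_not_heavy {F : ℝ × ℝ → ℝ≥0∞} (hF : Continuous F) {t : ℝ} {z : ℝ × ℝ}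
    (h : ∀ j, ¬ Heavy F t j (dkey j z)) : F z ≤ ENNReal.ofReal t := by
  by_contra! hcon
  obtain ⟨c, hc1, hc2⟩ := exists_between hcon
  obtain ⟨ε, hε, hball⟩ := Metric.mem_nhds_iff.1 (hF.continuousAt.eventually (lt_mem_nhds hc2))
  obtain ⟨j, hj⟩ := exists_dcube_subset_ball z hε
  refine h j ?_
  have hv0 : volume (dcube j (dkey j z)) ≠ 0 := by rw [volume_dcube]; simp; positivity
  have hv : volume (dcube j (dkey j z)) ≠ ∞ := by rw [volume_dcube]; simp
  calc ENNReal.ofReal t * volume (dcube j (dkey j z)) < c * volume (dcube j (dkey j z)) :=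
        (ENNReal.mul_lt_mul_iff_left hv0 hv).2 hc1
    _ = ∫⁻ w in dcube j (dkey j z), c := by simp
    _ ≤ _ := setLIntegral_mono' (measurableSet_dcube _ _) fun w hw => (hball (hj hw)).le

/-- Calderón–Zygmund decomposition with respect to parabolic dyadic rectangles. -/
theorem exists_cz_decomposition {f : ℝ × ℝ → ℂ} (hf : Continuous f) (hfi : Integrable f)
    {t : ℝ} (ht : 0 < t) :
    ∃ (S : Set (ℤ × (ℤ × ℤ))) (g : ℝ × ℝ → ℂ),
      S.PairwiseDisjoint qcube ∧ Measurable g ∧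
      (∀ q ∈ S, ∫ w in qcube q, (f w - g w) = 0) ∧
      (∀ z, z ∉ ⋃ q ∈ S, qcube q → g z = f z ∧ ‖f z‖ ≤ t) ∧
      (∀ z, z ∈ ⋃ q ∈ S, qcube q → ‖g z‖ ≤ 8 * t) ∧
      (∀ q ∈ S, ∫⁻ w in qcube q, ‖f w - g w‖ₑ ≤ ENNReal.ofReal (16 * t) * volume (qcube q)) ∧
      volume (⋃ q ∈ S, qcube q) ≤
        ENNReal.ofReal (2 / t) * ∫⁻ w in {w | t / 2 < ‖f w‖}, ‖f w‖ₑ := by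
  classical
  set F : ℝ × ℝ → ℝ≥0∞ := fun z => ‖f z‖ₑ with hFdef
  have hFc : Continuous F := hf.enorm
  have hFi : ∫⁻ w, F w ≠ ∞ := hfi.2.ne
  let S : Set (ℤ × (ℤ × ℤ)) := {q | MaxHeavy F t q}
  let avg : ℤ × (ℤ × ℤ) → ℂ := fun q => ⨍ w in qcube q, f w
  let g : ℝ × ℝ → ℂ := fun z =>
    if h : ∃ q, MaxHeavy F t q ∧ z ∈ qcube q then avg h.choose else f z
  have hvol : ∀ q : ℤ × (ℤ × ℤ), volume (qcube q) ≠ ∞ := fun q => by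
    rw [qcube, volume_dcube]; simp
  have hvol0 : ∀ q : ℤ × (ℤ × ℤ), volume (qcube q) ≠ 0 := fun q => by
    rw [qcube, volume_dcube]; simp; positivity
  have hmeas : ∀ q : ℤ × (ℤ × ℤ), MeasurableSet (qcube q) := fun q => measurableSet_dcube _ _
  have hgq : ∀ q ∈ S, ∀ z ∈ qcube q, g z = avg q := by
    intro q hq z hz
    have h : ∃ q, MaxHeavy F t q ∧ z ∈ qcube q := ⟨q, hq, hz⟩
    have e : h.choose = q := h.choose_spec.1.eq_of_mem hq h.choose_spec.2 hz
    simp only [g, dif_pos h, e]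
  have hgo : ∀ z, z ∉ ⋃ q ∈ S, qcube q → g z = f z := by
    intro z hz
    have h : ¬ ∃ q, MaxHeavy F t q ∧ z ∈ qcube q := by
      rintro ⟨q, hq, hzq⟩
      exact hz (Set.mem_biUnion (show q ∈ S from hq) hzq)
    simp only [g, dif_neg h]
  have hSc : S.Countable := Set.to_countable S
  have hΩm : MeasurableSet (⋃ q ∈ S, qcube q) := MeasurableSet.biUnion hSc fun q _ => hmeas q
  have hdisj : S.PairwiseDisjoint qcube := by
    intro q hq r hr hne
    rw [Function.onFun, Set.disjoint_left]
    intro z hzq hzr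
    exact hne (MaxHeavy.eq_of_mem hq hr hzq hzr)
  have havg : ∀ q ∈ S, ‖avg q‖ ≤ 8 * t := by
    intro q hq
    have h1 := (enorm_integral_le_lintegral_enorm (μ := volume.restrict (qcube q)) f).trans
      (MaxHeavy.lintegral_le ht hq)
    have h2 : ‖∫ w in qcube q, f w‖ ≤ 8 * t * (volume (qcube q)).toReal := by
      have := ENNReal.toReal_mono (ENNReal.mul_ne_top ENNReal.ofReal_ne_top (hvol q)) h1
      rwa [toReal_enorm, ENNReal.toReal_mul, ENNReal.toReal_ofReal (by positivity)] at this
    have h3 : 0 < (volume (qcube q)).toReal := ENNReal.toReal_pos (hvol0 q) (hvol q)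
    simp only [avg, setAverage_eq, norm_smul, norm_inv, Real.norm_eq_abs, measureReal_def,
      abs_of_pos h3]
    rw [inv_mul_le_iff₀ h3]
    linarith
  refine ⟨S, g, hdisj, ?_, ?_, ?_, ?_, ?_, ?_⟩
  · intro s hs
    have : g ⁻¹' s = ((⋃ q ∈ S, qcube q)ᶜ ∩ f ⁻¹' s) ∪
        ⋃ q ∈ {q ∈ S | avg q ∈ s}, qcube q := by
      ext z
      by_cases hz : z ∈ ⋃ q ∈ S, qcube q
      · obtain ⟨q, hq, hzq⟩ := Set.mem_iUnion₂.1 hz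
        simp only [Set.mem_preimage, hgq q hq z hzq, Set.mem_union, Set.mem_inter_iff,
          Set.mem_compl_iff, hz, not_true, false_and, false_or, Set.mem_iUnion₂]
        constructor
        · intro h; exact ⟨q, ⟨hq, h⟩, hzq⟩
        · rintro ⟨r, ⟨hr, hrs⟩, hzr⟩
          rwa [MaxHeavy.eq_of_mem hq hr hzq hzr]
      · simp only [Set.mem_preimage, hgo z hz, Set.mem_union, Set.mem_inter_iff,
          Set.mem_compl_iff, hz, not_false_eq_true, true_and]
        constructor
        · exact Or.inl
        · rintro (h | h)
          · exact h
          · obtain ⟨r, hr, hzr⟩ := Set.mem_iUnion₂.1 h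
            exact absurd (Set.mem_biUnion hr.1 hzr) hz
    rw [this]
    exact (hΩm.compl.inter (hf.measurable hs)).union
      (MeasurableSet.biUnion (Set.to_countable _) fun q _ => hmeas q)
  · intro q hq
    have e : ∫ w in qcube q, (f w - g w) = ∫ w in qcube q, (f w - avg q) :=
      setIntegral_congr_fun (hmeas q) fun w hw => by rw [hgq q hq w hw]
    have : IsFiniteMeasure (volume.restrict (qcube q)) := ⟨by
      rw [Measure.restrict_apply_univ]; exact (hvol q).lt_top⟩
    rw [e, integral_sub hfi.integrableOn (integrableOn_const (hvol q))]
    exact sub_eq_zero.2 (integral_average (volume.restrict (qcube q)) f).symm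
  · intro z hz
    refine ⟨hgo z hz, ?_⟩
    have : F z ≤ ENNReal.ofReal t := by
      refine le_of_not_heavy hFc fun j hj => hz ?_
      obtain ⟨q, hq, hzq⟩ := exists_maxHeavy ht hFi hj
      exact Set.mem_biUnion (show q ∈ S from hq) hzq
    simp only [hFdef, ← ofReal_norm] at this
    exact (ENNReal.ofReal_le_ofReal_iff ht.le).1 this
  · intro z hz
    obtain ⟨q, hq, hzq⟩ := Set.mem_iUnion₂.1 hz
    rw [hgq q hq z hzq]
    exact havg q hq
  · intro q hq
    calc ∫⁻ w in qcube q, ‖f w - g w‖ₑ ≤ ∫⁻ w in qcube q, (F w + ENNReal.ofReal (8 * t)) := by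
          refine setLIntegral_mono' (hmeas q) fun w hw => ?_
          refine (enorm_sub_le).trans (add_le_add le_rfl ?_)
          rw [hgq q hq w hw, ← ofReal_norm]
          exact ENNReal.ofReal_le_ofReal (havg q hq)
      _ = (∫⁻ w in qcube q, F w) + ENNReal.ofReal (8 * t) * volume (qcube q) := by
          rw [lintegral_add_right _ measurable_const]; simp
      _ ≤ ENNReal.ofReal (8 * t) * volume (qcube q) + ENNReal.ofReal (8 * t) * volume (qcube q) := by
          gcongr; exact MaxHeavy.lintegral_le ht hq
      _ = _ := by
          rw [← add_mul, ← ENNReal.ofReal_add (by positivity) (by positivity)]; congr 2; ring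
  · have hE : {w | t / 2 < ‖f w‖} = {w | ENNReal.ofReal (t / 2) < F w} := by
      ext w
      simp only [Set.mem_ofPred_eq, hFdef, ← ofReal_norm]
      rw [ENNReal.ofReal_lt_ofReal_iff_of_nonneg (by positivity)]
    have hEm : MeasurableSet {w | ENNReal.ofReal (t / 2) < F w} :=
      measurableSet_lt measurable_const hFc.measurable
    rw [hE]
    have : Countable S := hSc.to_subtype
    calc volume (⋃ q ∈ S, qcube q) ≤ ∑' q : S, volume (qcube q) := measure_biUnion_le _ hSc _
      _ ≤ ∑' q : S, ENNReal.ofReal (2 / t) *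
            ∫⁻ w in qcube q ∩ {w | ENNReal.ofReal (t / 2) < F w}, F w :=
          ENNReal.tsum_le_tsum fun q => MaxHeavy.volume_le hFc.measurable ht q.2
      _ = ENNReal.ofReal (2 / t) *
            ∫⁻ w in ⋃ q : S, (qcube q ∩ {w | ENNReal.ofReal (t / 2) < F w}), F w := by
          rw [ENNReal.tsum_mul_left, lintegral_iUnion]
          · exact fun q => (hmeas q).inter hEm
          · intro q r hqr
            exact (hdisj q.2 r.2 (fun h => hqr (Subtype.ext h))).mono
              Set.inter_subset_left Set.inter_subset_left
      _ ≤ _ := by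
          gcongr
          exact Set.iUnion_subset fun q => Set.inter_subset_right

/-- The parabolic Hörmander condition. -/
def Hor (k : ℝ × ℝ → ℂ) (L A : ℝ) : Prop :=
  ∀ (j : ℤ) (u : ℝ × ℝ), |u.1| ≤ 2 ^ j → |u.2| ≤ 4 ^ j →
    ∫⁻ z in {z : ℝ × ℝ | L * 2 ^ j < |z.1| ∨ L * 4 ^ j < |z.2|}, ‖k (z - u) - k z‖ₑ
      ≤ ENNReal.ofReal A

/-- The lower left corner of a parabolic dyadic rectangle. -/
def corner (q : ℤ × (ℤ × ℤ)) : ℝ × ℝ := (q.2.1 * 2 ^ q.1, q.2.2 * 4 ^ q.1)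

/-- A dilated parabolic dyadic rectangle. -/
def starBox (L : ℝ) (q : ℤ × (ℤ × ℤ)) : Set (ℝ × ℝ) :=
  Metric.closedBall (corner q).1 (L * 2 ^ q.1) ×ˢ Metric.closedBall (corner q).2 (L * 4 ^ q.1)

theorem measurableSet_star (L : ℝ) (q : ℤ × (ℤ × ℤ)) : MeasurableSet (starBox L q) :=
  Metric.isClosed_closedBall.measurableSet.prod Metric.isClosed_closedBall.measurableSet

theorem volume_star {L : ℝ} (hL : 0 ≤ L) (q : ℤ × (ℤ × ℤ)) :
    volume (starBox L q) = ENNReal.ofReal (4 * L ^ 2) * volume (qcube q) := by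
  have h2 : (0 : ℝ) < 2 ^ q.1 := by positivity
  have h4 : (0 : ℝ) < 4 ^ q.1 := by positivity
  have : (8 : ℝ) ^ q.1 = 2 ^ q.1 * 4 ^ q.1 := by rw [← mul_zpow]; norm_num
  unfold starBox; rw [Measure.volume_eq_prod, Measure.prod_prod, Real.volume_closedBall,
    Real.volume_closedBall, ← ENNReal.ofReal_mul (by positivity), ← Measure.volume_eq_prod, qcube,
    volume_dcube, ← ENNReal.ofReal_mul (by positivity), this]
  congr 1; ring

theorem lintegral_compl_star_le {k : ℝ × ℝ → ℂ} {L A : ℝ} (h : Hor k L A)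
    {q : ℤ × (ℤ × ℤ)} {w : ℝ × ℝ} (hw : w ∈ qcube q) :
    ∫⁻ z in (starBox L q)ᶜ, ‖k (z - w) - k (z - corner q)‖ₑ ≤ ENNReal.ofReal A := by
  have h2 : (0 : ℝ) < 2 ^ q.1 := by positivity
  have h4 : (0 : ℝ) < 4 ^ q.1 := by positivity
  rw [qcube, dcube_eq] at hw
  obtain ⟨⟨h1, h1'⟩, ⟨h3, h3'⟩⟩ := hw
  refine le_trans (le_of_eq ?_) (h q.1 (w - corner q) ?_ ?_)
  · have hm : MeasurableSet {z : ℝ × ℝ | L * 2 ^ q.1 < |z.1| ∨ L * 4 ^ q.1 < |z.2|} :=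
      (measurableSet_lt measurable_const (measurable_fst.abs)).union
        (measurableSet_lt measurable_const (measurable_snd.abs))
    rw [← lintegral_indicator hm, ← lintegral_indicator (measurableSet_star L q).compl,
      ← lintegral_sub_right_eq_self
        (fun z => Set.indicator {z : ℝ × ℝ | L * 2 ^ q.1 < |z.1| ∨ L * 4 ^ q.1 < |z.2|}
          (fun z => ‖k (z - (w - corner q)) - k z‖ₑ) z) (corner q)]
    congr 1; ext z
    by_cases hz : z ∈ (starBox L q)ᶜ
    · rw [Set.indicator_of_mem hz, Set.indicator_of_mem]
      · congr 3; abel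
      · by_contra hcon
        simp only [Set.mem_ofPred_eq, not_or, not_lt] at hcon
        exact hz ⟨by simpa [Real.dist_eq] using hcon.1, by simpa [Real.dist_eq] using hcon.2⟩
    · rw [Set.indicator_of_notMem hz, Set.indicator_of_notMem]
      simp only [Set.mem_compl_iff, not_not] at hz
      simp only [Set.mem_ofPred_eq, not_or, not_lt]
      exact ⟨by simpa [Real.dist_eq] using hz.1, by simpa [Real.dist_eq] using hz.2⟩
  · simp only [corner, Prod.fst_sub]
    rw [abs_of_nonneg (by linarith)]; linarith
  · simp only [corner, Prod.snd_sub]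
    rw [abs_of_nonneg (by linarith)]; linarith

theorem lintegral_cv_bad_le {k b : ℝ × ℝ → ℂ} (hk : Continuous k) (hkc : HasCompactSupport k)
    {L A : ℝ} (h : Hor k L A) {S : Set (ℤ × (ℤ × ℤ))} (hS : S.PairwiseDisjoint qcube)
    (hb : Measurable b) (hbi : Integrable b) (hb0 : ∀ z, z ∉ ⋃ q ∈ S, qcube q → b z = 0)
    (hbq : ∀ q ∈ S, ∫ w in qcube q, b w = 0) :
    ∫⁻ z in (⋃ q ∈ S, starBox L q)ᶜ, ‖cv k b z‖ₑ ≤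
      ENNReal.ofReal A * ∑' q : S, ∫⁻ w in qcube q, ‖b w‖ₑ := by
  have hSc : S.Countable := Set.to_countable S
  have : Countable S := hSc.to_subtype
  have hmeas : ∀ q : ℤ × (ℤ × ℤ), MeasurableSet (qcube q) := fun q => measurableSet_dcube _ _
  obtain ⟨C, hC⟩ := hkc.exists_bound_of_continuous hk
  have hi_int : ∀ z, Integrable fun w => b w * k (z - w) := fun z =>
    hbi.mul_bdd (c := C) (by fun_prop) (ae_of_all _ fun w => hC _)
  have hpt : ∀ z, ‖cv k b z‖ₑ ≤
      ∑' q : S, ∫⁻ w in qcube q, ‖b w‖ₑ * ‖k (z - w) - k (z - corner q)‖ₑ := by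
    intro z
    have e1 : cv k b z = ∑' q : S, ∫ w in qcube q, b w * k (z - w) := by
      rw [cv_eq, ← integral_iUnion (fun q : S => hmeas q)
        (fun q r hqr => hS q.2 r.2 (fun h => hqr (Subtype.ext h))) (hi_int z).integrableOn]
      refine (setIntegral_eq_integral_of_forall_compl_eq_zero fun w hw => ?_).symm
      rw [hb0 w, zero_mul]
      simpa [Set.mem_iUnion] using hw
    have e2 : ∀ q : S, ∫ w in qcube q, b w * k (z - w) =
        ∫ w in qcube q, b w * (k (z - w) - k (z - corner q)) := by
      intro q
      simp only [mul_sub]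
      rw [integral_sub (hi_int z).integrableOn (hbi.integrableOn.mul_const _), integral_mul_const,
        hbq q q.2, zero_mul, sub_zero]
    rw [e1]
    refine (enorm_tsum_le_tsum_enorm).trans (ENNReal.tsum_le_tsum fun q => ?_)
    rw [e2]
    refine (enorm_integral_le_lintegral_enorm _).trans (le_of_eq ?_)
    simp [enorm_mul]
  calc ∫⁻ z in (⋃ q ∈ S, starBox L q)ᶜ, ‖cv k b z‖ₑ
      ≤ ∫⁻ z in (⋃ q ∈ S, starBox L q)ᶜ,
        ∑' q : S, ∫⁻ w in qcube q, ‖b w‖ₑ * ‖k (z - w) - k (z - corner q)‖ₑ :=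
        lintegral_mono fun z => hpt z
    _ = ∑' q : S, ∫⁻ z in (⋃ q ∈ S, starBox L q)ᶜ,
        ∫⁻ w in qcube q, ‖b w‖ₑ * ‖k (z - w) - k (z - corner q)‖ₑ := by
        refine lintegral_tsum fun q => ?_
        refine Measurable.aemeasurable ?_
        refine Measurable.lintegral_prod_right' (f := fun x : (ℝ × ℝ) × (ℝ × ℝ) =>
          ‖b x.2‖ₑ * ‖k (x.1 - x.2) - k (x.1 - corner q)‖ₑ) ?_
        have := hk.measurable
        fun_prop
    _ ≤ ∑' q : S, ∫⁻ z in (starBox L q)ᶜ,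
        ∫⁻ w in qcube q, ‖b w‖ₑ * ‖k (z - w) - k (z - corner q)‖ₑ := by
        refine ENNReal.tsum_le_tsum fun q => lintegral_mono_set ?_
        exact Set.compl_subset_compl.2 (Set.subset_biUnion_of_mem (u := starBox L) q.2)
    _ = ∑' q : S, ∫⁻ w in qcube q, ‖b w‖ₑ *
          ∫⁻ z in (starBox L q)ᶜ, ‖k (z - w) - k (z - corner q)‖ₑ := by
        congr 1; ext q
        have hkm := hk.measurable
        rw [lintegral_lintegral_swap (by fun_prop)]
        congr 1; ext w
        rw [lintegral_const_mul _ (by fun_prop)]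
    _ ≤ ∑' q : S, ∫⁻ w in qcube q, ‖b w‖ₑ * ENNReal.ofReal A := by
        refine ENNReal.tsum_le_tsum fun q => setLIntegral_mono' (hmeas q) fun w hw => ?_
        gcongr
        exact lintegral_compl_star_le h hw
    _ = _ := by
        rw [← ENNReal.tsum_mul_left]
        congr 1; ext q
        rw [lintegral_mul_const _ hb.enorm, mul_comm]

theorem meas_lt_norm_le_div {g : ℝ × ℝ → ℂ} (hg : Measurable g) (μ : Measure (ℝ × ℝ))
    {s : ℝ} (hs : 0 < s) {p : ℝ} (hp : 0 < p) :
    μ {z | s < ‖g z‖} ≤ ENNReal.ofReal (1 / s ^ p) * ∫⁻ z, ‖g z‖ₑ ^ p ∂μ := by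
  have h1 := mul_meas_ge_le_lintegral (μ := μ) (hg.enorm.pow_const p) (ENNReal.ofReal (s ^ p))
  have hsp : 0 < s ^ p := Real.rpow_pos_of_pos hs p
  have h2 : {z | s < ‖g z‖} ⊆ {z | ENNReal.ofReal (s ^ p) ≤ ‖g z‖ₑ ^ p} := by
    intro z hz
    simp only [Set.mem_ofPred_eq] at hz ⊢
    rw [← ofReal_norm, ENNReal.ofReal_rpow_of_nonneg (norm_nonneg _) hp.le]
    exact ENNReal.ofReal_le_ofReal (Real.rpow_le_rpow hs.le hz.le hp.le)
  calc μ {z | s < ‖g z‖} ≤ μ {z | ENNReal.ofReal (s ^ p) ≤ ‖g z‖ₑ ^ p} := measure_mono h2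
    _ = ENNReal.ofReal (1 / s ^ p) * (ENNReal.ofReal (s ^ p) *
          μ {z | ENNReal.ofReal (s ^ p) ≤ ‖g z‖ₑ ^ p}) := by
        rw [← mul_assoc, ← ENNReal.ofReal_mul (by positivity), one_div_mul_cancel hsp.ne']; simp
    _ ≤ _ := by gcongr

theorem lintegral_cv_sq_le {k f : ℝ × ℝ → ℂ} (hk : Measurable k) (hf : Measurable f)
    (hki : Integrable k) (hfi : Integrable f) {B : ℝ} (hB0 : 0 < B)
    (hB : ∀ ξ η, ‖ft k ξ η‖ ≤ B) :
    ∫⁻ z, ‖cv k f z‖ₑ ^ (2 : ℝ) ≤ ENNReal.ofReal (B ^ 2) * ∫⁻ z, ‖f z‖ₑ ^ (2 : ℝ) := by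
  have e2 : ∀ g : ℝ × ℝ → ℂ, eLpNorm g 2 volume = (∫⁻ z, ‖g z‖ₑ ^ (2 : ℝ)) ^ (1 / (2 : ℝ)) := by
    intro g
    rw [← eLpNorm_ofReal_eq (by norm_num)]; norm_num
  by_cases hf2 : MemLp f 2
  · have h := eLpNorm_two_cv_le hk hf hki hfi hf2 hB
    rw [e2, e2] at h
    have h' := ENNReal.rpow_le_rpow h (by norm_num : (0 : ℝ) ≤ 2)
    rw [ENNReal.mul_rpow_of_nonneg _ _ (by norm_num), ← ENNReal.rpow_mul, ← ENNReal.rpow_mul,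
      ENNReal.ofReal_rpow_of_nonneg hB0.le (by norm_num)] at h'
    norm_num at h'
    convert h' using 3 <;> norm_num
  · have htop : ∫⁻ z, ‖f z‖ₑ ^ (2 : ℝ) = ∞ := by
      by_contra hcon
      refine hf2 ⟨hf.aestronglyMeasurable, ?_⟩
      rw [e2]
      exact ENNReal.rpow_lt_top_of_nonneg (by norm_num) hcon
    rw [htop, ENNReal.mul_top (by simpa using hB0.ne')]
    exact le_top

theorem meas_lt_norm_cv_le {k f : ℝ × ℝ → ℂ} (hk : Continuous k) (hkc : HasCompactSupport k)
    (hf : Continuous f) (hfi : Integrable f) {L A B : ℝ} (hL : 0 ≤ L) (hA : 0 ≤ A) (hB0 : 0 < B)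
    (h : Hor k L A) (hB : ∀ ξ η, ‖ft k ξ η‖ ≤ B) {γ τ : ℝ} (hγ : 0 < γ) (hτ : 0 < τ) :
    volume {z | τ < ‖cv k f z‖} ≤
      ENNReal.ofReal ((4 * L ^ 2 + 32 * A * γ + 256 * B ^ 2 * γ ^ 2) * (2 / (γ * τ))) *
        (∫⁻ w in {w | γ * τ / 2 < ‖f w‖}, ‖f w‖ₑ) +
      ENNReal.ofReal (4 * B ^ 2 / τ ^ 2) *
        ∫⁻ w in {w | ‖f w‖ ≤ γ * τ}, ‖f w‖ₑ ^ (2 : ℝ) := by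
  have ht : 0 < γ * τ := by positivity
  obtain ⟨S, g, hS, hg, hmean, hoff, hon, hbad, hvol⟩ := exists_cz_decomposition hf hfi ht
  set Ω := ⋃ q ∈ S, qcube q with hΩ
  set Ω' := ⋃ q ∈ S, starBox L q with hΩ'
  have hSc : S.Countable := Set.to_countable S
  have : Countable S := hSc.to_subtype
  have hmeas : ∀ q : ℤ × (ℤ × ℤ), MeasurableSet (qcube q) := fun q => measurableSet_dcube _ _
  have hΩm : MeasurableSet Ω := MeasurableSet.biUnion hSc fun q _ => hmeas q
  have hΩ'm : MeasurableSet Ω' := MeasurableSet.biUnion hSc fun q _ => measurableSet_star L q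
  have hΩfin : volume Ω < ∞ :=
    hvol.trans_lt (ENNReal.mul_lt_top (by simp)
      ((setLIntegral_le_lintegral _ _).trans_lt hfi.2))
  have hΩsum : ∑' q : S, volume (qcube q) = volume Ω := by
    rw [hΩ, measure_biUnion hSc hS fun q _ => hmeas q]
  have hgi : Integrable g := by
    have h1 : IntegrableOn g Ω :=
      Measure.integrableOn_of_bounded (M := 8 * (γ * τ)) hΩfin.ne hg.aestronglyMeasurable
        ((ae_restrict_iff' hΩm).2 (ae_of_all _ hon))
    have h2 : IntegrableOn g Ωᶜ :=
      (integrableOn_congr_fun (fun z hz => (hoff z hz).1) hΩm.compl).2 hfi.integrableOn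
    rw [← integrableOn_univ, ← Set.union_compl_self Ω]
    exact h1.union h2
  obtain ⟨C, hC⟩ := hkc.exists_bound_of_continuous hk
  have hki : Integrable k := hk.integrable_of_hasCompactSupport hkc
  set b : ℝ × ℝ → ℂ := fun z => f z - g z with hb
  have hbm : Measurable b := hf.measurable.sub hg
  have hbi : Integrable b := hfi.sub hgi
  have hb0 : ∀ z, z ∉ Ω → b z = 0 := fun z hz => by simp [hb, (hoff z hz).1]
  have hadd : ∀ z, cv k f z = cv k b z + cv k g z := by
    intro z
    rw [cv_eq, cv_eq, cv_eq, ← integral_add]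
    · congr 1; ext w; simp only [hb]; ring
    · exact hbi.mul_bdd (c := C) (by fun_prop) (ae_of_all _ fun w => hC _)
    · exact hgi.mul_bdd (c := C) (by fun_prop) (ae_of_all _ fun w => hC _)
  have hsub : {z | τ < ‖cv k f z‖} ⊆ Ω' ∪ ({z | τ / 2 < ‖cv k b z‖} ∩ Ω'ᶜ) ∪
      {z | τ / 2 < ‖cv k g z‖} := by
    intro z hz
    simp only [Set.mem_ofPred_eq, hadd z] at hz
    by_cases h1 : z ∈ Ω'
    · exact Or.inl (Or.inl h1)
    by_cases h2 : τ / 2 < ‖cv k g z‖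
    · exact Or.inr h2
    · refine Or.inl (Or.inr ⟨?_, h1⟩)
      have := norm_add_le (cv k b z) (cv k g z)
      simp only [Set.mem_ofPred_eq]
      linarith
  have hstar : volume Ω' ≤ ENNReal.ofReal (4 * L ^ 2) * volume Ω := by
    refine (measure_biUnion_le _ hSc _).trans (le_of_eq ?_)
    rw [← hΩsum, ← ENNReal.tsum_mul_left]
    exact tsum_congr fun q => volume_star hL q
  have hbadm : volume ({z | τ / 2 < ‖cv k b z‖} ∩ Ω'ᶜ) ≤
      ENNReal.ofReal (32 * A * γ) * volume Ω := by
    have h1 := meas_lt_norm_le_div (measurable_cv hk.measurable hbm) (volume.restrict Ω'ᶜ)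
      (half_pos hτ) one_pos
    rw [Measure.restrict_apply
      (measurableSet_lt measurable_const (measurable_cv hk.measurable hbm).norm)] at h1
    simp only [ENNReal.rpow_one, Real.rpow_one] at h1
    refine h1.trans ?_
    calc _ ≤ ENNReal.ofReal (1 / (τ / 2)) * (ENNReal.ofReal A *
          ∑' q : S, ∫⁻ w in qcube q, ‖b w‖ₑ) := by
          gcongr
          exact lintegral_cv_bad_le hk hkc h hS hbm hbi hb0 hmean
      _ ≤ ENNReal.ofReal (1 / (τ / 2)) * (ENNReal.ofReal A *
          ∑' q : S, ENNReal.ofReal (16 * (γ * τ)) * volume (qcube q)) := by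
          gcongr with q
          exact hbad q q.2
      _ = _ := by
          rw [ENNReal.tsum_mul_left, hΩsum, ← mul_assoc, ← mul_assoc,
            ← ENNReal.ofReal_mul (by positivity), ← ENNReal.ofReal_mul (by positivity)]
          congr 2; field_simp; ring
  have hfE : MeasurableSet {w | ‖f w‖ ≤ γ * τ} :=
    measurableSet_le hf.measurable.norm measurable_const
  have hg2 : ∫⁻ z, ‖g z‖ₑ ^ (2 : ℝ) ≤ ENNReal.ofReal (64 * (γ * τ) ^ 2) * volume Ω +
      ∫⁻ w in {w | ‖f w‖ ≤ γ * τ}, ‖f w‖ₑ ^ (2 : ℝ) := by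
    rw [← lintegral_add_compl _ hΩm]
    refine add_le_add ?_ ?_
    · rw [← setLIntegral_const]
      refine setLIntegral_mono' hΩm fun z hz => ?_
      rw [← ofReal_norm, ENNReal.ofReal_rpow_of_nonneg (norm_nonneg _) (by norm_num)]
      refine ENNReal.ofReal_le_ofReal ?_
      rw [Real.rpow_two]
      calc ‖g z‖ ^ 2 ≤ (8 * (γ * τ)) ^ 2 := by
            have := hon z hz
            gcongr
        _ = _ := by ring
    · calc ∫⁻ z in Ωᶜ, ‖g z‖ₑ ^ (2 : ℝ) = ∫⁻ z in Ωᶜ, ‖f z‖ₑ ^ (2 : ℝ) :=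
            setLIntegral_congr_fun hΩm.compl fun z hz => by simp only [(hoff z hz).1]
        _ ≤ _ := lintegral_mono_set fun z hz => (hoff z hz).2
  have hgood : volume {z | τ / 2 < ‖cv k g z‖} ≤
      ENNReal.ofReal (256 * B ^ 2 * γ ^ 2) * volume Ω + ENNReal.ofReal (4 * B ^ 2 / τ ^ 2) *
        ∫⁻ w in {w | ‖f w‖ ≤ γ * τ}, ‖f w‖ₑ ^ (2 : ℝ) := by
    refine (meas_lt_norm_le_div (measurable_cv hk.measurable hg) volume
      (half_pos hτ) two_pos).trans ?_
    calc _ ≤ ENNReal.ofReal (1 / (τ / 2) ^ (2 : ℝ)) * (ENNReal.ofReal (B ^ 2) *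
          (ENNReal.ofReal (64 * (γ * τ) ^ 2) * volume Ω +
            ∫⁻ w in {w | ‖f w‖ ≤ γ * τ}, ‖f w‖ₑ ^ (2 : ℝ))) := by
          gcongr
          exact (lintegral_cv_sq_le hk.measurable hg hki hgi hB0 hB).trans (by gcongr)
      _ = _ := by
          rw [mul_add, mul_add, ← mul_assoc, ← mul_assoc, ← mul_assoc,
            ← ENNReal.ofReal_mul (by positivity), ← ENNReal.ofReal_mul (by positivity),
            Real.rpow_two]
          congr 3
          · field_simp; ring
          · field_simp; ring
  calc volume {z | τ < ‖cv k f z‖} ≤ _ := measure_mono hsub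
    _ ≤ ENNReal.ofReal (4 * L ^ 2) * volume Ω + ENNReal.ofReal (32 * A * γ) * volume Ω +
        (ENNReal.ofReal (256 * B ^ 2 * γ ^ 2) * volume Ω + ENNReal.ofReal (4 * B ^ 2 / τ ^ 2) *
        ∫⁻ w in {w | ‖f w‖ ≤ γ * τ}, ‖f w‖ₑ ^ (2 : ℝ)) := by
        refine (measure_union_le _ _).trans (add_le_add ?_ hgood)
        exact (measure_union_le _ _).trans (add_le_add hstar hbadm)
    _ = ENNReal.ofReal (4 * L ^ 2 + 32 * A * γ + 256 * B ^ 2 * γ ^ 2) * volume Ω +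
        ENNReal.ofReal (4 * B ^ 2 / τ ^ 2) *
        ∫⁻ w in {w | ‖f w‖ ≤ γ * τ}, ‖f w‖ₑ ^ (2 : ℝ) := by
        rw [ENNReal.ofReal_add (by positivity) (by positivity),
          ENNReal.ofReal_add (by positivity) (by positivity)]
        ring
    _ ≤ _ := by
        rw [ENNReal.ofReal_mul (by positivity), mul_assoc (ENNReal.ofReal _) (ENNReal.ofReal _)]
        gcongr

theorem lintegral_layer_high {f : ℝ × ℝ → ℂ} (hf : Measurable f) {p : ℝ} (hp : 1 < p)
    {γ : ℝ} (hγ : 0 < γ) :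
    ∫⁻ τ in Set.Ioi (0 : ℝ), (∫⁻ w in {w | γ * τ / 2 < ‖f w‖}, ‖f w‖ₑ) *
        ENNReal.ofReal (τ ^ (p - 1 - 1)) =
      ENNReal.ofReal ((2 / γ) ^ (p - 1) / (p - 1)) * ∫⁻ w, ‖f w‖ₑ ^ p := by
  have hp1 : 0 < p - 1 := by linarith
  have h := lintegral_rpow_eq_lintegral_meas_lt_mul (μ := volume.withDensity fun w => ‖f w‖ₑ)
    (f := fun w => 2 / γ * ‖f w‖) (ae_of_all _ fun w => by positivity)
    (hf.norm.const_mul _).aemeasurable hp1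
  have hset : ∀ τ : ℝ, {w | γ * τ / 2 < ‖f w‖} = {w | τ < 2 / γ * ‖f w‖} := by
    intro τ; ext w
    simp only [Set.mem_ofPred_eq]
    rw [div_mul_eq_mul_div, lt_div_iff₀ hγ, div_lt_iff₀ two_pos, mul_comm γ, mul_comm 2]
  have hms : ∀ τ : ℝ, MeasurableSet {w | τ < 2 / γ * ‖f w‖} := fun τ =>
    measurableSet_lt measurable_const (hf.norm.const_mul _)
  simp only [withDensity_apply _ (hms _)] at h
  simp only [hset]
  have hne : ENNReal.ofReal (p - 1) ≠ 0 := by simpa using hp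
  rw [lintegral_withDensity_eq_lintegral_mul _ hf.enorm (by fun_prop)] at h
  rw [← ENNReal.mul_right_inj hne ENNReal.ofReal_ne_top, ← h, ← mul_assoc,
    ← ENNReal.ofReal_mul hp1.le, mul_div_cancel₀ _ hp1.ne', ← lintegral_const_mul _ (by fun_prop)]
  congr 1; ext w
  rw [Pi.mul_apply, Real.mul_rpow (by positivity) (norm_nonneg _),
    ENNReal.ofReal_mul (by positivity), ← ENNReal.ofReal_rpow_of_nonneg (norm_nonneg _) hp1.le,
    ofReal_norm, mul_left_comm]
  congr 1
  nth_rw 1 [← ENNReal.rpow_one ‖f w‖ₑ]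
  rw [← ENNReal.rpow_add_of_nonneg _ _ zero_le_one hp1.le]
  congr 1; ring

theorem lintegral_layer_low {f : ℝ × ℝ → ℂ} (hf : Measurable f) {p : ℝ} (hp : p < 2)
    {γ : ℝ} (hγ : 0 < γ) :
    ∫⁻ τ in Set.Ioi (0 : ℝ), (∫⁻ w in {w | ‖f w‖ ≤ γ * τ}, ‖f w‖ₑ ^ (2 : ℝ)) *
        ENNReal.ofReal (τ ^ (p - 3)) ≤
      ENNReal.ofReal (γ ^ (2 - p) / (2 - p)) * ∫⁻ w, ‖f w‖ₑ ^ p := by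
  have hms : ∀ τ : ℝ, MeasurableSet {w | ‖f w‖ ≤ γ * τ} := fun τ =>
    measurableSet_le hf.norm measurable_const
  have e1 : ∀ τ : ℝ, (∫⁻ w in {w | ‖f w‖ ≤ γ * τ}, ‖f w‖ₑ ^ (2 : ℝ)) *
        ENNReal.ofReal (τ ^ (p - 3)) =
      ∫⁻ w, Set.indicator {x : ℝ × (ℝ × ℝ) | ‖f x.2‖ ≤ γ * x.1}
        (fun x => ‖f x.2‖ₑ ^ (2 : ℝ) * ENNReal.ofReal (x.1 ^ (p - 3))) (τ, w) := by
    intro τ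
    rw [← lintegral_mul_const _ (by fun_prop), ← lintegral_indicator (hms τ)]
    rfl
  have hm : Measurable (Set.indicator {x : ℝ × (ℝ × ℝ) | ‖f x.2‖ ≤ γ * x.1}
        (fun x => ‖f x.2‖ₑ ^ (2 : ℝ) * ENNReal.ofReal (x.1 ^ (p - 3)))) :=
    Measurable.indicator (by fun_prop) (measurableSet_le (by fun_prop) (by fun_prop))
  simp only [e1]
  rw [lintegral_lintegral_swap (f := fun (τ : ℝ) (w : ℝ × ℝ) =>
      Set.indicator {x : ℝ × (ℝ × ℝ) | ‖f x.2‖ ≤ γ * x.1}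
        (fun x => ‖f x.2‖ₑ ^ (2 : ℝ) * ENNReal.ofReal (x.1 ^ (p - 3))) (τ, w)) hm.aemeasurable,
    ← lintegral_const_mul _ (by fun_prop)]
  refine lintegral_mono fun w => ?_
  simp only
  by_cases h0 : f w = 0
  · have : ∀ τ : ℝ, Set.indicator {x : ℝ × (ℝ × ℝ) | ‖f x.2‖ ≤ γ * x.1}
        (fun x => ‖f x.2‖ₑ ^ (2 : ℝ) * ENNReal.ofReal (x.1 ^ (p - 3))) (τ, w) = 0 := by
      intro τ
      simp only [Set.indicator_apply, h0]; simp
    rw [lintegral_congr this, lintegral_zero]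
    exact zero_le
  have hpos : 0 < ‖f w‖ := norm_pos_iff.2 h0
  have hc : 0 < ‖f w‖ / γ := by positivity
  have e2 : ∀ τ : ℝ, Set.indicator {x : ℝ × (ℝ × ℝ) | ‖f x.2‖ ≤ γ * x.1}
        (fun x => ‖f x.2‖ₑ ^ (2 : ℝ) * ENNReal.ofReal (x.1 ^ (p - 3))) (τ, w) =
      Set.indicator (Set.Ici (‖f w‖ / γ))
        (fun τ => ‖f w‖ₑ ^ (2 : ℝ) * ENNReal.ofReal (τ ^ (p - 3))) τ := by
    intro τ
    simp only [Set.indicator_apply, Set.mem_ofPred_eq, Set.mem_Ici, div_le_iff₀ hγ, mul_comm γ]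
  rw [lintegral_congr e2]
  have hi_int : IntegrableOn (fun τ : ℝ => τ ^ (p - 3)) (Set.Ioi (‖f w‖ / γ)) :=
    integrableOn_Ioi_rpow_of_lt (by linarith) hc
  calc _ ≤ ∫⁻ τ, Set.indicator (Set.Ici (‖f w‖ / γ))
        (fun τ => ‖f w‖ₑ ^ (2 : ℝ) * ENNReal.ofReal (τ ^ (p - 3))) τ :=
        setLIntegral_le_lintegral _ _
    _ = ‖f w‖ₑ ^ (2 : ℝ) * ∫⁻ τ in Set.Ioi (‖f w‖ / γ), ENNReal.ofReal (τ ^ (p - 3)) := by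
        rw [lintegral_indicator measurableSet_Ici, lintegral_const_mul _ (by fun_prop),
          setLIntegral_congr Ioi_ae_eq_Ici]
    _ = ‖f w‖ₑ ^ (2 : ℝ) * ENNReal.ofReal ((‖f w‖ / γ) ^ (p - 2) / (2 - p)) := by
        rw [← ofReal_integral_eq_lintegral_ofReal hi_int, integral_Ioi_rpow_of_lt (by linarith) hc]
        · congr 2
          rw [show p - 3 + 1 = p - 2 by ring, neg_div, ← div_neg, neg_sub]
        · filter_upwards [self_mem_ae_restrict measurableSet_Ioi] with τ hτ
          exact Real.rpow_nonneg (hc.le.trans (le_of_lt hτ)) _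
    _ = _ := by
        rw [← ofReal_norm, ENNReal.ofReal_rpow_of_pos hpos, ENNReal.ofReal_rpow_of_pos hpos,
          ← ENNReal.ofReal_mul (by positivity), ← ENNReal.ofReal_mul (by
            have : 0 < 2 - p := by linarith
            positivity)]
        congr 1
        rw [Real.div_rpow hpos.le hγ.le, show 2 - p = -(p - 2) by ring, Real.rpow_neg hγ.le,
          show p = 2 + (p - 2) by ring, Real.rpow_add hpos]
        ring_nf

theorem lintegral_cv_rpow_le_of_hor {k f : ℝ × ℝ → ℂ} (hk : Continuous k)
    (hkc : HasCompactSupport k) (hf : Continuous f) (hfi : Integrable f) {L A B : ℝ} (hL : 0 ≤ L)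
    (hA : 0 ≤ A) (hB0 : 0 < B) (h : Hor k L A) (hB : ∀ ξ η, ‖ft k ξ η‖ ≤ B) {γ : ℝ} (hγ : 0 < γ)
    {p : ℝ} (hp : 1 < p) (hp2 : p < 2) :
    ∫⁻ z, ‖cv k f z‖ₑ ^ p ≤
      ENNReal.ofReal (p * ((4 * L ^ 2 + 32 * A * γ + 256 * B ^ 2 * γ ^ 2) * (2 / γ) *
        ((2 / γ) ^ (p - 1) / (p - 1)) + 4 * B ^ 2 * (γ ^ (2 - p) / (2 - p)))) *
      ∫⁻ z, ‖f z‖ₑ ^ p := by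
  have hp0 : 0 < p := by linarith
  have hp1 : 0 < p - 1 := by linarith
  have hp2' : 0 < 2 - p := by linarith
  set D := 4 * L ^ 2 + 32 * A * γ + 256 * B ^ 2 * γ ^ 2 with hD
  have hD0 : 0 ≤ D := by positivity
  have hm := measurable_cv hk.measurable hf.measurable
  have hmh : Measurable fun τ : ℝ => ∫⁻ w in {w | γ * τ / 2 < ‖f w‖}, ‖f w‖ₑ := by
    have : Antitone fun τ : ℝ => ∫⁻ w in {w | γ * τ / 2 < ‖f w‖}, ‖f w‖ₑ := by
      intro s t hst
      refine lintegral_mono_set fun w hw => ?_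
      simp only [Set.mem_ofPred_eq] at hw ⊢
      nlinarith
    exact this.measurable
  calc ∫⁻ z, ‖cv k f z‖ₑ ^ p = ∫⁻ z, ENNReal.ofReal (‖cv k f z‖ ^ p) := by
        congr 1; ext z
        rw [← ofReal_norm, ENNReal.ofReal_rpow_of_nonneg (norm_nonneg _) hp0.le]
    _ = ENNReal.ofReal p * ∫⁻ τ in Set.Ioi (0 : ℝ), volume {z | τ < ‖cv k f z‖} *
          ENNReal.ofReal (τ ^ (p - 1)) :=
        lintegral_rpow_eq_lintegral_meas_lt_mul _ (ae_of_all _ fun z => norm_nonneg _)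
          hm.norm.aemeasurable hp0
    _ ≤ ENNReal.ofReal p * ∫⁻ τ in Set.Ioi (0 : ℝ), (ENNReal.ofReal (D * (2 / γ)) *
          ((∫⁻ w in {w | γ * τ / 2 < ‖f w‖}, ‖f w‖ₑ) * ENNReal.ofReal (τ ^ (p - 1 - 1))) +
          ENNReal.ofReal (4 * B ^ 2) * ((∫⁻ w in {w | ‖f w‖ ≤ γ * τ}, ‖f w‖ₑ ^ (2 : ℝ)) *
          ENNReal.ofReal (τ ^ (p - 3)))) := by
        gcongr ENNReal.ofReal p * ?_
        refine setLIntegral_mono' measurableSet_Ioi fun τ hτ => ?_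
        have hτ : 0 < τ := hτ
        refine (mul_le_mul_left (meas_lt_norm_cv_le hk hkc hf hfi hL hA hB0 h hB hγ hτ)
          _).trans (le_of_eq ?_)
        rw [add_mul, ← hD]
        congr 1
        · rw [mul_right_comm, ← ENNReal.ofReal_mul (by positivity), mul_comm (∫⁻ _ in _, _),
            ← mul_assoc, ← ENNReal.ofReal_mul (by positivity), Real.rpow_sub_one hτ.ne' (p - 1)]
          congr 2; field_simp
        · rw [mul_right_comm, ← ENNReal.ofReal_mul (by positivity), mul_comm (∫⁻ _ in _, _),
            ← mul_assoc, ← ENNReal.ofReal_mul (by positivity),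
            show p - 3 = p - 1 - (2 : ℕ) by push_cast; ring, Real.rpow_sub_natCast hτ.ne']
          congr 2; field_simp
    _ = ENNReal.ofReal p * (ENNReal.ofReal (D * (2 / γ)) *
          (ENNReal.ofReal ((2 / γ) ^ (p - 1) / (p - 1)) * ∫⁻ w, ‖f w‖ₑ ^ p) +
          ENNReal.ofReal (4 * B ^ 2) * ∫⁻ τ in Set.Ioi (0 : ℝ),
          (∫⁻ w in {w | ‖f w‖ ≤ γ * τ}, ‖f w‖ₑ ^ (2 : ℝ)) * ENNReal.ofReal (τ ^ (p - 3))) := by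
        rw [lintegral_add_left (by fun_prop), lintegral_const_mul _ (by fun_prop),
          lintegral_const_mul' _ _ ENNReal.ofReal_ne_top, lintegral_layer_high hf.measurable hp hγ]
    _ ≤ ENNReal.ofReal p * (ENNReal.ofReal (D * (2 / γ)) *
          (ENNReal.ofReal ((2 / γ) ^ (p - 1) / (p - 1)) * ∫⁻ w, ‖f w‖ₑ ^ p) +
          ENNReal.ofReal (4 * B ^ 2) *
          (ENNReal.ofReal (γ ^ (2 - p) / (2 - p)) * ∫⁻ w, ‖f w‖ₑ ^ p)) := by
        gcongr
        exact lintegral_layer_low hf.measurable hp2 hγ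
    _ = _ := by
        rw [← mul_assoc, ← mul_assoc, ← add_mul, ← mul_assoc, ← ENNReal.ofReal_mul (by positivity),
          ← ENNReal.ofReal_mul (by positivity), ← ENNReal.ofReal_add (by positivity)
            (by positivity), ← ENNReal.ofReal_mul (by positivity)]

/-- The class of test functions: continuous, integrable and bounded. -/
structure Nice (f : ℝ × ℝ → ℂ) : Prop where
  continuous : Continuous f
  integrable : Integrable f
  bounded : ∃ C : ℝ, ∀ z, ‖f z‖ ≤ C

/-- Convolution with `k` is bounded on `L^p` with constant `C`. -/
def LpBound (k : ℝ × ℝ → ℂ) (p C : ℝ) : Prop :=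
  ∀ f, Nice f → eLpNorm (cv k f) (ENNReal.ofReal p) volume
    ≤ ENNReal.ofReal C * eLpNorm f (ENNReal.ofReal p) volume

theorem Nice.cv {k f : ℝ × ℝ → ℂ} (hk : Continuous k) (hkc : HasCompactSupport k) (hf : Nice f) :
    Nice (cv k f) := by
  obtain ⟨C, hC⟩ := hkc.exists_bound_of_continuous hk
  have hki : Integrable k := hk.integrable_of_hasCompactSupport hkc
  have hb : ∀ z w, ‖f w * k (z - w)‖ ≤ C * ‖f w‖ := fun z w => by
    rw [norm_mul, mul_comm]; gcongr; exact hC _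
  refine ⟨?_, integrable_cv hk.measurable hf.continuous.measurable hki hf.integrable,
    ∫ w, C * ‖f w‖, fun z => ?_⟩
  · rw [funext (cv_eq k f)]
    have hfc := hf.continuous
    refine continuous_of_dominated (bound := fun w => C * ‖f w‖) (fun z => ?_)
      (fun z => ae_of_all _ (hb z)) (hf.integrable.norm.const_mul C) (ae_of_all _ fun w => ?_)
    · exact (by fun_prop : Continuous fun w => f w * k (z - w)).aestronglyMeasurable
    · fun_prop
  · rw [cv_eq]
    exact norm_integral_le_of_norm_le (hf.integrable.norm.const_mul C) (ae_of_all _ (hb z))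

theorem hor_comp_neg {k : ℝ × ℝ → ℂ} {L A : ℝ} (h : Hor k L A) : Hor (fun z => k (-z)) L A := by
  intro j u h1 h2
  refine le_trans (le_of_eq ?_) (h j (-u) (by simpa using h1) (by simpa using h2))
  have hm : MeasurableSet {z : ℝ × ℝ | L * 2 ^ j < |z.1| ∨ L * 4 ^ j < |z.2|} :=
    (measurableSet_lt measurable_const (measurable_fst.abs)).union
      (measurableSet_lt measurable_const (measurable_snd.abs))
  rw [← lintegral_indicator hm, ← lintegral_indicator hm, ← lintegral_neg_eq_self]
  congr 1; ext z
  simp [Set.indicator_apply, add_comm]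

theorem ft_comp_neg (k : ℝ × ℝ → ℂ) (ξ η : ℝ) : ft (fun z => k (-z)) ξ η = ft k (-ξ) (-η) := by
  unfold ft
  rw [← integral_neg_eq_self]
  simp

theorem lintegral_rpow_le_of_dual {k f : ℝ × ℝ → ℂ} (hk : Continuous k)
    (hkc : HasCompactSupport k) (hf : Nice f) {p q C : ℝ} (hpq : p.HolderConjugate q) (hp : 2 < p)
    (h : LpBound (fun z => k (-z)) q C) :
    ∫⁻ z, ‖cv k f z‖ₑ ^ p ≤
      (∫⁻ z, ‖f z‖ₑ ^ p) ^ (1 / p) * (ENNReal.ofReal C * (∫⁻ z, ‖cv k f z‖ₑ ^ p) ^ (1 / q)) := by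
  have hp0 : 0 < p := by linarith
  have hq0 : 0 < q := hpq.symm.pos
  obtain ⟨hhc, hhi, M, hM⟩ := hf.cv hk hkc
  have hki : Integrable k := hk.integrable_of_hasCompactSupport hkc
  obtain ⟨Ck, hCk⟩ := hkc.exists_bound_of_continuous hk
  set H := cv k f with hH
  have hM0 : 0 ≤ M := (norm_nonneg _).trans (hM 0)
  set g : ℝ × ℝ → ℂ := fun z => ((‖H z‖ ^ (p - 2) : ℝ) : ℂ) * (starRingEnd ℂ) (H z) with hg
  have hgn : ∀ z, ‖g z‖ = ‖H z‖ ^ (p - 1) := by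
    intro z
    simp only [hg, norm_mul, Complex.norm_real, RCLike.norm_conj, Real.norm_eq_abs]
    rw [abs_of_nonneg (Real.rpow_nonneg (norm_nonneg _) _),
      ← Real.rpow_add_one' (norm_nonneg _) (by linarith)]
    congr 1; ring
  have hgc : Continuous g := by
    have : Continuous fun z => ‖H z‖ ^ (p - 2) :=
      hhc.norm.rpow_const fun z => Or.inr (by linarith)
    exact (Complex.continuous_ofReal.comp this).mul (Complex.continuous_conj.comp hhc)
  have hgi : Integrable g := by
    refine Integrable.mono' (g := fun z => M ^ (p - 2) * ‖H z‖) (hhi.norm.const_mul _)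
      hgc.aestronglyMeasurable (ae_of_all _ fun z => ?_)
    rw [hgn, show p - 1 = (p - 2) + 1 by ring, Real.rpow_add_one' (norm_nonneg _) (by linarith)]
    gcongr
    · exact hM z
  have hgN : Nice g := ⟨hgc, hgi, M ^ (p - 1), fun z => by
    rw [hgn]; exact Real.rpow_le_rpow (norm_nonneg _) (hM z) (by linarith)⟩
  have hgp : ∀ z, ‖g z‖ₑ ^ q = ‖H z‖ₑ ^ p := by
    intro z
    rw [← ofReal_norm, ← ofReal_norm, hgn, ENNReal.ofReal_rpow_of_nonneg
      (Real.rpow_nonneg (norm_nonneg _) _) hq0.le, ENNReal.ofReal_rpow_of_nonneg (norm_nonneg _)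
      hp0.le, ← Real.rpow_mul (norm_nonneg _), hpq.sub_one_mul_conj]
  have hHg : ∀ z, H z * g z = ((‖H z‖ ^ p : ℝ) : ℂ) := by
    intro z
    simp only [hg]
    rw [mul_left_comm, Complex.mul_conj, ← Complex.ofReal_mul, Complex.normSq_eq_norm_sq,
      ← Real.rpow_two, ← Real.rpow_add' (norm_nonneg _) (by linarith)]
    congr 2; ring
  have e1 : ∫⁻ z, ‖H z‖ₑ ^ p = ‖∫ z, H z * g z‖ₑ := by
    simp only [hHg]
    have hHp : Integrable fun z => ‖H z‖ ^ p := by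
      have : Integrable fun z => H z * g z := hgi.bdd_mul (c := M) hhc.aestronglyMeasurable
        (ae_of_all _ hM)
      simp only [hHg] at this
      simpa using this.re
    rw [integral_complex_ofReal, ← ofReal_norm, Complex.norm_real, Real.norm_eq_abs,
      abs_of_nonneg (integral_nonneg fun z => Real.rpow_nonneg (norm_nonneg _) _),
      ofReal_integral_eq_lintegral_ofReal hHp
        (ae_of_all _ fun z => Real.rpow_nonneg (norm_nonneg _) _)]
    congr 1; ext z
    rw [← ofReal_norm, ENNReal.ofReal_rpow_of_nonneg (norm_nonneg _) hp0.le]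
  have e2 : ∫ z, H z * g z = ∫ w, f w * cv (fun z => k (-z)) g w := by
    have hsw : Integrable (Function.uncurry fun z w : ℝ × ℝ => f w * k (z - w) * g z)
        (volume.prod volume) := by
      have : Integrable (fun x : (ℝ × ℝ) × (ℝ × ℝ) => (g x.1 * f x.2) * k (x.1 - x.2))
          (volume.prod volume) :=
        (hgi.mul_prod hf.integrable).mul_bdd (c := Ck)
          (by fun_prop) (ae_of_all _ fun x => hCk _)
      refine this.congr (ae_of_all _ fun x => ?_)
      simp only [Function.uncurry]; ring
    calc ∫ z, H z * g z = ∫ z, ∫ w, f w * k (z - w) * g z := by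
          congr 1; ext z; rw [hH, cv_eq, integral_mul_const]
      _ = ∫ w, ∫ z, f w * k (z - w) * g z := integral_integral_swap hsw
      _ = _ := by
          congr 1; ext w
          rw [cv_eq, ← integral_const_mul]
          congr 1; ext z; rw [neg_sub]; ring
  have hkm : Measurable fun z => k (-z) := (hk.comp continuous_neg).measurable
  have hdual := h g hgN
  rw [eLpNorm_ofReal_eq hq0, eLpNorm_ofReal_eq hq0] at hdual
  simp only [hgp] at hdual
  calc ∫⁻ z, ‖H z‖ₑ ^ p ≤ ∫⁻ w, ‖f w‖ₑ * ‖cv (fun z => k (-z)) g w‖ₑ := by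
        rw [e1, e2]
        refine (enorm_integral_le_lintegral_enorm _).trans (le_of_eq ?_)
        simp [enorm_mul]
    _ ≤ (∫⁻ z, ‖f z‖ₑ ^ p) ^ (1 / p) *
          (∫⁻ z, ‖cv (fun z => k (-z)) g z‖ₑ ^ q) ^ (1 / q) :=
        ENNReal.lintegral_mul_le_Lp_mul_Lq _ hpq hf.continuous.measurable.enorm.aemeasurable
          (measurable_cv hkm hgc.measurable).enorm.aemeasurable
    _ ≤ _ := by gcongr

theorem LpBound.of_dual {k : ℝ × ℝ → ℂ} (hk : Continuous k)
    (hkc : HasCompactSupport k) {p q C : ℝ} (hpq : p.HolderConjugate q) (hp : 2 < p)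
    (h : LpBound (fun z => k (-z)) q C) : LpBound k p C := by
  intro f hf
  have hp0 : 0 < p := by linarith
  have hq0 : 0 < q := hpq.symm.pos
  have key := lintegral_rpow_le_of_dual hk hkc hf hpq hp h
  rw [eLpNorm_ofReal_eq hp0, eLpNorm_ofReal_eq hp0]
  obtain ⟨hhc, hhi, M, hM⟩ := hf.cv hk hkc
  have hM0 : 0 ≤ M := (norm_nonneg _).trans (hM 0)
  set X := ∫⁻ z, ‖cv k f z‖ₑ ^ p with hX
  have hXt : X ≠ ∞ := by
    refine ne_of_lt (lt_of_le_of_lt (b := ENNReal.ofReal (M ^ (p - 1)) * ∫⁻ z, ‖cv k f z‖ₑ) ?_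
      (ENNReal.mul_lt_top (by simp) hhi.2))
    rw [← lintegral_const_mul _ hhc.measurable.enorm]
    refine lintegral_mono fun z => ?_
    rw [← ofReal_norm, ENNReal.ofReal_rpow_of_nonneg (norm_nonneg _) hp0.le,
      ← ENNReal.ofReal_mul (by positivity)]
    refine ENNReal.ofReal_le_ofReal ?_
    nth_rw 1 [show p = (p - 1) + 1 by ring]
    rw [Real.rpow_add_one' (norm_nonneg _) (by linarith)]
    have := hM z
    gcongr
    linarith
  rcases eq_or_ne X 0 with h0 | h0
  · rw [h0, ENNReal.zero_rpow_of_pos (by positivity)]; exact zero_le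
  have hXq0 : X ^ (1 / q) ≠ 0 := by
    simp only [ne_eq, ENNReal.rpow_eq_zero_iff, h0, hXt, false_and, or_false, not_false_eq_true]
  have hXqt : X ^ (1 / q) ≠ ∞ := ENNReal.rpow_ne_top_of_nonneg (by positivity) hXt
  have hsplit : X = X ^ (1 / p) * X ^ (1 / q) := by
    rw [← ENNReal.rpow_add _ _ h0 hXt, one_div, one_div, hpq.inv_add_inv_eq_one, ENNReal.rpow_one]
  rw [← ENNReal.mul_le_mul_iff_left hXq0 hXqt, ← hsplit]
  refine key.trans (le_of_eq ?_)
  ring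

theorem lpBound_two {k : ℝ × ℝ → ℂ} (hk : Continuous k) (hkc : HasCompactSupport k) {B : ℝ}
    (hB : ∀ ξ η, ‖ft k ξ η‖ ≤ B) : LpBound k 2 B := by
  intro f hf
  obtain ⟨C, hC⟩ := hf.bounded
  have hf2 : MemLp f 2 := by
    rw [memLp_two_iff_integrable_sq_norm hf.continuous.aestronglyMeasurable]
    simp only [pow_two]
    exact hf.integrable.norm.mul_bdd (c := C) hf.continuous.norm.aestronglyMeasurable
      (ae_of_all _ fun z => by simpa using hC z)
  simpa using eLpNorm_two_cv_le hk.measurable hf.continuous.measurable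
    (hk.integrable_of_hasCompactSupport hkc) hf.integrable hf2 hB

theorem exists_lpBound_decay_lt_two {p : ℝ} (hp : 1 < p) (hp2 : p < 2) {L B : ℝ} (hL : 0 ≤ L)
    (hB : 0 < B) {A : ℝ → ℝ} (hA : ∀ ε, 0 ≤ A ε) :
    ∃ C δ : ℝ, 0 ≤ C ∧ 0 < δ ∧ ∀ (n : ℕ) (k : ℝ × ℝ → ℂ), Continuous k → HasCompactSupport k →
      (∀ ε, 0 < ε → ε ≤ 1 → Hor k L (A ε * 2 ^ (ε * n))) →
      (∀ ξ η, ‖ft k ξ η‖ ≤ B * 2 ^ (-(n : ℝ) / 4)) →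
      LpBound k p (C * 2 ^ (-δ * n)) := by
  have hp0 : 0 < p := by linarith
  have hp1 : 0 < p - 1 := by linarith
  have hp2' : 0 < 2 - p := by linarith
  set ε := (p - 1) / 16 with hε
  set D₀ := 4 * L ^ 2 + 32 * A ε + 256 * B ^ 2 with hD₀
  have hAε := hA ε
  set C₀ := p * (D₀ * 2 * (2 ^ (p - 1) / (p - 1)) + 4 * B ^ 2 / (2 - p)) with hC₀
  have hC₀0 : 0 ≤ C₀ := by positivity
  refine ⟨C₀ ^ (1 / p), (p - 1) / (16 * p), by positivity, by positivity, ?_⟩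
  intro n k hk hkc hH hF f hf
  have hfc := hf.continuous
  set γ : ℝ := 2 ^ ((n : ℝ) / 8) with hγ
  have hγ1 : 1 ≤ γ := Real.one_le_rpow (by norm_num) (by positivity)
  have hγ0 : 0 < γ := by positivity
  have hpow : ∀ s : ℝ, γ ^ s = 2 ^ ((n : ℝ) / 8 * s) := fun s => by
    rw [hγ, ← Real.rpow_mul (by norm_num)]
  have hAn : A ε * 2 ^ (ε * n) = A ε * γ ^ ((p - 1) / 2) := by
    rw [hpow]; congr 2; rw [hε]; ring
  have hBn : B * 2 ^ (-(n : ℝ) / 4) = B * γ ^ (-2 : ℝ) := by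
    rw [hpow]; congr 2; ring
  have h1 := lintegral_cv_rpow_le_of_hor hk hkc hf.continuous hf.integrable hL
    (A := A ε * γ ^ ((p - 1) / 2)) (B := B * γ ^ (-2 : ℝ)) (by positivity)
    (by positivity) (hAn ▸ hH ε (by positivity) (by rw [hε]; linarith))
    (fun ξ η => (hF ξ η).trans_eq hBn) hγ0 hp hp2
  have hsq : (γ ^ (-2 : ℝ)) ^ 2 = γ ^ (-4 : ℝ) := by
    rw [← Real.rpow_natCast, ← Real.rpow_mul hγ0.le]; norm_num
  have hle : ∀ s : ℝ, s ≤ (p + 1) / 2 → γ ^ s ≤ γ ^ ((p + 1) / 2) := fun s hs =>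
    Real.rpow_le_rpow_of_exponent_le hγ1 hs
  have hD : 4 * L ^ 2 + 32 * (A ε * γ ^ ((p - 1) / 2)) * γ +
      256 * (B * γ ^ (-2 : ℝ)) ^ 2 * γ ^ 2 ≤ D₀ * γ ^ ((p + 1) / 2) := by
    have e1 := hle 0 (by linarith)
    have e2 : γ ^ ((p - 1) / 2) * γ = γ ^ ((p + 1) / 2) := by
      rw [← Real.rpow_add_one hγ0.ne']; congr 1; ring
    have e3 : γ ^ (-4 : ℝ) * γ ^ 2 ≤ γ ^ ((p + 1) / 2) := by
      rw [← Real.rpow_natCast, ← Real.rpow_add hγ0]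
      exact hle _ (by push_cast; linarith)
    rw [Real.rpow_zero] at e1
    calc _ = 4 * L ^ 2 * 1 + 32 * A ε * (γ ^ ((p - 1) / 2) * γ) +
          256 * B ^ 2 * (γ ^ (-4 : ℝ) * γ ^ 2) := by rw [mul_pow, hsq]; ring
      _ ≤ 4 * L ^ 2 * γ ^ ((p + 1) / 2) + 32 * A ε * γ ^ ((p + 1) / 2) +
          256 * B ^ 2 * γ ^ ((p + 1) / 2) := by rw [e2]; gcongr
      _ = _ := by rw [hD₀]; ring
  have hfin : p * ((4 * L ^ 2 + 32 * (A ε * γ ^ ((p - 1) / 2)) * γ +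
      256 * (B * γ ^ (-2 : ℝ)) ^ 2 * γ ^ 2) * (2 / γ) * ((2 / γ) ^ (p - 1) / (p - 1)) +
      4 * (B * γ ^ (-2 : ℝ)) ^ 2 * (γ ^ (2 - p) / (2 - p))) ≤ C₀ * γ ^ (-(p - 1) / 2) := by
    have e1 : γ ^ ((p + 1) / 2) * (2 / γ) * ((2 / γ) ^ (p - 1) / (p - 1)) =
        2 * (2 ^ (p - 1) / (p - 1)) * γ ^ (-(p - 1) / 2) := by
      rw [Real.div_rpow (by norm_num) hγ0.le,
        show -(p - 1) / 2 = (p + 1) / 2 - 1 - (p - 1) by ring, Real.rpow_sub hγ0 ((p + 1) / 2 - 1) (p - 1),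
        Real.rpow_sub hγ0 ((p + 1) / 2) 1, Real.rpow_one]
      generalize γ ^ ((p + 1) / 2) = a
      generalize γ ^ (p - 1) = b
      ring
    have e2 : γ ^ (-4 : ℝ) * γ ^ (2 - p) ≤ γ ^ (-(p - 1) / 2) := by
      rw [← Real.rpow_add hγ0]
      exact Real.rpow_le_rpow_of_exponent_le hγ1 (by linarith)
    calc _ ≤ p * (D₀ * γ ^ ((p + 1) / 2) * (2 / γ) * ((2 / γ) ^ (p - 1) / (p - 1)) +
          4 * (B * γ ^ (-2 : ℝ)) ^ 2 * (γ ^ (2 - p) / (2 - p))) := by gcongr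
      _ = p * (D₀ * (γ ^ ((p + 1) / 2) * (2 / γ) * ((2 / γ) ^ (p - 1) / (p - 1))) +
          4 * B ^ 2 / (2 - p) * (γ ^ (-4 : ℝ) * γ ^ (2 - p))) := by rw [mul_pow, hsq]; ring
      _ ≤ p * (D₀ * (2 * (2 ^ (p - 1) / (p - 1)) * γ ^ (-(p - 1) / 2)) +
          4 * B ^ 2 / (2 - p) * γ ^ (-(p - 1) / 2)) := by rw [e1]; gcongr
      _ = _ := by rw [hC₀]; ring
  rw [eLpNorm_ofReal_eq hp0, eLpNorm_ofReal_eq hp0]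
  have h2 := h1.trans (mul_le_mul_left (ENNReal.ofReal_le_ofReal hfin) _)
  have h3 := ENNReal.rpow_le_rpow h2 (by positivity : 0 ≤ 1 / p)
  rw [ENNReal.mul_rpow_of_nonneg _ _ (by positivity),
    ENNReal.ofReal_rpow_of_nonneg (by positivity) (by positivity),
    Real.mul_rpow hC₀0 (by positivity), ← Real.rpow_mul hγ0.le, hpow] at h3
  convert h3 using 5
  field_simp
  ring

theorem exists_lpBound_decay {p : ℝ} (hp : 1 < p) {L B : ℝ} (hL : 0 ≤ L)
    (hB : 0 < B) {A : ℝ → ℝ} (hA : ∀ ε, 0 ≤ A ε) :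
    ∃ C δ : ℝ, 0 ≤ C ∧ 0 < δ ∧ ∀ (n : ℕ) (k : ℝ × ℝ → ℂ), Continuous k → HasCompactSupport k →
      (∀ ε, 0 < ε → ε ≤ 1 → Hor k L (A ε * 2 ^ (ε * n))) →
      (∀ ξ η, ‖ft k ξ η‖ ≤ B * 2 ^ (-(n : ℝ) / 4)) →
      LpBound k p (C * 2 ^ (-δ * n)) := by
  rcases lt_trichotomy p 2 with h2 | rfl | h2
  · exact exists_lpBound_decay_lt_two hp h2 hL hB hA
  · refine ⟨B, 1 / 4, hB.le, by norm_num, fun n k hk hkc _ hF => ?_⟩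
    rw [show -(1 / 4 : ℝ) * n = -(n : ℝ) / 4 by ring]
    exact lpBound_two hk hkc hF
  · have hpq : p.HolderConjugate (p.conjExponent) := Real.HolderConjugate.conjExponent hp
    have hq2 : p.conjExponent < 2 := by
      rw [Real.conjExponent, div_lt_iff₀ (by linarith)]; linarith
    obtain ⟨C, δ, hC, hδ, h⟩ := exists_lpBound_decay_lt_two hpq.symm.lt hq2 hL hB hA
    refine ⟨C, δ, hC, hδ, fun n k hk hkc hH hF => ?_⟩
    refine LpBound.of_dual hk hkc hpq h2 (h n _ (hk.comp continuous_neg)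
      (hkc.comp_homeomorph (Homeomorph.neg _)) (fun ε h1 h2 => hor_comp_neg (hH ε h1 h2))
      fun ξ η => ?_)
    rw [ft_comp_neg]
    exact hF _ _

/-- A Lipschitz function adapted to the rectangle `|x| ≤ r`, `|y| ≤ s` and normalized in `L¹`. -/
structure Bump (C r s : ℝ) (F : ℝ → ℝ → ℂ) : Prop where
  continuous : Continuous fun p : ℝ × ℝ => F p.1 p.2
  support : ∀ x y, F x y ≠ 0 → |x| ≤ r ∧ |y| ≤ s
  bound : ∀ x y, ‖F x y‖ ≤ C / (r * s)
  lip_fst : ∀ x x' y, ‖F x y - F x' y‖ ≤ C / (r * s) * (|x - x'| / r)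
  lip_snd : ∀ x y y', ‖F x y - F x y'‖ ≤ C / (r * s) * (|y - y'| / s)

/-- Composition with the parabolic shear. -/
def shear (c : ℝ) (F : ℝ → ℝ → ℂ) (z : ℝ × ℝ) : ℂ := F z.1 (z.2 - c * z.1 ^ 2)

theorem measurePreserving_shear (c : ℝ) :
    MeasurePreserving (fun z : ℝ × ℝ => (z.1, z.2 - c * z.1 ^ 2)) := by
  refine (MeasurePreserving.id volume).skew_product (g := fun x y => y - c * x ^ 2)
    (by fun_prop) (ae_of_all _ fun x => ?_)
  exact (measurePreserving_sub_right volume (c * x ^ 2)).map_eq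

/-- A sheared rectangle. -/
def shearBox (c r s : ℝ) : Set (ℝ × ℝ) :=
  (fun z : ℝ × ℝ => (z.1, z.2 - c * z.1 ^ 2)) ⁻¹'
    (Metric.closedBall (0 : ℝ) r ×ˢ Metric.closedBall (0 : ℝ) s)

theorem isClosed_shearBox (c r s : ℝ) : IsClosed (shearBox c r s) :=
  (Metric.isClosed_closedBall.prod Metric.isClosed_closedBall).preimage (by fun_prop)

theorem mem_shearBox {c r s : ℝ} {z : ℝ × ℝ} :
    z ∈ shearBox c r s ↔ |z.1| ≤ r ∧ |z.2 - c * z.1 ^ 2| ≤ s := by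
  simp [shearBox]

theorem volume_shearBox (c : ℝ) {r s : ℝ} (hr : 0 ≤ r) :
    volume (shearBox c r s) = ENNReal.ofReal (4 * (r * s)) := by
  rw [shearBox, (measurePreserving_shear c).measure_preimage
    (Metric.isClosed_closedBall.measurableSet.prod
      Metric.isClosed_closedBall.measurableSet).nullMeasurableSet, Measure.volume_eq_prod,
    Measure.prod_prod, Real.volume_closedBall, Real.volume_closedBall,
    ← ENNReal.ofReal_mul (by positivity)]
  congr 1; ring

theorem abs_snd_le_of_mem_shearBox {c r s : ℝ} (hc : 0 ≤ c) {z : ℝ × ℝ}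
    (hz : z ∈ shearBox c r s) : |z.2| ≤ s + c * r ^ 2 := by
  obtain ⟨h1, h2⟩ := mem_shearBox.1 hz
  have h3 : z.1 ^ 2 ≤ r ^ 2 := sq_le_sq' (by linarith [neg_abs_le z.1]) ((le_abs_self _).trans h1)
  have h4 := abs_add_le (z.2 - c * z.1 ^ 2) (c * z.1 ^ 2)
  rw [sub_add_cancel] at h4
  rw [abs_of_nonneg (by positivity : 0 ≤ c * z.1 ^ 2)] at h4
  nlinarith [mul_le_mul_of_nonneg_left h3 hc]

theorem lintegral_shear_le_of_support {c r s B : ℝ} {F : ℝ → ℝ → ℂ} (hr : 0 ≤ r) (hB : 0 ≤ B)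
    (hF : ∀ x y, F x y ≠ 0 → |x| ≤ r ∧ |y| ≤ s) (hFB : ∀ x y, ‖F x y‖ ≤ B) :
    ∫⁻ z, ‖shear c F z‖ₑ ≤ ENNReal.ofReal (B * (4 * (r * s))) := by
  calc ∫⁻ z, ‖shear c F z‖ₑ
      ≤ ∫⁻ z, Set.indicator (shearBox c r s) (fun _ => ENNReal.ofReal B) z := by
        refine lintegral_mono fun z => ?_
        by_cases hz : z ∈ shearBox c r s
        · rw [Set.indicator_of_mem hz, ← ofReal_norm]
          exact ENNReal.ofReal_le_ofReal (hFB _ _)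
        · have : shear c F z = 0 := by
            by_contra h
            exact hz (mem_shearBox.2 (hF _ _ h))
          simp [this]
    _ = _ := by
        rw [lintegral_indicator_const (isClosed_shearBox c r s).measurableSet,
          volume_shearBox c hr, ← ENNReal.ofReal_mul hB]

namespace Bump

variable {C r s c : ℝ} {F : ℝ → ℝ → ℂ}

theorem shear_eq_zero (hF : Bump C r s F) {z : ℝ × ℝ} (hz : z ∉ shearBox c r s) :
    shear c F z = 0 := by
  by_contra h
  exact hz (mem_shearBox.2 (hF.support _ _ h))

theorem continuous_shear (hF : Bump C r s F) : Continuous (shear c F) :=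
  hF.continuous.comp (by fun_prop : Continuous fun z : ℝ × ℝ => (z.1, z.2 - c * z.1 ^ 2))

theorem hasCompactSupport_shear (hF : Bump C r s F) (hc : 0 ≤ c) :
    HasCompactSupport (shear c F) := by
  refine HasCompactSupport.intro' (K := shearBox c r s) ?_ (isClosed_shearBox c r s)
    fun z hz => hF.shear_eq_zero hz
  refine ((isCompact_closedBall (0 : ℝ) r).prod
    (isCompact_closedBall (0 : ℝ) (s + c * r ^ 2))).of_isClosed_subset (isClosed_shearBox c r s) ?_
  intro z hz
  exact ⟨by simpa using (mem_shearBox.1 hz).1, by simpa using abs_snd_le_of_mem_shearBox hc hz⟩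

theorem lintegral_shear_le (hF : Bump C r s F) (hr : 0 < r) (hs : 0 < s) (hC : 0 ≤ C) :
    ∫⁻ z, ‖shear c F z‖ₑ ≤ ENNReal.ofReal (4 * C) := by
  refine (lintegral_shear_le_of_support hr.le (by positivity) hF.support hF.bound).trans ?_
  refine ENNReal.ofReal_le_ofReal (le_of_eq ?_)
  field_simp

/-- Pointwise smoothness of a sheared bump at parabolic scale `t`. -/
theorem norm_shear_sub_le (hF : Bump C r s F) (hr : 0 < r) (hs : 0 < s) (hC : 0 ≤ C)
    (hc : 0 ≤ c) {t : ℝ} (htr : t ≤ r) (hrs : s ≤ r ^ 2) {u : ℝ × ℝ} (hu1 : |u.1| ≤ t)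
    (hu2 : |u.2| ≤ t ^ 2) (z : ℝ × ℝ) :
    ‖shear c F (z - u) - shear c F z‖ ≤
      C * (2 + 3 * c) / (r * s) * min 1 (r ^ 2 / s * (t / r)) := by
  have hCrs : 0 ≤ C / (r * s) := by positivity
  have ht0 : 0 ≤ t := (abs_nonneg _).trans hu1
  rw [mul_min_of_nonneg _ _ (by positivity)]
  refine le_min ?_ ?_
  · calc ‖shear c F (z - u) - shear c F z‖ ≤ C / (r * s) + C / (r * s) :=
          (norm_sub_le _ _).trans (add_le_add (hF.bound _ _) (hF.bound _ _))
      _ ≤ C * (2 + 3 * c) / (r * s) * 1 := by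
          rw [mul_one, ← add_div]; gcongr; nlinarith
  by_cases hz : z ∈ shearBox c r s ∨ z - u ∈ shearBox c r s
  · have hx : |2 * z.1 - u.1| ≤ 3 * r := by
      rcases hz with hz | hz
      · have h1 := (mem_shearBox.1 hz).1
        rw [abs_le] at *
        constructor <;> linarith
      · have h1 := (mem_shearBox.1 hz).1
        simp only [Prod.fst_sub] at h1
        rw [abs_le] at *
        constructor <;> linarith
    have hy : |(z.2 - u.2 - c * (z.1 - u.1) ^ 2) - (z.2 - c * z.1 ^ 2)| ≤
        t ^ 2 + c * (t * (3 * r)) := by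
      rw [show (z.2 - u.2 - c * (z.1 - u.1) ^ 2) - (z.2 - c * z.1 ^ 2) =
        -u.2 + c * (u.1 * (2 * z.1 - u.1)) by ring]
      refine (abs_add_le _ _).trans ?_
      rw [abs_neg, abs_mul, abs_mul, abs_of_nonneg hc]
      gcongr
    have h1 := hF.lip_fst (z.1 - u.1) z.1 (z.2 - u.2 - c * (z.1 - u.1) ^ 2)
    have h2 := hF.lip_snd z.1 (z.2 - u.2 - c * (z.1 - u.1) ^ 2) (z.2 - c * z.1 ^ 2)
    have h3 : |z.1 - u.1 - z.1| ≤ t := by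
      rw [show z.1 - u.1 - z.1 = -u.1 by ring, abs_neg]; exact hu1
    calc ‖shear c F (z - u) - shear c F z‖
        ≤ C / (r * s) * (|z.1 - u.1 - z.1| / r) + C / (r * s) *
          (|(z.2 - u.2 - c * (z.1 - u.1) ^ 2) - (z.2 - c * z.1 ^ 2)| / s) := by
          refine le_trans (le_of_eq ?_) ((norm_add_le _ _).trans (add_le_add h1 h2))
          simp [shear]
      _ ≤ C / (r * s) * (t / r) + C / (r * s) * ((t ^ 2 + c * (t * (3 * r))) / s) := by gcongr
      _ = C / (r * s) * (t / r + (t ^ 2 + c * (t * (3 * r))) / s) := by ring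
      _ ≤ C / (r * s) * ((2 + 3 * c) * (r ^ 2 / s * (t / r))) := by
          gcongr
          have e1 : t / r ≤ r ^ 2 / s * (t / r) := by
            have : 1 ≤ r ^ 2 / s := by rwa [one_le_div hs]
            exact le_mul_of_one_le_left (by positivity) this
          have e2 : (t ^ 2 + c * (t * (3 * r))) / s ≤ (1 + 3 * c) * (r ^ 2 / s * (t / r)) := by
            rw [show (1 + 3 * c) * (r ^ 2 / s * (t / r)) = (1 + 3 * c) * (r * t) / s by
              field_simp]
            gcongr
            nlinarith
          linarith
      _ = _ := by ring
  · push Not at hz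
    rw [hF.shear_eq_zero hz.1, hF.shear_eq_zero hz.2]
    simp only [sub_self, norm_zero]
    positivity

theorem lintegral_shear_sub_le (hF : Bump C r s F) (hr : 0 < r) (hs : 0 < s) (hC : 0 ≤ C)
    (hc : 0 ≤ c) {t : ℝ} (htr : t ≤ r) (hrs : s ≤ r ^ 2) {u : ℝ × ℝ} (hu1 : |u.1| ≤ t)
    (hu2 : |u.2| ≤ t ^ 2) :
    ∫⁻ z, ‖shear c F (z - u) - shear c F z‖ₑ ≤
      ENNReal.ofReal (8 * C * (2 + 3 * c) * min 1 (r ^ 2 / s * (t / r))) := by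
  have ht0 : 0 ≤ t := (abs_nonneg _).trans hu1
  set m := min 1 (r ^ 2 / s * (t / r)) with hm
  have hm0 : 0 ≤ m := le_min zero_le_one (by positivity)
  set E := shearBox c r s ∪ (fun z => z - u) ⁻¹' shearBox c r s with hE
  have hmeas := (isClosed_shearBox c r s).measurableSet
  have hEm : MeasurableSet E := hmeas.union (hmeas.preimage (by fun_prop))
  have hEv : volume E ≤ ENNReal.ofReal (8 * (r * s)) := by
    refine (measure_union_le _ _).trans ?_
    rw [(measurePreserving_sub_right volume u).measure_preimage hmeas.nullMeasurableSet,
      volume_shearBox c hr.le, ← ENNReal.ofReal_add (by positivity) (by positivity)]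
    exact ENNReal.ofReal_le_ofReal (by linarith)
  calc ∫⁻ z, ‖shear c F (z - u) - shear c F z‖ₑ
      ≤ ∫⁻ z, Set.indicator E (fun _ => ENNReal.ofReal (C * (2 + 3 * c) / (r * s) * m)) z := by
        refine lintegral_mono fun z => ?_
        by_cases hz : z ∈ E
        · rw [Set.indicator_of_mem hz, ← ofReal_norm]
          exact ENNReal.ofReal_le_ofReal (hF.norm_shear_sub_le hr hs hC hc htr hrs hu1 hu2 z)
        · simp only [hE, Set.mem_union, not_or] at hz
          rw [hF.shear_eq_zero hz.1, hF.shear_eq_zero hz.2]; simp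
    _ = ENNReal.ofReal (C * (2 + 3 * c) / (r * s) * m) * volume E :=
        lintegral_indicator_const hEm _
    _ ≤ ENNReal.ofReal (C * (2 + 3 * c) / (r * s) * m) * ENNReal.ofReal (8 * (r * s)) := by gcongr
    _ = _ := by
        rw [← ENNReal.ofReal_mul (by positivity)]
        congr 1; field_simp

end Bump

theorem sum_geometric_le (S : Finset ℕ) {q : ℝ} (hq : 0 ≤ q) (hq1 : q < 1) :
    ∑ i ∈ S, q ^ i ≤ (1 - q)⁻¹ := by
  rw [← tsum_geometric_of_lt_one hq hq1]
  exact (summable_geometric_of_lt_one hq hq1).sum_le_tsum S fun i _ => by positivity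

theorem sum_int_ge_le (S : Finset ℤ) (j : ℤ) {q : ℝ} (hq : 0 ≤ q) (hq1 : q < 1) :
    ∑ J ∈ S with j ≤ J, q ^ (J - j).toNat ≤ (1 - q)⁻¹ := by
  rw [← Finset.sum_image (s := S.filter fun J => j ≤ J) (g := fun J : ℤ => (J - j).toNat)
    (f := fun i : ℕ => q ^ i)]
  · exact sum_geometric_le _ hq hq1
  · intro a ha b hb hab
    simp at ha hb hab
    omega

theorem sum_int_le_le (S : Finset ℤ) (j : ℤ) {q : ℝ} (hq : 0 ≤ q) (hq1 : q < 1) :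
    ∑ J ∈ S with J ≤ j, q ^ (j - J).toNat ≤ (1 - q)⁻¹ := by
  rw [← Finset.sum_image (s := S.filter fun J => J ≤ j) (g := fun J : ℤ => (j - J).toNat)
    (f := fun i : ℕ => q ^ i)]
  · exact sum_geometric_le _ hq hq1
  · intro a ha b hb hab
    simp at ha hb hab
    omega

theorem min_one_le_rpow {v ε : ℝ} (hv : 0 ≤ v) (hε : 0 < ε) (hε1 : ε ≤ 1) : min 1 v ≤ v ^ ε := by
  rcases le_total 1 v with h | h
  · exact (min_le_left _ _).trans (Real.one_le_rpow h hε.le)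
  · rcases hv.eq_or_lt with rfl | h0
    · simp [Real.zero_rpow hε.ne']
    · refine (min_le_right _ _).trans ?_
      nth_rw 1 [← Real.rpow_one v]
      exact Real.rpow_le_rpow_of_exponent_ge h0 h hε1

/-- Sums of dyadic sheared bumps of relative thickness `2⁻ⁿ` satisfy a Hörmander condition. -/
theorem hor_sum_shear {C c : ℝ} (hC : 0 ≤ C) (hc : 0 ≤ c) {n : ℕ} {F : ℤ → ℝ → ℝ → ℂ}
    (hF : ∀ J, Bump C (2 ^ J) (4 ^ J / 2 ^ n) (F J)) (S : Finset ℤ) {ε : ℝ} (hε : 0 < ε)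
    (hε1 : ε ≤ 1) :
    Hor (fun z => ∑ J ∈ S, shear c (F J) z) (2 + c)
      (8 * C * (2 + 3 * c) * (1 - 2 ^ (-ε))⁻¹ * 2 ^ (ε * n)) := by
  intro j u hu1 hu2
  set q : ℝ := 2 ^ (-ε) with hq
  have hq0 : 0 ≤ q := by positivity
  have hq1 : q < 1 := Real.rpow_lt_one_of_one_lt_of_neg (by norm_num) (by linarith)
  have h4 : ∀ J : ℤ, (4 : ℝ) ^ J = (2 ^ J) ^ 2 := fun J => by
    rw [← zpow_natCast, ← zpow_mul, mul_comm, zpow_mul]; norm_num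
  have h2n : (1 : ℝ) ≤ 2 ^ n := one_le_pow₀ (by norm_num)
  set X : Set (ℝ × ℝ) := {z | (2 + c) * 2 ^ j < |z.1| ∨ (2 + c) * 4 ^ j < |z.2|} with hX
  have hXm : MeasurableSet X := (measurableSet_lt measurable_const (measurable_fst.abs)).union
      (measurableSet_lt measurable_const (measurable_snd.abs))
  have hterm : ∀ J ∈ S, ∫⁻ z in X, ‖shear c (F J) (z - u) - shear c (F J) z‖ₑ ≤
      if j ≤ J then ENNReal.ofReal (8 * C * (2 + 3 * c) * 2 ^ (ε * n) * q ^ (J - j).toNat)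
      else 0 := by
    intro J _
    split_ifs with hJ
    · refine (setLIntegral_le_lintegral _ _).trans ?_
      refine ((hF J).lintegral_shear_sub_le (by positivity) (by positivity) hC hc
        (t := 2 ^ j) (zpow_le_zpow_right₀ (by norm_num) hJ) ?_ hu1 (by rwa [← h4])).trans ?_
      · rw [← h4]; exact div_le_self (by positivity) h2n
      · refine ENNReal.ofReal_le_ofReal ?_
        rw [mul_assoc _ ((2 : ℝ) ^ (ε * n))]
        gcongr
        refine (min_one_le_rpow (by positivity) hε hε1).trans (le_of_eq ?_)
        obtain ⟨i, rfl⟩ := Int.exists_add_of_le hJ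
        have : ((2 : ℝ) ^ (j + (i : ℤ))) ^ 2 / (4 ^ (j + (i : ℤ)) / 2 ^ n) *
            (2 ^ j / 2 ^ (j + (i : ℤ))) = 2 ^ (n : ℝ) * (2 : ℝ) ^ (-(i : ℝ)) := by
          rw [h4, Real.rpow_neg (by norm_num), Real.rpow_natCast, Real.rpow_natCast,
            zpow_add₀ (by norm_num), zpow_natCast]
          field_simp
        rw [this, Real.mul_rpow (by positivity) (by positivity), ← Real.rpow_mul (by norm_num),
          ← Real.rpow_mul (by norm_num), mul_comm (n : ℝ) ε, hq, ← Real.rpow_natCast,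
          ← Real.rpow_mul (by norm_num)]
        simp [mul_comm]
    · push Not at hJ
      rw [nonpos_iff_eq_zero, setLIntegral_congr_fun (g := fun _ => 0) hXm, lintegral_zero]
      intro z hz
      have b1 : (2 : ℝ) ^ J ≤ 2 ^ j := zpow_le_zpow_right₀ (by norm_num) hJ.le
      have b2 : (4 : ℝ) ^ J ≤ 4 ^ j := zpow_le_zpow_right₀ (by norm_num) hJ.le
      have b3 : (4 : ℝ) ^ J / 2 ^ n ≤ 4 ^ J := div_le_self (by positivity) h2n
      have p2 : (0 : ℝ) < 2 ^ j := by positivity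
      have p4 : (0 : ℝ) < 4 ^ j := by positivity
      have key : ∀ w ∈ shearBox c (2 ^ J) (4 ^ J / 2 ^ n),
          |w.1| ≤ 2 ^ j ∧ |w.2| ≤ (1 + c) * 4 ^ j := by
        intro w hw
        refine ⟨(mem_shearBox.1 hw).1.trans b1, (abs_snd_le_of_mem_shearBox hc hw).trans ?_⟩
        rw [← h4]; nlinarith
      have z1 : z ∉ shearBox c (2 ^ J) (4 ^ J / 2 ^ n) := fun h => by
        obtain ⟨h1, h2⟩ := key _ h
        rcases hz with hz | hz <;> nlinarith
      have z2 : z - u ∉ shearBox c (2 ^ J) (4 ^ J / 2 ^ n) := fun h => by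
        obtain ⟨h1, h2⟩ := key _ h
        have t1 := abs_add_le (z - u).1 u.1
        have t2 := abs_add_le (z - u).2 u.2
        simp only [Prod.fst_sub, Prod.snd_sub, sub_add_cancel] at t1 t2 h1 h2
        rcases hz with hz | hz <;> nlinarith
      simp [(hF J).shear_eq_zero z1, (hF J).shear_eq_zero z2]
  calc ∫⁻ z in X, ‖∑ J ∈ S, shear c (F J) (z - u) - ∑ J ∈ S, shear c (F J) z‖ₑ
      ≤ ∫⁻ z in X, ∑ J ∈ S, ‖shear c (F J) (z - u) - shear c (F J) z‖ₑ := by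
        refine lintegral_mono fun z => ?_
        rw [← Finset.sum_sub_distrib]
        exact enorm_sum_le _ _
    _ = ∑ J ∈ S, ∫⁻ z in X, ‖shear c (F J) (z - u) - shear c (F J) z‖ₑ := by
        refine lintegral_finsetSum _ fun J _ => ?_
        have := (hF J).continuous_shear (c := c)
        exact (by fun_prop : Continuous fun z => shear c (F J) (z - u) - shear c (F J) z)
          |>.measurable.enorm
    _ ≤ ∑ J ∈ S, if j ≤ J then
          ENNReal.ofReal (8 * C * (2 + 3 * c) * 2 ^ (ε * n) * q ^ (J - j).toNat) else 0 :=
        Finset.sum_le_sum hterm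
    _ = ENNReal.ofReal (8 * C * (2 + 3 * c) * 2 ^ (ε * n) *
          ∑ J ∈ S with j ≤ J, q ^ (J - j).toNat) := by
        rw [← Finset.sum_filter, Finset.mul_sum, ENNReal.ofReal_sum_of_nonneg]
        intro J _; positivity
    _ ≤ _ := by
        refine ENNReal.ofReal_le_ofReal ?_
        rw [mul_right_comm _ (1 - q)⁻¹]
        gcongr
        exact sum_int_ge_le S j hq0 hq1

/-- Two-sided geometric sums are bounded uniformly in the centre. -/
theorem sum_min_zpow_le (S : Finset ℤ) {v b : ℝ} (hv : 0 < v) (hb : 1 < b) :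
    ∑ J ∈ S, min (v * b ^ J) (v * b ^ J)⁻¹ ≤ 2 * (1 - b⁻¹)⁻¹ := by
  have hb0 : 0 < b := by linarith
  have hq0 : 0 ≤ b⁻¹ := by positivity
  have hq1 : b⁻¹ < 1 := inv_lt_one_of_one_lt₀ hb
  obtain ⟨j, hj1, hj2⟩ := exists_mem_Ico_zpow (inv_pos.2 hv) hb
  rw [← Finset.sum_filter_add_sum_filter_not S (fun J => J ≤ j), two_mul]
  refine add_le_add ((Finset.sum_le_sum fun J hJ => ?_).trans (sum_int_le_le S j hq0 hq1))
    (le_trans (Finset.sum_le_sum fun J hJ => ?_)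
      (le_trans (le_of_eq (Finset.sum_congr (by ext; simp) fun _ _ => rfl))
        (sum_int_ge_le S (j + 1) hq0 hq1)))
  · have hJ := (Finset.mem_filter.1 hJ).2
    obtain ⟨i, rfl⟩ := Int.exists_add_of_le hJ
    refine (min_le_left _ _).trans ?_
    simp only [add_sub_cancel_left, Int.toNat_natCast, inv_pow]
    rw [zpow_add₀ hb0.ne', zpow_natCast] at hj1
    rw [← one_div, le_div_iff₀ (by positivity)]
    calc v * b ^ J * b ^ i = v * (b ^ J * b ^ i) := by ring
      _ ≤ v * v⁻¹ := by gcongr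
      _ = 1 := mul_inv_cancel₀ hv.ne'
  · have hJ := (Finset.mem_filter.1 hJ).2
    obtain ⟨i, rfl⟩ := Int.exists_add_of_le (show j + 1 ≤ J by omega)
    refine (min_le_right _ _).trans ?_
    simp only [add_sub_cancel_left, Int.toNat_natCast, inv_pow]
    rw [zpow_add₀ hb0.ne' (j + 1), zpow_natCast]
    refine inv_anti₀ (by positivity) ?_
    calc b ^ i = (v * v⁻¹) * b ^ i := by rw [mul_inv_cancel₀ hv.ne', one_mul]
      _ ≤ (v * b ^ (j + 1)) * b ^ i := by gcongr
      _ = _ := by ring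

theorem eI_add (a b : ℝ) : eI (a + b) = eI a * eI b := by
  simp [eI, mul_add, Complex.exp_add]

theorem continuous_eI : Continuous eI := by unfold eI; fun_prop

theorem norm_eI (a : ℝ) : ‖eI a‖ = 1 := by
  rw [eI, mul_comm]; exact Complex.norm_exp_ofReal_mul_I a

theorem eI_zero : eI 0 = 1 := by simp [eI]

theorem eI_neg_pi : eI (-π) = -1 := by
  rw [eI, mul_comm]; push_cast
  rw [neg_mul, Complex.exp_neg, Complex.exp_pi_mul_I]; norm_num

theorem conj_eI (a : ℝ) : (starRingEnd ℂ) (eI a) = eI (-a) := by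
  rw [eI, eI, ← Complex.exp_conj]; simp

theorem norm_eI_sub_one_le (a : ℝ) : ‖eI a - 1‖ ≤ |a| :=
  Real.norm_exp_I_mul_ofReal_sub_one_le

/-- Half-period shift: an oscillating integral is controlled by the modulus of continuity. -/
theorem two_mul_norm_integral_eI_le {G : Type*} [AddGroup G] [MeasurableSpace G] [MeasurableAdd G]
    [MeasurableNeg G] {μ : Measure G} [μ.IsAddRightInvariant] {b : G → ℂ} (hb : Integrable b μ)
    {φ : G → ℝ} (hφm : Measurable φ) {u : G} (hφ : ∀ z, φ (z - u) = φ z - π) :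
    2 * ‖∫ z, b z * eI (φ z) ∂μ‖ ≤ ∫ z, ‖b (z - u) - b z‖ ∂μ := by
  have hm : AEStronglyMeasurable (fun z => eI (φ z)) μ :=
    (continuous_eI.measurable.comp hφm).aestronglyMeasurable
  have hbu : Integrable (fun z => b (z - u)) μ := hb.comp_sub_right u
  have h1 : ∫ z, b z * eI (φ z) ∂μ = -∫ z, b (z - u) * eI (φ z) ∂μ := by
    rw [← integral_sub_right_eq_self _ u, ← integral_neg]
    congr 1; ext z
    rw [hφ, sub_eq_add_neg (φ z), eI_add, eI_neg_pi]; ring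
  have i1 : Integrable (fun z => b z * eI (φ z)) μ :=
    hb.mul_bdd (c := 1) hm (ae_of_all _ fun z => (norm_eI _).le)
  have i2 : Integrable (fun z => b (z - u) * eI (φ z)) μ :=
    hbu.mul_bdd (c := 1) hm (ae_of_all _ fun z => (norm_eI _).le)
  have h2 : (2 : ℂ) * ∫ z, b z * eI (φ z) ∂μ = -∫ z, (b (z - u) - b z) * eI (φ z) ∂μ := by
    simp_rw [sub_mul]
    rw [integral_sub i2 i1, two_mul]
    nth_rw 1 [h1]
    ring
  calc 2 * ‖∫ z, b z * eI (φ z) ∂μ‖ = ‖(2 : ℂ) * ∫ z, b z * eI (φ z) ∂μ‖ := by simp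
    _ ≤ ∫ z, ‖(b (z - u) - b z) * eI (φ z)‖ ∂μ := by
        rw [h2, norm_neg]; exact norm_integral_le_integral_norm _
    _ = _ := by simp [norm_eI]

theorem integrable_indicator_closedBall (v R B : ℝ) :
    Integrable (Set.indicator (Metric.closedBall v R) fun _ => B) :=
  (integrable_indicator_iff Metric.isClosed_closedBall.measurableSet).2
    (integrableOn_const measure_closedBall_lt_top.ne)

theorem integral_indicator_closedBall (v B : ℝ) {R : ℝ} (hR : 0 ≤ R) :
    ∫ x, Set.indicator (Metric.closedBall v R) (fun _ => B) x = 2 * R * B := by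
  rw [integral_indicator_const _ Metric.isClosed_closedBall.measurableSet]
  simp [measureReal_def, Real.volume_closedBall, hR]

/-- The integral of a bounded function supported in an interval. -/
theorem integral_norm_le_of_support {g : ℝ → ℂ} {R B : ℝ} (hR : 0 ≤ R)
    (hs : ∀ x, R < |x| → g x = 0) (hB : ∀ x, ‖g x‖ ≤ B) : ∫ x, ‖g x‖ ≤ 2 * R * B := by
  have hB0 : 0 ≤ B := (norm_nonneg _).trans (hB 0)
  calc ∫ x, ‖g x‖ ≤ ∫ x, Set.indicator (Metric.closedBall (0 : ℝ) R) (fun _ => B) x := by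
        refine integral_mono_of_nonneg (ae_of_all _ fun x => norm_nonneg _)
          (integrable_indicator_closedBall 0 R B) (ae_of_all _ fun x => ?_)
        by_cases hx : x ∈ Metric.closedBall (0 : ℝ) R
        · rw [Set.indicator_of_mem hx]; exact hB x
        · rw [Set.indicator_of_notMem hx]
          simp only [Metric.mem_closedBall, dist_zero_right, norm_eq_abs, not_le] at hx
          simp [hs x hx]
    _ = 2 * R * B := integral_indicator_closedBall 0 B hR

/-- Second-derivative van der Corput estimate for a quadratic phase. -/
theorem norm_sq_integral_quadratic_le {a : ℝ → ℂ} {r A : ℝ} (hr : 0 < r)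
    (hs : ∀ x, r < |x| → a x = 0) (hA : ∀ x, ‖a x‖ ≤ A)
    (hlip : ∀ x y, ‖a x - a y‖ ≤ A * (|x - y| / r)) (ξ : ℝ) {c : ℝ} (hc : c ≠ 0) :
    ‖∫ x, a x * eI (ξ * x + c * x ^ 2)‖ ^ 2 ≤ A ^ 2 * r / √|c| * (4 + 8 * π) := by
  have hA0 : 0 ≤ A := (norm_nonneg _).trans (hA 0)
  have hac : Continuous a := by
    have : LipschitzWith (Real.toNNReal (A / r)) a := LipschitzWith.of_dist_le_mul fun x y => by
      rw [dist_eq_norm, Real.coe_toNNReal _ (by positivity), Real.dist_eq]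
      exact (hlip x y).trans (le_of_eq (by ring))
    exact this.continuous
  set g : ℝ → ℂ := fun x => a x * eI (ξ * x + c * x ^ 2) with hg
  have hgc : Continuous g := hac.mul (continuous_eI.comp (by fun_prop))
  have hgs : ∀ x, r < |x| → g x = 0 := fun x hx => by simp [hg, hs x hx]
  have hgn : ∀ x, ‖g x‖ ≤ A := fun x => by simpa [hg, norm_eI] using hA x
  have hcc : 0 < |c| := abs_pos.2 hc
  set T : ℝ → ℂ := fun h => ∫ y, g (y + h) * (starRingEnd ℂ) (g y) with hT
  have hsq : (∫ x, g x) * (starRingEnd ℂ) (∫ x, g x) = ∫ h, T h := by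
    rw [← integral_conj, ← integral_const_mul]
    have : ∀ y, (∫ x, g x) * (starRingEnd ℂ) (g y) = ∫ h, g (y + h) * (starRingEnd ℂ) (g y) := by
      intro y
      rw [integral_mul_const]
      congr 1
      simp_rw [add_comm y]
      rw [integral_add_right_eq_self]
    simp_rw [this]
    refine integral_integral_swap ?_
    have hcont : Continuous (Function.uncurry fun y h => g (y + h) * (starRingEnd ℂ) (g y)) := by
      unfold Function.uncurry
      exact (hgc.comp (continuous_fst.add continuous_snd)).mul
        (Complex.continuous_conj.comp (hgc.comp continuous_fst))
    refine hcont.integrable_of_hasCompactSupport (HasCompactSupport.intro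
      ((isCompact_closedBall (0 : ℝ) r).prod (isCompact_closedBall (0 : ℝ) (2 * r))) ?_)
    rintro ⟨y, h⟩ hyh
    by_contra hne
    simp only [Function.uncurry, mul_eq_zero, map_eq_zero, not_or] at hne
    have h1 : |y| ≤ r := not_lt.1 fun hh => hne.2 (hgs _ hh)
    have h2 : |y + h| ≤ r := not_lt.1 fun hh => hne.1 (hgs _ hh)
    refine hyh ⟨by simpa using h1, ?_⟩
    simp only [Metric.mem_closedBall, dist_zero_right, norm_eq_abs]
    rw [abs_le] at *
    constructor <;> linarith
  have hT0 : ∀ h, 2 * r < |h| → T h = 0 := by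
    intro h hh
    rw [hT]
    refine integral_eq_zero_of_ae (ae_of_all _ fun y => ?_)
    simp only [Pi.zero_apply, mul_eq_zero, map_eq_zero]
    by_contra! hne
    have h1 : |y| ≤ r := not_lt.1 fun hh => hne.2 (hgs _ hh)
    have h2 : |y + h| ≤ r := not_lt.1 fun hh => hne.1 (hgs _ hh)
    have := abs_sub (y + h) y
    rw [add_sub_cancel_left] at this
    linarith
  have hT1 : ∀ h, ‖T h‖ ≤ 2 * r * A ^ 2 := by
    intro h
    refine (norm_integral_le_integral_norm _).trans
      (integral_norm_le_of_support hr.le (fun y hy => by simp [hgs y hy]) fun y => ?_)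
    rw [norm_mul, RCLike.norm_conj, sq]
    exact mul_le_mul (hgn _) (hgn _) (norm_nonneg _) hA0
  have hT2 : ∀ h, h ≠ 0 → ‖T h‖ ≤ 2 * π * A ^ 2 / (|c| * |h|) := by
    intro h hh
    set b : ℝ → ℂ := fun y => a (y + h) * (starRingEnd ℂ) (a y) * eI (ξ * h + c * h ^ 2) with hb
    have hbc : Continuous b := by
      refine Continuous.mul (Continuous.mul (by fun_prop) ?_) continuous_const
      exact Complex.continuous_conj.comp hac
    have hbs : ∀ y, r < |y| → b y = 0 := fun y hy => by simp [hb, hs y hy]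
    have hbi : Integrable b := hbc.integrable_of_hasCompactSupport
      (HasCompactSupport.intro (isCompact_closedBall (0 : ℝ) r) fun y hy => hbs y (by simpa using hy))
    have hTb : T h = ∫ y, b y * eI (2 * c * h * y) := by
      rw [hT]
      refine integral_congr_ae (ae_of_all _ fun y => ?_)
      simp only [hg, hb, map_mul, conj_eI]
      have : eI (ξ * (y + h) + c * (y + h) ^ 2) =
          eI (ξ * h + c * h ^ 2) * eI (2 * c * h * y) * eI (ξ * y + c * y ^ 2) := by
        rw [← eI_add, ← eI_add]; congr 1; ring
      rw [this]
      have h1 : eI (ξ * y + c * y ^ 2) * eI (-(ξ * y + c * y ^ 2)) = 1 := by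
        rw [← eI_add, add_neg_cancel, eI_zero]
      linear_combination (a (y + h) * (starRingEnd ℂ) (a y) * eI (ξ * h + c * h ^ 2) *
        eI (2 * c * h * y)) * h1
    set u := π / (2 * c * h) with hu
    have hshift : ∀ y, ‖b (y - u) - b y‖ ≤ 2 * A ^ 2 * (|u| / r) := by
      intro y
      have e : b (y - u) - b y = ((a (y - u + h) - a (y + h)) * (starRingEnd ℂ) (a (y - u)) +
          a (y + h) * (starRingEnd ℂ) (a (y - u) - a y)) * eI (ξ * h + c * h ^ 2) := by
        simp only [hb, map_sub]; ring
      rw [e, norm_mul, norm_eI, mul_one]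
      refine (norm_add_le _ _).trans ?_
      rw [norm_mul, norm_mul, RCLike.norm_conj, RCLike.norm_conj]
      have l1 := hlip (y - u + h) (y + h)
      have l2 := hlip (y - u) y
      rw [show y - u + h - (y + h) = -u by ring, abs_neg] at l1
      rw [show y - u - y = -u by ring, abs_neg] at l2
      calc _ ≤ (A * (|u| / r)) * A + A * (A * (|u| / r)) := by
            gcongr
            · exact hA _
            · exact hA _
        _ = _ := by ring
    have hL1 : ∫ y, ‖b (y - u) - b y‖ ≤ 8 * A ^ 2 * |u| := by
      set B := 2 * A ^ 2 * (|u| / r) with hB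
      calc ∫ y, ‖b (y - u) - b y‖ ≤ ∫ y,
            (Set.indicator (Metric.closedBall (0 : ℝ) r) (fun _ => B) y +
              Set.indicator (Metric.closedBall (u : ℝ) r) (fun _ => B) y) := by
            refine integral_mono_of_nonneg (ae_of_all _ fun x => norm_nonneg _)
              ((integrable_indicator_closedBall _ _ _).add
                (integrable_indicator_closedBall _ _ _)) (ae_of_all _ fun y => ?_)
            have hg0 : 0 ≤ 2 * A ^ 2 * (|u| / r) := by positivity
            have hi0 : ∀ v : ℝ, 0 ≤ Set.indicator (Metric.closedBall v r) (fun _ => B) y := fun v =>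
              Set.indicator_nonneg (fun _ _ => hg0) _
            by_cases h1 : y ∈ Metric.closedBall (0 : ℝ) r
            · have := hi0 u
              simp only [Set.indicator_of_mem h1]
              exact (hshift y).trans (le_add_of_nonneg_right this)
            by_cases h2 : y ∈ Metric.closedBall u r
            · have := hi0 0
              simp only [Set.indicator_of_mem h2]
              exact (hshift y).trans (le_add_of_nonneg_left this)
            · simp only [Metric.mem_closedBall, dist_zero_right, Real.dist_eq, not_le,
                norm_eq_abs] at h1 h2
              simp only [hbs _ h1, hbs _ h2, sub_self, norm_zero]
              exact add_nonneg (hi0 0) (hi0 u)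
        _ = _ := by
            rw [integral_add (integrable_indicator_closedBall _ _ _)
              (integrable_indicator_closedBall _ _ _), integral_indicator_closedBall _ _ hr.le,
              integral_indicator_closedBall _ _ hr.le, hB]
            field_simp; ring
    have := two_mul_norm_integral_eI_le hbi (φ := fun y => 2 * c * h * y) (by fun_prop) (u := u)
      (fun z => by rw [hu]; field_simp)
    rw [hTb]
    have hu' : |u| = π / (2 * |c| * |h|) := by
      rw [hu, abs_div, abs_mul, abs_mul, abs_of_pos pi_pos, abs_two]
    have hh' : 0 < |h| := abs_pos.2 hh
    calc _ ≤ 4 * A ^ 2 * |u| := by linarith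
      _ = _ := by rw [hu']; field_simp; ring
  set h₀ := (√|c|)⁻¹ with hh₀
  have hsc : 0 < √|c| := Real.sqrt_pos.2 hcc
  have hfin : ∫ h, ‖T h‖ ≤ A ^ 2 * r / √|c| * (4 + 8 * π) := by
    calc ∫ h, ‖T h‖ ≤ ∫ h, (Set.indicator (Metric.closedBall (0 : ℝ) h₀) (fun _ => 2 * r * A ^ 2) h +
            Set.indicator (Metric.closedBall (0 : ℝ) (2 * r))
              (fun _ => 2 * π * A ^ 2 / √|c|) h) := by
          refine integral_mono_of_nonneg (ae_of_all _ fun x => norm_nonneg _)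
            ((integrable_indicator_closedBall _ _ _).add
              (integrable_indicator_closedBall _ _ _)) (ae_of_all _ fun h => ?_)
          have n1 : 0 ≤ Set.indicator (Metric.closedBall (0 : ℝ) h₀) (fun _ => 2 * r * A ^ 2) h :=
            Set.indicator_nonneg (fun _ _ => by positivity) _
          have n2 : 0 ≤ Set.indicator (Metric.closedBall (0 : ℝ) (2 * r))
              (fun _ => 2 * π * A ^ 2 / √|c|) h :=
            Set.indicator_nonneg (fun _ _ => by positivity) _
          by_cases h1 : h ∈ Metric.closedBall (0 : ℝ) h₀
          · simp only [Set.indicator_of_mem h1]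
            exact (hT1 h).trans (le_add_of_nonneg_right n2)
          by_cases h2 : h ∈ Metric.closedBall (0 : ℝ) (2 * r)
          · simp only [Set.indicator_of_mem h2]
            refine le_trans ?_ (le_add_of_nonneg_left n1)
            simp only [Metric.mem_closedBall, dist_zero_right, norm_eq_abs, not_le] at h1
            have hpos : 0 < h₀ := by positivity
            have hne : h ≠ 0 := by rintro rfl; simp at h1; linarith
            refine (hT2 h hne).trans ?_
            gcongr
            calc √|c| = |c| * h₀ := by
                  rw [hh₀, eq_mul_inv_iff_mul_eq₀ hsc.ne', Real.mul_self_sqrt hcc.le]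
              _ ≤ |c| * |h| := by gcongr
          · simp only [Metric.mem_closedBall, dist_zero_right, norm_eq_abs, not_le] at h2
            simp only [hT0 h h2, norm_zero]
            exact add_nonneg n1 n2
      _ = _ := by
          rw [integral_add (integrable_indicator_closedBall _ _ _)
            (integrable_indicator_closedBall _ _ _),
            integral_indicator_closedBall _ _ (by positivity : 0 ≤ h₀),
            integral_indicator_closedBall _ _ (by positivity : 0 ≤ 2 * r), hh₀]
          field_simp; ring
  calc ‖∫ x, g x‖ ^ 2 = ‖(∫ x, g x) * (starRingEnd ℂ) (∫ x, g x)‖ := by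
        rw [norm_mul, RCLike.norm_conj, sq]
    _ ≤ _ := by
        rw [hsq]; exact (norm_integral_le_integral_norm _).trans hfin

theorem integral_norm_le_of_lintegral {α : Type*} [MeasurableSpace α] {μ : Measure α} {g : α → ℂ}
    (hg : AEStronglyMeasurable g μ) {B : ℝ} (hB : 0 ≤ B)
    (h : ∫⁻ z, ‖g z‖ₑ ∂μ ≤ ENNReal.ofReal B) : ∫ z, ‖g z‖ ∂μ ≤ B := by
  rw [integral_norm_eq_lintegral_enorm hg]
  exact ENNReal.toReal_le_of_le_ofReal hB h

theorem integral_shear (c : ℝ) {F : ℝ → ℝ → ℂ} (hF : Continuous fun p : ℝ × ℝ => F p.1 p.2) :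
    ∫ z, shear c F z = ∫ p : ℝ × ℝ, F p.1 p.2 := by
  have h := integral_map (μ := volume) (measurePreserving_shear c).measurable.aemeasurable
    (f := fun p : ℝ × ℝ => F p.1 p.2) hF.aestronglyMeasurable
  rw [(measurePreserving_shear c).map_eq] at h
  exact h.symm

/-- The Fourier transform of a function of mean zero supported in an interval. -/
theorem norm_integral_mul_eI_le {g : ℝ → ℂ} (hg : Continuous g) {s B : ℝ} (hs : 0 ≤ s)
    (hsupp : ∀ y, s < |y| → g y = 0) (hB : ∀ y, ‖g y‖ ≤ B) (hmean : ∫ y, g y = 0) (η : ℝ) :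
    ‖∫ y, g y * eI (η * y)‖ ≤ 2 * s * B * min 1 (|η| * s) := by
  have hB0 : 0 ≤ B := (norm_nonneg _).trans (hB 0)
  have hgi : Integrable g := hg.integrable_of_hasCompactSupport
    (HasCompactSupport.intro (isCompact_closedBall (0 : ℝ) s) fun y hy => hsupp y (by simpa using hy))
  have hge : Integrable fun y => g y * eI (η * y) :=
    hgi.mul_bdd (c := 1) (continuous_eI.comp (by fun_prop)).aestronglyMeasurable
      (ae_of_all _ fun z => (norm_eI _).le)
  rw [mul_min_of_nonneg _ _ (by positivity), mul_one]
  refine le_min ?_ ?_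
  · refine (norm_integral_le_integral_norm _).trans
      (integral_norm_le_of_support hs (fun y hy => by simp [hsupp y hy]) fun y => ?_)
    simpa [norm_eI] using hB y
  · have : ∫ y, g y * eI (η * y) = ∫ y, g y * (eI (η * y) - 1) := by
      simp_rw [mul_sub, mul_one]
      rw [integral_sub hge hgi, hmean, sub_zero]
    rw [this, mul_assoc (2 * s)]
    refine (norm_integral_le_integral_norm _).trans
      (integral_norm_le_of_support hs (fun y hy => by simp [hsupp y hy]) fun y => ?_)
    rcases lt_or_ge s |y| with hy | hy
    · simp only [hsupp y hy, zero_mul, norm_zero]; positivity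
    · rw [norm_mul]
      refine mul_le_mul (hB y) ((norm_eI_sub_one_le _).trans ?_) (norm_nonneg _) hB0
      rw [abs_mul]; gcongr

namespace Bump

variable {C r s c : ℝ} {F : ℝ → ℝ → ℂ}

theorem eq_zero_of_snd (hF : Bump C r s F) (x : ℝ) {y : ℝ} (hy : s < |y|) : F x y = 0 := by
  by_contra h
  exact absurd (hF.support x y h).2 (not_le.2 hy)

theorem eq_zero_of_fst (hF : Bump C r s F) {x : ℝ} (y : ℝ) (hx : r < |x|) : F x y = 0 := by
  by_contra h
  exact absurd (hF.support x y h).1 (not_le.2 hx)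

theorem hasCompactSupport (hF : Bump C r s F) :
    HasCompactSupport fun p : ℝ × ℝ => F p.1 p.2 := by
  refine HasCompactSupport.intro ((isCompact_closedBall (0 : ℝ) r).prod
    (isCompact_closedBall (0 : ℝ) s)) fun p hp => ?_
  by_contra h
  exact hp ⟨by simpa using (hF.support _ _ h).1, by simpa using (hF.support _ _ h).2⟩

theorem integrable (hF : Bump C r s F) : Integrable fun p : ℝ × ℝ => F p.1 p.2 :=
  hF.continuous.integrable_of_hasCompactSupport hF.hasCompactSupport

theorem integrable_shear (hF : Bump C r s F) (hc : 0 ≤ c) : Integrable (shear c F) :=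
  hF.continuous_shear.integrable_of_hasCompactSupport (hF.hasCompactSupport_shear hc)

theorem integral_norm_shear_le (hF : Bump C r s F) (hr : 0 < r) (hs : 0 < s) (hC : 0 ≤ C) :
    ∫ z, ‖shear c F z‖ ≤ 4 * C :=
  integral_norm_le_of_lintegral hF.continuous_shear.aestronglyMeasurable (by positivity)
    (hF.lintegral_shear_le hr hs hC)

theorem ft_shear_eq (hF : Bump C r s F) (c ξ η : ℝ) :
    ft (shear c F) ξ η = ∫ x, (∫ y, F x y * eI (η * y)) * eI (ξ * x + η * c * x ^ 2) := by
  set G : ℝ × ℝ → ℂ := fun p => F p.1 p.2 * eI (ξ * p.1 + η * (p.2 + c * p.1 ^ 2)) with hG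
  have hGc : Continuous G := hF.continuous.mul (continuous_eI.comp (by fun_prop))
  have hGi : Integrable G := hF.integrable.mul_bdd (c := 1)
    (continuous_eI.comp (by fun_prop)).aestronglyMeasurable (ae_of_all _ fun z => (norm_eI _).le)
  have h1 : ft (shear c F) ξ η = ∫ p, G p := by
    rw [← integral_shear c (F := fun x y => G (x, y)) hGc]
    simp [ft, shear, hG]
  rw [h1, Measure.volume_eq_prod, integral_prod G hGi]
  refine integral_congr_ae (ae_of_all _ fun x => ?_)
  simp only [hG]
  rw [← integral_mul_const]
  refine integral_congr_ae (ae_of_all _ fun y => ?_)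
  simp only
  rw [mul_assoc, ← eI_add]
  congr 2; ring

theorem norm_sq_ft_shear_le (hF : Bump C r s F) (hr : 0 < r) (hs : 0 < s) (hc : 0 < c)
    (hmean : ∀ x, ∫ y, F x y = 0) (ξ : ℝ) {η : ℝ} (hη : η ≠ 0) :
    ‖ft (shear c F) ξ η‖ ^ 2 ≤
      (2 * C / r * min 1 (|η| * s)) ^ 2 * r / √(|η| * c) * (4 + 8 * π) := by
  rw [hF.ft_shear_eq]
  have hFc : ∀ x, Continuous (F x) := fun x =>
    hF.continuous.comp (by fun_prop : Continuous fun y : ℝ => (x, y))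
  have hm : 0 ≤ min 1 (|η| * s) := le_min zero_le_one (by positivity)
  have hFi : ∀ x, Integrable (F x) := fun x => (hFc x).integrable_of_hasCompactSupport
    (HasCompactSupport.intro (isCompact_closedBall (0 : ℝ) s) fun y hy =>
      hF.eq_zero_of_snd x (by simpa using hy))
  have hFe : ∀ x, Integrable fun y => F x y * eI (η * y) := fun x =>
    (hFi x).mul_bdd (c := 1) (continuous_eI.comp (by fun_prop)).aestronglyMeasurable
      (ae_of_all _ fun z => (norm_eI _).le)
  have := norm_sq_integral_quadratic_le (a := fun x => ∫ y, F x y * eI (η * y))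
    (A := 2 * C / r * min 1 (|η| * s)) hr (fun x hx => by simp [hF.eq_zero_of_fst _ hx]) ?_ ?_ ξ
    (mul_ne_zero hη hc.ne')
  · rwa [abs_mul, abs_of_pos hc] at this
  · intro x
    refine (norm_integral_mul_eI_le (hFc x) hs.le (fun y hy => hF.eq_zero_of_snd x hy)
      (hF.bound x) (hmean x) η).trans (le_of_eq ?_)
    field_simp
  · intro x x'
    rw [← integral_sub (hFe x) (hFe x')]
    simp_rw [← sub_mul]
    refine (norm_integral_mul_eI_le ((hFc x).sub (hFc x')) hs.le
      (fun y hy => by simp [hF.eq_zero_of_snd _ hy])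
      (hF.lip_fst x x') ((integral_sub (hFi x) (hFi x')).trans (by rw [hmean, hmean, sub_zero])) η).trans
        (le_of_eq ?_)
    field_simp

end Bump

theorem ft_sum {ι : Type*} (S : Finset ι) {k : ι → ℝ × ℝ → ℂ} (hk : ∀ i, Integrable (k i))
    (ξ η : ℝ) : ft (fun z => ∑ i ∈ S, k i z) ξ η = ∑ i ∈ S, ft (k i) ξ η := by
  unfold ft
  simp_rw [Finset.sum_mul]
  exact integral_finsetSum _ fun i _ => (hk i).mul_bdd (c := 1)
    (continuous_eI.comp (by fun_prop)).aestronglyMeasurable (ae_of_all _ fun z => (norm_eI _).le)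

/-- Fourier decay for sums of dyadic sheared bumps of relative thickness `2⁻ⁿ`. -/
theorem norm_ft_sum_shear_le {C c : ℝ} (hC : 0 ≤ C) (hc : 0 < c) {n : ℕ} {F : ℤ → ℝ → ℝ → ℂ}
    (hF : ∀ J, Bump C (2 ^ J) (4 ^ J / 2 ^ n) (F J)) (hmean : ∀ J x, ∫ y, F J x y = 0)
    (S : Finset ℤ) (ξ η : ℝ) :
    ‖ft (fun z => ∑ J ∈ S, shear c (F J) z) ξ η‖ ≤
      2 * C * √((4 + 8 * π) / √c) * (2 * (1 - ((4 : ℝ) ^ (1 / 4 : ℝ))⁻¹)⁻¹) *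
        2 ^ (-(n : ℝ) / 4) := by
  have hb : (1 : ℝ) < (4 : ℝ) ^ (1 / 4 : ℝ) := Real.one_lt_rpow (by norm_num) (by norm_num)
  have hb' : 0 ≤ (1 - ((4 : ℝ) ^ (1 / 4 : ℝ))⁻¹)⁻¹ :=
    inv_nonneg.2 (sub_nonneg.2 (inv_le_one_of_one_le₀ hb.le))
  rw [ft_sum S fun J => (hF J).integrable_shear hc.le]
  rcases eq_or_ne η 0 with rfl | hη
  · have : ∀ J, ft (shear c (F J)) ξ 0 = 0 := fun J => by
      rw [(hF J).ft_shear_eq]; simp [eI_zero, hmean]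
    simp only [this, Finset.sum_const_zero, norm_zero]
    positivity
  have hη' : 0 < |η| := abs_pos.2 hη
  set v : ℝ := (|η| / 2 ^ n) ^ (1 / 4 : ℝ) with hv
  have hv0 : 0 < v := by positivity
  set b : ℝ := (4 : ℝ) ^ (1 / 4 : ℝ) with hbdef
  have hb0 : 0 < b := by positivity
  have hv4 : v ^ 4 = |η| / 2 ^ n := by
    rw [hv, ← Real.rpow_natCast, ← Real.rpow_mul (by positivity)]; norm_num
  have hb4 : b ^ 4 = 4 := by
    rw [hbdef, ← Real.rpow_natCast, ← Real.rpow_mul (by positivity)]; norm_num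
  have hb2 : b ^ 2 = 2 := by
    have : (b ^ 2 - 2) * (b ^ 2 + 2) = 0 := by linear_combination hb4
    rcases mul_eq_zero.1 this with h | h
    · linarith
    · nlinarith
  set d : ℝ := 2 ^ (-(n : ℝ) / 4) with hd
  have hd0 : 0 < d := by positivity
  have hd4 : d ^ 4 = 1 / 2 ^ n := by
    rw [hd, ← Real.rpow_natCast, ← Real.rpow_mul (by positivity)]
    norm_num
  have hterm : ∀ J, ‖ft (shear c (F J)) ξ η‖ ≤
      2 * C * √((4 + 8 * π) / √c) * d * min (v * b ^ J) (v * b ^ J)⁻¹ := by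
    intro J
    set X := v * b ^ J with hX
    have hX0 : 0 < X := by positivity
    have h2J : (b ^ J) ^ 2 = (2 : ℝ) ^ J := by
      rw [← hb2, ← zpow_natCast, ← zpow_natCast, ← zpow_mul, ← zpow_mul, mul_comm]
    have h4J : (b ^ J) ^ 4 = (4 : ℝ) ^ J := by
      rw [← hb4, ← zpow_natCast, ← zpow_natCast, ← zpow_mul, ← zpow_mul, mul_comm]
    have hw : |η| * (4 ^ J / 2 ^ n) = X ^ 4 := by rw [hX, mul_pow, hv4, h4J]; ring
    have hsq : √(|η| * c) = v ^ 2 / d ^ 2 * √c := by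
      rw [Real.sqrt_mul hη'.le]
      congr 1
      rw [← Real.sqrt_sq (by positivity : 0 ≤ v ^ 2 / d ^ 2)]
      congr 1
      rw [div_pow, ← pow_mul, ← pow_mul, hv4, hd4]; field_simp
    have key := (hF J).norm_sq_ft_shear_le (by positivity) (by positivity) hc (hmean J) ξ hη
    rw [hw, hsq] at key
    have hmin : 0 ≤ min X X⁻¹ := le_min hX0.le (by positivity)
    refine le_of_sq_le_sq (key.trans ?_) (by positivity)
    have hm : (min 1 (X ^ 4)) ^ 2 ≤ X ^ 2 * (min X X⁻¹) ^ 2 := by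
      rcases le_total X 1 with h | h
      · rw [min_eq_left (h.trans (one_le_inv₀ hX0 |>.2 h)), min_eq_right (pow_le_one₀ hX0.le h)]
        calc (X ^ 4) ^ 2 = X ^ 4 * X ^ 4 := by ring
          _ ≤ X ^ 4 * 1 := by gcongr; exact pow_le_one₀ hX0.le h
          _ = _ := by ring
      · rw [min_eq_right ((inv_le_one_of_one_le₀ h).trans h), min_eq_left (one_le_pow₀ h)]
        rw [← mul_pow, mul_inv_cancel₀ hX0.ne']
    rw [mul_pow (_ * _ * _), mul_pow (_ * _), mul_pow (2 * C), Real.sq_sqrt (by positivity)]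
    have hsc : 0 < √c := Real.sqrt_pos.2 hc
    calc (2 * C / 2 ^ J * min 1 (X ^ 4)) ^ 2 * 2 ^ J / (v ^ 2 / d ^ 2 * √c) * (4 + 8 * π)
        = (2 * C) ^ 2 * ((4 + 8 * π) / √c) * d ^ 2 * ((min 1 (X ^ 4)) ^ 2 / (v ^ 2 * 2 ^ J)) := by
          field_simp
      _ ≤ (2 * C) ^ 2 * ((4 + 8 * π) / √c) * d ^ 2 * (min X X⁻¹) ^ 2 := by
          gcongr
          rw [div_le_iff₀ (by positivity)]
          refine hm.trans (le_of_eq ?_)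
          rw [hX, mul_pow v, h2J]; ring
  calc ‖∑ J ∈ S, ft (shear c (F J)) ξ η‖ ≤ ∑ J ∈ S, ‖ft (shear c (F J)) ξ η‖ := norm_sum_le _ _
    _ ≤ ∑ J ∈ S, 2 * C * √((4 + 8 * π) / √c) * d * min (v * b ^ J) (v * b ^ J)⁻¹ :=
        Finset.sum_le_sum fun J _ => hterm J
    _ = 2 * C * √((4 + 8 * π) / √c) * d * ∑ J ∈ S, min (v * b ^ J) (v * b ^ J)⁻¹ := by
        rw [Finset.mul_sum]
    _ ≤ 2 * C * √((4 + 8 * π) / √c) * d * (2 * (1 - b⁻¹)⁻¹) := by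
        gcongr; exact sum_min_zpow_le S hv0 hb
    _ = _ := by ring

theorem Bump.norm_ft_shear_le {C r c : ℝ} {F : ℝ → ℝ → ℂ} (hF : Bump C r (r ^ 2) F) (hr : 0 < r)
    (hC : 0 ≤ C) (hc : 0 ≤ c) (hmean : ∫ p : ℝ × ℝ, F p.1 p.2 = 0) {ξ η : ℝ}
    (hN : 0 < max |ξ| √|η|) :
    ‖ft (shear c F) ξ η‖ ≤ 4 * C * (2 + 3 * c) * π *
      min (max |ξ| √|η| * r) (max |ξ| √|η| * r)⁻¹ := by
  set N := max |ξ| √|η| with hNdef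
  have hs : 0 < r ^ 2 := by positivity
  have hki := hF.integrable_shear hc
  have hL1 := hF.integral_norm_shear_le (c := c) hr hs hC
  have hξ : |ξ| ≤ N := le_max_left _ _
  have hη : |η| ≤ N ^ 2 := by
    rw [← Real.sq_sqrt (abs_nonneg η)]
    gcongr
    exact le_max_right _ _
  have hkint : ∫ z, shear c F z = 0 := (integral_shear c hF.continuous).trans hmean
  have hke : Integrable fun z : ℝ × ℝ => shear c F z * eI (ξ * z.1 + η * z.2) :=
    hki.mul_bdd (c := 1) (continuous_eI.comp (by fun_prop)).aestronglyMeasurable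
      (ae_of_all _ fun z => (norm_eI _).le)
  have hpi : (3 : ℝ) ≤ π := pi_gt_three.le
  have hNr : 0 < N * r := by positivity
  rw [mul_min_of_nonneg _ _ (by positivity)]
  have htriv : ‖ft (shear c F) ξ η‖ ≤ 4 * C := by
    refine (norm_integral_le_integral_norm _).trans (le_trans (le_of_eq ?_) hL1)
    simp [norm_eI]
  refine le_min ?_ ?_
  · rcases le_total (N * r) 1 with h1 | h1
    · have e1 : ft (shear c F) ξ η =
          ∫ z : ℝ × ℝ, shear c F z * (eI (ξ * z.1 + η * z.2) - 1) := by
        simp_rw [mul_sub, mul_one]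
        rw [integral_sub hke hki, hkint, sub_zero]; rfl
      rw [e1]
      calc ‖∫ z : ℝ × ℝ, shear c F z * (eI (ξ * z.1 + η * z.2) - 1)‖
          ≤ ∫ z, ‖shear c F z‖ * ((2 + c) * (N * r)) := by
            refine norm_integral_le_of_norm_le (hki.norm.mul_const _) (ae_of_all _ fun z => ?_)
            by_cases hz : z ∈ shearBox c r (r ^ 2)
            · rw [norm_mul]
              gcongr
              refine (norm_eI_sub_one_le _).trans ((abs_add_le _ _).trans ?_)
              rw [abs_mul, abs_mul]
              have b1 := (mem_shearBox.1 hz).1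
              have b2 := abs_snd_le_of_mem_shearBox hc hz
              calc |ξ| * |z.1| + |η| * |z.2| ≤ N * r + N ^ 2 * (r ^ 2 + c * r ^ 2) := by gcongr
                _ = N * r + (1 + c) * ((N * r) * (N * r)) := by ring
                _ ≤ N * r + (1 + c) * ((N * r) * 1) := by gcongr
                _ = _ := by ring
            · simp [hF.shear_eq_zero hz]
        _ = (∫ z, ‖shear c F z‖) * ((2 + c) * (N * r)) := integral_mul_const _ _
        _ ≤ 4 * C * ((2 + c) * (N * r)) := by gcongr
        _ ≤ 4 * C * ((2 + 3 * c) * π * (N * r)) := by gcongr; nlinarith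
        _ = _ := by ring
    · refine htriv.trans ?_
      calc 4 * C = 4 * C * (1 * 1 * 1) := by ring
        _ ≤ 4 * C * ((2 + 3 * c) * π * (N * r)) := by gcongr <;> linarith
        _ = _ := by ring
  · rcases le_total r (π / N) with h1 | h1
    · rw [le_div_iff₀ hN] at h1
      refine htriv.trans ?_
      calc 4 * C = 4 * C * (1 * (π / π)) := by rw [div_self Real.pi_ne_zero]; ring
        _ ≤ 4 * C * ((2 + 3 * c) * (π / (N * r))) := by gcongr <;> linarith
        _ = _ := by ring
    · obtain ⟨u, hu, hu1, hu2⟩ : ∃ u : ℝ × ℝ, ξ * u.1 + η * u.2 = π ∧ |u.1| ≤ π / N ∧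
          |u.2| ≤ (π / N) ^ 2 := by
        rcases le_total √|η| |ξ| with h | h
        · have hNe : N = |ξ| := max_eq_left h
          have hξ0 : ξ ≠ 0 := by rintro rfl; simp [hNe] at hN
          refine ⟨(π / ξ, 0), by field_simp; simp, ?_, by simp; positivity⟩
          simp [hNe, abs_div, abs_of_pos pi_pos]
        · have hNe : N = √|η| := max_eq_right h
          have hη0 : η ≠ 0 := by rintro rfl; simp [hNe] at hN
          refine ⟨(0, π / η), by field_simp; simp, by simp; positivity, ?_⟩
          simp only [hNe, abs_div, abs_of_pos pi_pos, div_pow, Real.sq_sqrt (abs_nonneg η)]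
          gcongr
          nlinarith
      have h2 := two_mul_norm_integral_eI_le hki (φ := fun z : ℝ × ℝ => ξ * z.1 + η * z.2)
        (by fun_prop) (u := u) (fun z => by simp only [Prod.fst_sub, Prod.snd_sub, ← hu]; ring)
      have h3 : ∫ z, ‖shear c F (z - u) - shear c F z‖ ≤
          8 * C * (2 + 3 * c) * min 1 (r ^ 2 / r ^ 2 * (π / N / r)) := by
        have := hF.continuous_shear (c := c)
        refine integral_norm_le_of_lintegral (by fun_prop) ?_
          (hF.lintegral_shear_sub_le hr hs hC hc h1 le_rfl hu1 hu2)
        have : 0 ≤ min 1 (r ^ 2 / r ^ 2 * (π / N / r)) := le_min zero_le_one (by positivity)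
        positivity
      have h4 : 8 * C * (2 + 3 * c) * min 1 (r ^ 2 / r ^ 2 * (π / N / r)) ≤
          8 * C * (2 + 3 * c) * (π * (N * r)⁻¹) := by
        gcongr
        refine (min_le_right _ _).trans (le_of_eq ?_)
        field_simp
      change 2 * ‖ft (shear c F) ξ η‖ ≤ _ at h2
      linarith

/-- Fourier bound for sums of dyadic sheared bumps of mean zero. -/
theorem norm_ft_sum_shear_le_of_mean_zero {C c : ℝ} (hC : 0 ≤ C) (hc : 0 ≤ c)
    {F : ℤ → ℝ → ℝ → ℂ} (hF : ∀ J, Bump C (2 ^ J) (4 ^ J) (F J))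
    (hmean : ∀ J, ∫ p : ℝ × ℝ, F J p.1 p.2 = 0) (S : Finset ℤ) (ξ η : ℝ) :
    ‖ft (fun z => ∑ J ∈ S, shear c (F J) z) ξ η‖ ≤ 16 * C * (2 + 3 * c) * π := by
  have h4 : ∀ J : ℤ, (4 : ℝ) ^ J = (2 ^ J) ^ 2 := fun J => by
    rw [← zpow_natCast, ← zpow_mul, mul_comm, zpow_mul]; norm_num
  simp_rw [h4] at hF
  rw [ft_sum S fun J => (hF J).integrable_shear hc]
  rcases (le_max_of_le_left (abs_nonneg ξ) : 0 ≤ max |ξ| √|η|).eq_or_lt with hN | hN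
  · have hξ : ξ = 0 := by
      have := le_max_left |ξ| √|η|
      rw [← hN] at this
      simpa using this
    have hη : η = 0 := by
      have := le_max_right |ξ| √|η|
      rw [← hN, Real.sqrt_le_left le_rfl] at this
      simpa using this
    have : ∀ J, ft (shear c (F J)) ξ η = 0 := fun J => by
      simpa [ft, hξ, hη, eI_zero] using (integral_shear c (hF J).continuous).trans (hmean J)
    simp only [this, Finset.sum_const_zero, norm_zero]
    positivity
  calc ‖∑ J ∈ S, ft (shear c (F J)) ξ η‖ ≤ ∑ J ∈ S, ‖ft (shear c (F J)) ξ η‖ := norm_sum_le _ _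
    _ ≤ ∑ J ∈ S, 4 * C * (2 + 3 * c) * π *
          min (max |ξ| √|η| * 2 ^ J) (max |ξ| √|η| * 2 ^ J)⁻¹ :=
        Finset.sum_le_sum fun J _ => (hF J).norm_ft_shear_le (by positivity) hC hc (hmean J) hN
    _ = 4 * C * (2 + 3 * c) * π *
          ∑ J ∈ S, min (max |ξ| √|η| * 2 ^ J) (max |ξ| √|η| * 2 ^ J)⁻¹ := by rw [Finset.mul_sum]
    _ ≤ 4 * C * (2 + 3 * c) * π * (2 * (1 - 2⁻¹)⁻¹) := by
        gcongr; exact sum_min_zpow_le S hN (by norm_num)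
    _ = _ := by norm_num; ring

theorem Bump.continuous_sum_shear {C c : ℝ} {r s : ℤ → ℝ} {F : ℤ → ℝ → ℝ → ℂ}
    (hF : ∀ J, Bump C (r J) (s J) (F J)) (S : Finset ℤ) :
    Continuous fun z => ∑ J ∈ S, shear c (F J) z :=
  continuous_finsetSum _ fun J _ => (hF J).continuous_shear

theorem Bump.hasCompactSupport_sum_shear {C c : ℝ} (hc : 0 ≤ c) {r s : ℤ → ℝ}
    {F : ℤ → ℝ → ℝ → ℂ} (hF : ∀ J, Bump C (r J) (s J) (F J)) (S : Finset ℤ) :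
    HasCompactSupport fun z => ∑ J ∈ S, shear c (F J) z := by
  classical
  induction S using Finset.induction_on with
  | empty => exact HasCompactSupport.zero
  | insert J S hJ ih =>
    simp only [Finset.sum_insert hJ]
    exact ((hF J).hasCompactSupport_shear hc).add ih

/-- Sums of dyadic sheared bumps of relative thickness `2⁻ⁿ` with vanishing vertical means are
bounded on `L^p` with exponential decay in `n`. -/
theorem exists_lpBound_sum_shear {p C c : ℝ} (hp : 1 < p) (hC : 0 ≤ C) (hc : 0 < c) :
    ∃ C' δ : ℝ, 0 ≤ C' ∧ 0 < δ ∧ ∀ (n : ℕ) (F : ℤ → ℝ → ℝ → ℂ),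
      (∀ J, Bump C (2 ^ J) (4 ^ J / 2 ^ n) (F J)) → (∀ J x, ∫ y, F J x y = 0) →
      ∀ S : Finset ℤ, LpBound (fun z => ∑ J ∈ S, shear c (F J) z) p (C' * 2 ^ (-δ * n)) := by
  set B := 2 * C * √((4 + 8 * π) / √c) * (2 * (1 - ((4 : ℝ) ^ (1 / 4 : ℝ))⁻¹)⁻¹) with hB
  obtain ⟨C', δ, h1, h2, h3⟩ := exists_lpBound_decay hp (L := 2 + c) (B := max B 1)
    (A := fun ε => |8 * C * (2 + 3 * c) * (1 - 2 ^ (-ε))⁻¹|) (by positivity)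
    (lt_max_of_lt_right one_pos) fun ε => abs_nonneg _
  refine ⟨C', δ, h1, h2, fun n F hF hmean S => h3 n _ (Bump.continuous_sum_shear hF S)
    (Bump.hasCompactSupport_sum_shear hc.le hF S) (fun ε hε hε1 => ?_) fun ξ η => ?_⟩
  · have hq1 : (2 : ℝ) ^ (-ε) < 1 :=
      Real.rpow_lt_one_of_one_lt_of_neg (by norm_num) (by linarith)
    have hq : 0 < 1 - (2 : ℝ) ^ (-ε) := by linarith
    rw [abs_of_nonneg (by positivity)]
    exact hor_sum_shear hC hc.le hF S hε hε1
  · refine (norm_ft_sum_shear_le hC hc hF hmean S ξ η).trans ?_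
    gcongr
    exact le_max_left _ _

/-- Sums of dyadic sheared bumps of mean zero are bounded on `L^p`. -/
theorem exists_lpBound_sum_shear_of_mean_zero {p C c : ℝ} (hp : 1 < p) (hC : 0 ≤ C) (hc : 0 < c) :
    ∃ C' : ℝ, 0 ≤ C' ∧ ∀ F : ℤ → ℝ → ℝ → ℂ,
      (∀ J, Bump C (2 ^ J) (4 ^ J) (F J)) → (∀ J, ∫ p : ℝ × ℝ, F J p.1 p.2 = 0) →
      ∀ S : Finset ℤ, LpBound (fun z => ∑ J ∈ S, shear c (F J) z) p C' := by
  set B := 16 * C * (2 + 3 * c) * π with hB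
  obtain ⟨C', δ, h1, -, h3⟩ := exists_lpBound_decay hp (L := 2 + c) (B := max B 1)
    (A := fun ε => |8 * C * (2 + 3 * c) * (1 - 2 ^ (-ε))⁻¹|) (by positivity)
    (lt_max_of_lt_right one_pos) fun ε => abs_nonneg _
  refine ⟨C', h1, fun F hF hmean S => ?_⟩
  have := h3 0 _ (Bump.continuous_sum_shear hF S)
    (Bump.hasCompactSupport_sum_shear hc.le hF S) (fun ε hε hε1 => ?_) fun ξ η => ?_
  · simpa using this
  · have hq1 : (2 : ℝ) ^ (-ε) < 1 :=
      Real.rpow_lt_one_of_one_lt_of_neg (by norm_num) (by linarith)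
    have hq : 0 < 1 - (2 : ℝ) ^ (-ε) := by linarith
    rw [abs_of_nonneg (by positivity)]
    exact hor_sum_shear (n := 0) hC hc.le (by simpa using hF) S hε hε1
  · refine (norm_ft_sum_shear_le_of_mean_zero hC hc.le hF hmean S ξ η).trans ?_
    simp [hB]

/-- A fixed smooth cutoff, equal to `1` on `[-1/2,1/2]` and supported in `[-1,1]`. -/
def rho : ℝ → ℝ := (⟨1 / 2, 1, by norm_num, by norm_num⟩ : ContDiffBump (0 : ℝ))

theorem contDiff_rho : ContDiff ℝ (⊤ : ℕ∞) rho := ContDiffBump.contDiff _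

theorem continuous_rho : Continuous rho := contDiff_rho.continuous

theorem differentiable_rho : Differentiable ℝ rho := contDiff_rho.differentiable (by simp)

theorem rho_eq_one {t : ℝ} (ht : |t| ≤ 1 / 2) : rho t = 1 :=
  ContDiffBump.one_of_mem_closedBall _ (by simpa using ht)

theorem rho_eq_zero {t : ℝ} (ht : 1 ≤ |t|) : rho t = 0 :=
  ContDiffBump.zero_of_le_dist _ (by simpa using ht)

theorem rho_nonneg (t : ℝ) : 0 ≤ rho t := ContDiffBump.nonneg _

theorem abs_rho_le_one (t : ℝ) : |rho t| ≤ 1 := by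
  rw [abs_of_nonneg (rho_nonneg t)]; exact ContDiffBump.le_one _

theorem hasCompactSupport_rho : HasCompactSupport rho := ContDiffBump.hasCompactSupport _

theorem deriv_rho_eq_zero {t : ℝ} (ht : |t| < 1 / 2) : deriv rho t = 0 := by
  have : rho =ᶠ[𝓝 t] fun _ => 1 := by
    filter_upwards [(isOpen_lt continuous_abs continuous_const).mem_nhds ht] with u hu
    exact rho_eq_one (le_of_lt hu)
  rw [this.deriv_eq]; simp

theorem exists_deriv_rho_bound : ∃ D : ℝ, 1 ≤ D ∧ ∀ t, |deriv rho t| ≤ D := by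
  obtain ⟨D, hD⟩ := hasCompactSupport_rho.deriv.exists_bound_of_continuous
    (contDiff_rho.continuous_deriv (by simp))
  exact ⟨max D 1, le_max_right _ _, fun t => (hD t).trans (le_max_left _ _)⟩

/-- A bound for `rho` and its derivative. -/
def rhoD : ℝ := exists_deriv_rho_bound.choose

theorem one_le_rhoD : 1 ≤ rhoD := exists_deriv_rho_bound.choose_spec.1

theorem abs_deriv_rho_le (t : ℝ) : |deriv rho t| ≤ rhoD := exists_deriv_rho_bound.choose_spec.2 t

theorem rhoD_pos : 0 < rhoD := one_pos.trans_le one_le_rhoD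

theorem isNormalizedBump_rho : IsNormalizedBump fun t => rho t / rhoD := by
  refine ⟨contDiff_rho.div_const _, fun t ht => by simp [rho_eq_zero ht.le], fun t => ?_,
    fun t => ?_⟩
  · rw [abs_div, abs_of_pos rhoD_pos, div_le_one rhoD_pos]
    exact (abs_rho_le_one t).trans one_le_rhoD
  · rw [deriv_div_const, abs_div, abs_of_pos rhoD_pos, div_le_one rhoD_pos]
    exact abs_deriv_rho_le t

/-- The integral of the cutoff. -/
def rhoI : ℝ := ∫ t, rho t

theorem rhoI_pos : 0 < rhoI :=
  ContDiffBump.integral_pos (μ := volume) (⟨1 / 2, 1, by norm_num, by norm_num⟩ : ContDiffBump (0 : ℝ))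

theorem integral_rho_div {s : ℝ} (hs : 0 < s) : ∫ y, rho (y / s) = rhoI * s := by
  rw [Measure.integral_comp_div rho s, abs_of_pos hs, smul_eq_mul, mul_comm]; rfl

/-- The partial average of `M` in the second variable at scale `s`. -/
def avg (M : ℝ → ℝ → ℂ) (s x : ℝ) : ℂ := ∫ y, M x y * (rho (y / s) : ℂ)

/-- The estimates on a flag kernel used below, with a single constant and a single cutoff. -/
structure FlagCore (A : ℝ) (M : ℝ → ℝ → ℂ) : Prop where
  contDiff : ContDiff ℝ 1 fun p : ℝ × ℝ => M p.1 p.2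
  hasCompactSupport : HasCompactSupport fun p : ℝ × ℝ => M p.1 p.2
  bound : ∀ x y, y ≠ 0 → ‖M x y‖ ≤ A / ((|x| + √|y|) * |y|)
  bound_fst : ∀ x y, y ≠ 0 → ‖deriv (fun x' => M x' y) x‖ ≤ A / ((|x| + √|y|) ^ 2 * |y|)
  bound_snd : ∀ x y, y ≠ 0 → ‖deriv (M x) y‖ ≤ A / ((|x| + √|y|) * |y| ^ 2)
  avg_bound : ∀ s x, 0 < s → x ≠ 0 → ‖avg M s x‖ ≤ A / |x|
  avg_deriv : ∀ s x, 0 < s → x ≠ 0 → ‖deriv (avg M s) x‖ ≤ A / |x| ^ 2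
  avg_avg : ∀ r s, 0 < r → 0 < s → ‖∫ x, avg M s x * (rho (x / r) : ℂ)‖ ≤ A

/-- The constant in `FlagCore` produced by the flag seminorms. -/
def coreConst (Cab : ℕ → ℕ → ℝ) (C1 : ℕ → ℝ) (C2 : ℝ) : ℝ :=
  |Cab 0 0| + |Cab 1 0| + |Cab 0 1| + rhoD * |C1 0| + rhoD * |C1 1| + rhoD ^ 2 * |C2|

theorem avg_eq (M : ℝ → ℝ → ℂ) (s x : ℝ) :
    avg M s x = rhoD * ∫ y, M x y * ((rho (s⁻¹ * y) / rhoD : ℝ) : ℂ) := by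
  rw [avg, ← integral_const_mul]
  refine integral_congr_ae (ae_of_all _ fun y => ?_)
  have : (rhoD : ℂ) ≠ 0 := by exact_mod_cast rhoD_pos.ne'
  simp only
  push_cast
  rw [inv_mul_eq_div]
  field_simp

theorem FlagF1FunBounds.core {Cab : ℕ → ℕ → ℝ} {C1 : ℕ → ℝ} {C2 : ℝ} {M : ℝ → ℝ → ℂ}
    (h : FlagF1FunBounds Cab C1 C2 M) : FlagCore (coreConst Cab C1 C2) M := by
  obtain ⟨h1, h2, h3, h4⟩ := h
  have hD := rhoD_pos
  have k1 : |Cab 0 0| ≤ coreConst Cab C1 C2 := by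
    unfold coreConst; linarith [abs_nonneg (Cab 1 0), abs_nonneg (Cab 0 1),
      (by positivity : 0 ≤ rhoD * |C1 0|), (by positivity : 0 ≤ rhoD * |C1 1|),
      (by positivity : 0 ≤ rhoD ^ 2 * |C2|)]
  have k2 : |Cab 1 0| ≤ coreConst Cab C1 C2 := by
    unfold coreConst; linarith [abs_nonneg (Cab 0 0), abs_nonneg (Cab 0 1),
      (by positivity : 0 ≤ rhoD * |C1 0|), (by positivity : 0 ≤ rhoD * |C1 1|),
      (by positivity : 0 ≤ rhoD ^ 2 * |C2|)]
  have k3 : |Cab 0 1| ≤ coreConst Cab C1 C2 := by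
    unfold coreConst; linarith [abs_nonneg (Cab 0 0), abs_nonneg (Cab 1 0),
      (by positivity : 0 ≤ rhoD * |C1 0|), (by positivity : 0 ≤ rhoD * |C1 1|),
      (by positivity : 0 ≤ rhoD ^ 2 * |C2|)]
  have k4 : rhoD * |C1 0| ≤ coreConst Cab C1 C2 := by
    unfold coreConst; linarith [abs_nonneg (Cab 0 0), abs_nonneg (Cab 1 0), abs_nonneg (Cab 0 1),
      (by positivity : 0 ≤ rhoD * |C1 1|), (by positivity : 0 ≤ rhoD ^ 2 * |C2|)]
  have k5 : rhoD * |C1 1| ≤ coreConst Cab C1 C2 := by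
    unfold coreConst; linarith [abs_nonneg (Cab 0 0), abs_nonneg (Cab 1 0), abs_nonneg (Cab 0 1),
      (by positivity : 0 ≤ rhoD * |C1 0|), (by positivity : 0 ≤ rhoD ^ 2 * |C2|)]
  have k6 : rhoD ^ 2 * |C2| ≤ coreConst Cab C1 C2 := by
    unfold coreConst; linarith [abs_nonneg (Cab 0 0), abs_nonneg (Cab 1 0), abs_nonneg (Cab 0 1),
      (by positivity : 0 ≤ rhoD * |C1 0|), (by positivity : 0 ≤ rhoD * |C1 1|)]
  have pow1 : ∀ t : ℝ, 0 ≤ t → t ^ (-1 - ((0 : ℕ) : ℝ)) = t⁻¹ := fun t _ => by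
    simp [Real.rpow_neg_one]
  have pow2 : ∀ t : ℝ, 0 ≤ t → t ^ (-1 - ((1 : ℕ) : ℝ)) = (t ^ 2)⁻¹ := fun t ht => by
    rw [show (-1 - ((1 : ℕ) : ℝ)) = -((2 : ℕ) : ℝ) by norm_num, Real.rpow_neg ht, Real.rpow_natCast]
  have hs0 : ∀ x y : ℝ, 0 ≤ |x| + √|y| := fun x y => by positivity
  refine ⟨h1.of_le (by exact_mod_cast le_top), h2, fun x y hy => ?_, fun x y hy => ?_,
    fun x y hy => ?_, fun s x hs hx => ?_, fun s x hs hx => ?_, fun r s hr hs => ?_⟩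
  · have := h3 0 0 x y hy
    rw [← Real.sqrt_eq_rpow, pow1 _ (hs0 x y), pow1 _ (abs_nonneg y)] at this
    simp only [iteratedDeriv_zero] at this
    refine this.trans ?_
    rw [mul_assoc, ← mul_inv, ← div_eq_mul_inv]
    gcongr
    exact (le_abs_self _).trans k1
  · have := h3 1 0 x y hy
    rw [← Real.sqrt_eq_rpow, pow2 _ (hs0 x y), pow1 _ (abs_nonneg y)] at this
    simp only [iteratedDeriv_zero, iteratedDeriv_one] at this
    refine this.trans ?_
    rw [mul_assoc, ← mul_inv, ← div_eq_mul_inv]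
    gcongr
    exact (le_abs_self _).trans k2
  · have := h3 0 1 x y hy
    rw [← Real.sqrt_eq_rpow, pow1 _ (hs0 x y), pow2 _ (abs_nonneg y)] at this
    simp only [iteratedDeriv_zero, iteratedDeriv_one] at this
    refine this.trans ?_
    rw [mul_assoc, ← mul_inv, ← div_eq_mul_inv]
    gcongr
    exact (le_abs_self _).trans k3
  · have := (h4 _ isNormalizedBump_rho s⁻¹ (inv_pos.2 hs)).2.2.1 0 x hx
    rw [pow1 _ (abs_nonneg x)] at this
    simp only [iteratedDeriv_zero] at this
    rw [avg_eq, norm_mul, Complex.norm_real, norm_eq_abs, abs_of_pos hD]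
    calc _ ≤ rhoD * (C1 0 * |x|⁻¹) := by gcongr
      _ = rhoD * C1 0 / |x| := by ring
      _ ≤ _ := by gcongr; exact (mul_le_mul_of_nonneg_left (le_abs_self _) hD.le).trans k4
  · have := (h4 _ isNormalizedBump_rho s⁻¹ (inv_pos.2 hs)).2.2.1 1 x hx
    rw [pow2 _ (abs_nonneg x)] at this
    simp only [iteratedDeriv_one] at this
    rw [funext (avg_eq M s), deriv_const_mul_field, norm_mul, Complex.norm_real, norm_eq_abs,
      abs_of_pos hD]
    calc _ ≤ rhoD * (C1 1 * (|x| ^ 2)⁻¹) := by gcongr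
      _ = rhoD * C1 1 / |x| ^ 2 := by ring
      _ ≤ _ := by gcongr; exact (mul_le_mul_of_nonneg_left (le_abs_self _) hD.le).trans k5
  · have := (h4 _ isNormalizedBump_rho s⁻¹ (inv_pos.2 hs)).2.2.2 r⁻¹ (inv_pos.2 hr) _
      isNormalizedBump_rho
    have e : ∫ x, avg M s x * (rho (x / r) : ℂ) = (rhoD : ℂ) ^ 2 * ∫ x : ℝ,
        (∫ y : ℝ, M x y * ((rho (s⁻¹ * y) / rhoD : ℝ) : ℂ)) * ((rho (r⁻¹ * x) / rhoD : ℝ) : ℂ) := by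
      rw [← integral_const_mul]
      refine integral_congr_ae (ae_of_all _ fun x => ?_)
      have : (rhoD : ℂ) ≠ 0 := by exact_mod_cast rhoD_pos.ne'
      simp only [avg_eq]
      push_cast
      rw [inv_mul_eq_div r]
      field_simp
    rw [e, norm_mul, norm_pow, Complex.norm_real, norm_eq_abs, abs_of_pos hD]
    exact (mul_le_mul_of_nonneg_left (this.trans (le_abs_self _)) (by positivity)).trans k6

namespace Bump

variable {C C' r s : ℝ} {F G : ℝ → ℝ → ℂ}

theorem add (hF : Bump C r s F) (hG : Bump C' r s G) :
    Bump (C + C') r s fun x y => F x y + G x y where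
  continuous := hF.continuous.add hG.continuous
  support x y h := by
    by_cases h0 : F x y = 0
    · exact hG.support x y fun h1 => h (by rw [h0, h1, add_zero])
    · exact hF.support x y h0
  bound x y := by
    rw [add_div]
    exact (norm_add_le _ _).trans (add_le_add (hF.bound x y) (hG.bound x y))
  lip_fst x x' y := by
    rw [add_div, add_mul, add_sub_add_comm]
    exact (norm_add_le _ _).trans (add_le_add (hF.lip_fst x x' y) (hG.lip_fst x x' y))
  lip_snd x y y' := by
    rw [add_div, add_mul, add_sub_add_comm]
    exact (norm_add_le _ _).trans (add_le_add (hF.lip_snd x y y') (hG.lip_snd x y y'))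

theorem neg (hF : Bump C r s F) : Bump C r s fun x y => -F x y where
  continuous := hF.continuous.neg
  support x y h := hF.support x y fun h1 => h (by rw [h1, neg_zero])
  bound x y := by rw [norm_neg]; exact hF.bound x y
  lip_fst x x' y := by
    rw [← norm_neg, show -(-F x y - -F x' y) = F x y - F x' y by ring]; exact hF.lip_fst x x' y
  lip_snd x y y' := by
    rw [← norm_neg, show -(-F x y - -F x y') = F x y - F x y' by ring]; exact hF.lip_snd x y y'

theorem sub (hF : Bump C r s F) (hG : Bump C' r s G) :
    Bump (C + C') r s fun x y => F x y - G x y := by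
  simpa only [sub_eq_add_neg] using hF.add hG.neg

/-- A bump is also a bump at comparable larger scales. -/
theorem rescale (hF : Bump C r s F) (hr : 0 < r) (hs : 0 < s) (hC : 0 ≤ C) {κ r' s' : ℝ}
    (hκ : 1 ≤ κ) (hr1 : r ≤ r') (hr2 : r' ≤ κ * r) (hs1 : s ≤ s') (hs2 : s' ≤ κ * s) :
    Bump (C * κ ^ 3) r' s' F := by
  have hκ0 : 0 < κ := by linarith
  have hr' : 0 < r' := by linarith
  have hs' : 0 < s' := by linarith
  have e1 : r⁻¹ ≤ κ / r' := by
    rw [← one_div, div_le_div_iff₀ hr hr']; linarith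
  have e2 : s⁻¹ ≤ κ / s' := by
    rw [← one_div, div_le_div_iff₀ hs hs']; linarith
  have e3 : C / (r * s) ≤ C * κ ^ 2 / (r' * s') := by
    calc C / (r * s) = C * (r⁻¹ * s⁻¹) := by rw [← mul_inv]; rfl
      _ ≤ C * ((κ / r') * (κ / s')) := by gcongr
      _ = _ := by field_simp
  refine ⟨hF.continuous, fun x y h => ?_, fun x y => ?_, fun x x' y => ?_, fun x y y' => ?_⟩
  · obtain ⟨h1, h2⟩ := hF.support x y h
    exact ⟨h1.trans hr1, h2.trans hs1⟩
  · refine (hF.bound x y).trans (e3.trans ?_)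
    gcongr
    · norm_num
  · refine (hF.lip_fst x x' y).trans ?_
    calc C / (r * s) * (|x - x'| / r) = C / (r * s) * (|x - x'| * r⁻¹) := rfl
      _ ≤ C * κ ^ 2 / (r' * s') * (|x - x'| * (κ / r')) := by gcongr
      _ = _ := by ring
  · refine (hF.lip_snd x y y').trans ?_
    calc C / (r * s) * (|y - y'| / s) = C / (r * s) * (|y - y'| * s⁻¹) := rfl
      _ ≤ C * κ ^ 2 / (r' * s') * (|y - y'| * (κ / s')) := by gcongr
      _ = _ := by ring

end Bump

/-- A cutoff at scale `r` vanishing near `|x| < l`. -/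
structure Cut (B r l : ℝ) (α : ℝ → ℝ) : Prop where
  differentiable : Differentiable ℝ α
  far : ∀ x, r < |x| → α x = 0
  near : ∀ x, |x| < l → α x = 0 ∧ deriv α x = 0
  bound : ∀ x, |α x| ≤ B
  deriv_bound : ∀ x, |deriv α x| ≤ B / r

namespace Cut

variable {B r l : ℝ} {α : ℝ → ℝ}

theorem nonneg (h : Cut B r l α) : 0 ≤ B := (abs_nonneg _).trans (h.bound 0)

theorem lip (h : Cut B r l α) (x x' : ℝ) : |α x - α x'| ≤ B / r * |x - x'| :=
  convex_univ.norm_image_sub_le_of_norm_deriv_le (fun t _ => h.differentiable t)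
    (fun t _ => h.deriv_bound t) (Set.mem_univ x') (Set.mem_univ x)

theorem dist_le (h : Cut B r l α) (x x' : ℝ) :
    ‖((α x : ℝ) : ℂ) - ((α x' : ℝ) : ℂ)‖ ≤ B / r * |x - x'| := by
  rw [← Complex.ofReal_sub, Complex.norm_real]; exact h.lip x x'

theorem hasDerivAt_ofReal (h : Cut B r l α) (x : ℝ) :
    HasDerivAt (fun t => ((α t : ℝ) : ℂ)) ((deriv α x : ℝ) : ℂ) x :=
  (h.differentiable x).hasDerivAt.ofReal_comp

end Cut

theorem cut_rho {r k : ℝ} (hr : 0 < r) (hk : 1 ≤ k) :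
    Cut (k * rhoD) r 0 fun x => rho (k * x / r) := by
  have hk0 : 0 < k := by linarith
  have hd : ∀ x, HasDerivAt (fun x => rho (k * x / r)) (deriv rho (k * x / r) * (k / r)) x := by
    intro x
    refine (differentiable_rho _).hasDerivAt.comp x ?_
    simpa using ((hasDerivAt_id x).const_mul k).div_const r
  refine ⟨fun x => (hd x).differentiableAt, fun x hx => rho_eq_zero ?_, fun x hx => ?_,
    fun x => ?_, fun x => ?_⟩
  · rw [abs_div, abs_mul, abs_of_pos hr, abs_of_pos hk0, le_div_iff₀ hr, one_mul]
    nlinarith [abs_nonneg x]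
  · exact absurd hx (not_lt.2 (abs_nonneg x))
  · exact (abs_rho_le_one _).trans (one_le_mul_of_one_le_of_one_le hk one_le_rhoD)
  · rw [(hd x).deriv, abs_mul, abs_of_pos (div_pos hk0 hr)]
    calc _ ≤ rhoD * (k / r) := by gcongr; exact abs_deriv_rho_le _
      _ = _ := by ring

theorem cut_rho_sub {r j k : ℝ} (hr : 0 < r) (hj : 1 ≤ j) (hjk : j ≤ k) :
    Cut (2 * k * rhoD) r (r / (2 * k)) fun x => rho (j * x / r) - rho (k * x / r) := by
  have hk : 1 ≤ k := hj.trans hjk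
  have hk0 : 0 < k := by linarith
  have hj0 : 0 < j := by linarith
  have hD := rhoD_pos
  have c1 := cut_rho hr hj
  have c2 := cut_rho hr hk
  have hsub : ∀ x, deriv (fun x => rho (j * x / r) - rho (k * x / r)) x =
      deriv (fun x => rho (j * x / r)) x - deriv (fun x => rho (k * x / r)) x := fun x =>
    deriv_fun_sub (c1.differentiable x) (c2.differentiable x)
  have hnear : ∀ i : ℝ, 1 ≤ i → i ≤ k → ∀ x, |x| < r / (2 * k) → |i * x / r| < 1 / 2 := by
    intro i hi hik x hx
    have hi0 : 0 < i := by linarith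
    rw [lt_div_iff₀ (by positivity)] at hx
    rw [abs_div, abs_mul, abs_of_pos hr, abs_of_pos hi0, div_lt_iff₀ hr]
    nlinarith [abs_nonneg x]
  refine ⟨c1.differentiable.sub c2.differentiable, fun x hx => ?_, fun x hx => ?_, fun x => ?_,
    fun x => ?_⟩
  · simp [c1.far x hx, c2.far x hx]
  · have h1 := hnear j hj hjk x hx
    have h2 := hnear k hk le_rfl x hx
    refine ⟨by rw [rho_eq_one h1.le, rho_eq_one h2.le, sub_self], ?_⟩
    have hd : ∀ i : ℝ, HasDerivAt (fun x => rho (i * x / r)) (deriv rho (i * x / r) * (i / r)) x := by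
      intro i
      refine (differentiable_rho _).hasDerivAt.comp x ?_
      simpa using ((hasDerivAt_id x).const_mul i).div_const r
    rw [hsub, (hd j).deriv, (hd k).deriv, deriv_rho_eq_zero h1, deriv_rho_eq_zero h2]
    simp
  · have := (abs_sub (rho (j * x / r)) (rho (k * x / r))).trans
      (add_le_add (c1.bound x) (c2.bound x))
    nlinarith
  · rw [hsub]
    refine (abs_sub _ _).trans ((add_le_add (c1.deriv_bound x) (c2.deriv_bound x)).trans ?_)
    rw [← add_div]
    gcongr
    nlinarith

/-- A tensor product of a one-variable bump with a cutoff. -/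
theorem bump_tensor {E B r s l : ℝ} (hr : 0 < r) (hs : 0 < s) (hE : 0 ≤ E) {γ : ℝ → ℂ}
    {β : ℝ → ℝ}
    (hγ : ∀ x, r < |x| → γ x = 0) (hγb : ∀ x, ‖γ x‖ ≤ E / r)
    (hγl : ∀ x x', ‖γ x - γ x'‖ ≤ E / r * (|x - x'| / r)) (hβ : Cut B s l β) :
    Bump (E * B) r s fun x y => γ x * ((β y : ℂ) / s) := by
  have hB := hβ.nonneg
  have hγc : Continuous γ := by
    have : LipschitzWith (Real.toNNReal (E / r / r)) γ := LipschitzWith.of_dist_le_mul fun x y => by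
      rw [dist_eq_norm, Real.coe_toNNReal _ (by positivity), Real.dist_eq]
      exact (hγl x y).trans (le_of_eq (by ring))
    exact this.continuous
  have hβs : ∀ y, ‖(β y : ℂ) / s‖ ≤ B / s := fun y => by
    rw [norm_div, Complex.norm_real, Complex.norm_real, norm_eq_abs, norm_eq_abs, abs_of_pos hs]
    gcongr; exact hβ.bound y
  refine ⟨?_, fun x y h => ?_, fun x y => ?_, fun x x' y => ?_, fun x y y' => ?_⟩
  · have := hβ.differentiable.continuous
    fun_prop
  · simp only [ne_eq, mul_eq_zero, not_or] at h
    exact ⟨not_lt.1 fun hx => h.1 (hγ x hx), not_lt.1 fun hy => h.2 (by simp [hβ.far y hy])⟩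
  · rw [norm_mul]
    calc _ ≤ (E / r) * (B / s) := by gcongr; exacts [hγb x, hβs y]
      _ = _ := by field_simp
  · rw [← sub_mul, norm_mul]
    calc _ ≤ (E / r * (|x - x'| / r)) * (B / s) := by gcongr; exacts [hγl x x', hβs y]
      _ = _ := by field_simp
  · rw [← mul_sub, ← _root_.sub_div, norm_mul, norm_div, Complex.norm_real s, norm_eq_abs, abs_of_pos hs]
    calc _ ≤ (E / r) * (B / s * |y - y'| / s) := by gcongr; exacts [hγb x, hβ.dist_le y y']
      _ = _ := by field_simp

namespace FlagCore

variable {A : ℝ} {M : ℝ → ℝ → ℂ}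

theorem nonneg (h : FlagCore A M) : 0 ≤ A :=
  (norm_nonneg _).trans (h.avg_avg 1 1 one_pos one_pos)

theorem continuous (h : FlagCore A M) : Continuous fun p : ℝ × ℝ => M p.1 p.2 :=
  h.contDiff.continuous

theorem hasFDerivAt (h : FlagCore A M) (p : ℝ × ℝ) :
    HasFDerivAt (fun p : ℝ × ℝ => M p.1 p.2) (fderiv ℝ (fun p : ℝ × ℝ => M p.1 p.2) p) p :=
  (h.contDiff.differentiable one_ne_zero p).hasFDerivAt

theorem hasDerivAt_fst (h : FlagCore A M) (x y : ℝ) :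
    HasDerivAt (fun x' => M x' y) (deriv (fun x' => M x' y) x) x := by
  have h2 : HasDerivAt (fun x' : ℝ => (x', y)) ((1 : ℝ), (0 : ℝ)) x :=
    (hasDerivAt_id x).prodMk (hasDerivAt_const x y)
  exact ((h.hasFDerivAt (x, y)).comp_hasDerivAt x h2).differentiableAt.hasDerivAt

theorem hasDerivAt_snd (h : FlagCore A M) (x y : ℝ) :
    HasDerivAt (M x) (deriv (M x) y) y := by
  have h2 : HasDerivAt (fun y' : ℝ => (x, y')) ((0 : ℝ), (1 : ℝ)) y :=
    (hasDerivAt_const y x).prodMk (hasDerivAt_id y)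
  exact ((h.hasFDerivAt (x, y)).comp_hasDerivAt y h2).differentiableAt.hasDerivAt

theorem deriv_fst_eq (h : FlagCore A M) (x y : ℝ) : deriv (fun x' => M x' y) x =
    fderiv ℝ (fun p : ℝ × ℝ => M p.1 p.2) (x, y) (1, 0) := by
  have h2 : HasDerivAt (fun x' : ℝ => (x', y)) ((1 : ℝ), (0 : ℝ)) x :=
    (hasDerivAt_id x).prodMk (hasDerivAt_const x y)
  exact ((h.hasFDerivAt (x, y)).comp_hasDerivAt x h2).deriv

theorem differentiable_avg (h : FlagCore A M) {s : ℝ} (hs : 0 < s) :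
    Differentiable ℝ (avg M s) := by
  have hdc : Continuous fun p : ℝ × ℝ => fderiv ℝ (fun p : ℝ × ℝ => M p.1 p.2) p (1, 0) :=
    (h.contDiff.continuous_fderiv one_ne_zero).clm_apply continuous_const
  obtain ⟨K, hK⟩ := (h.hasCompactSupport.fderiv_apply (𝕜 := ℝ) (1, 0)).exists_bound_of_continuous hdc
  have hρ : Continuous fun y : ℝ => rho (y / s) := continuous_rho.comp (by fun_prop)
  have hρs : ∀ y, y ∉ Metric.closedBall (0 : ℝ) s → rho (y / s) = 0 := fun y hy => by
    simp only [Metric.mem_closedBall, dist_zero_right, norm_eq_abs, not_le] at hy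
    refine rho_eq_zero ?_
    rw [abs_div, abs_of_pos hs, le_div_iff₀ hs]; linarith
  have hMc : ∀ x, Continuous (M x) := fun x =>
    h.continuous.comp (by fun_prop : Continuous fun y : ℝ => (x, y))
  have hFc : ∀ x, Continuous fun y => M x y * (rho (y / s) : ℂ) := fun x =>
    (hMc x).mul (Complex.continuous_ofReal.comp hρ)
  intro x
  refine (hasDerivAt_integral_of_dominated_loc_of_deriv_le (μ := volume)
    (F := fun x y => M x y * (rho (y / s) : ℂ))
    (F' := fun x y => deriv (fun x' => M x' y) x * (rho (y / s) : ℂ))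
    (bound := fun y => K * |rho (y / s)|) (s := Set.univ) univ_mem
    (Eventually.of_forall fun x => (hFc x).aestronglyMeasurable) ?_ ?_ ?_ ?_ ?_).2.differentiableAt
  · exact (hFc x).integrable_of_hasCompactSupport (HasCompactSupport.intro
      (isCompact_closedBall (0 : ℝ) s) fun y hy => by simp [hρs y hy])
  · simp_rw [h.deriv_fst_eq]
    exact ((hdc.comp (by fun_prop : Continuous fun y : ℝ => (x, y))).mul
      (Complex.continuous_ofReal.comp hρ)).aestronglyMeasurable
  · refine ae_of_all _ fun y x' _ => ?_
    rw [norm_mul, Complex.norm_real, norm_eq_abs, h.deriv_fst_eq]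
    gcongr
    exact hK (x', y)
  · exact (continuous_const.mul hρ.abs).integrable_of_hasCompactSupport (HasCompactSupport.intro
      (isCompact_closedBall (0 : ℝ) s) fun y hy => by simp [hρs y hy])
  · exact ae_of_all _ fun y x' _ => (h.hasDerivAt_fst x' y).mul_const _

/-- Localizing a flag kernel away from its singularities gives a bump. -/
theorem bump_mul (h : FlagCore A M) {B B' r s l l' κ : ℝ} (hr : 0 < r) (hs : 0 < s) (hκ : 1 ≤ κ)
    {α β : ℝ → ℝ} (hα : Cut B r l α) (hβ : Cut B' s l' β) (hl' : s / κ ≤ l')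
    (hl : r / κ ≤ l ∨ (r / κ) ^ 2 ≤ l') :
    Bump (2 * A * B * B' * κ ^ 3) r s fun x y => (α x : ℂ) * (β y : ℂ) * M x y := by
  have hA := h.nonneg
  have hB := hα.nonneg
  have hB' := hβ.nonneg
  have hκ0 : 0 < κ := by linarith
  have hsκ : 0 < s / κ := by positivity
  have hrκ : 0 < r / κ := by positivity
  have good : ∀ x y, (s / κ ≤ |y| ∧ r / κ ≤ |x| + √|y|) ∨ (α x = 0 ∧ deriv α x = 0) ∨
      (β y = 0 ∧ deriv β y = 0) := by
    intro x y
    rcases lt_or_ge |y| l' with hy | hy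
    · exact Or.inr (Or.inr (hβ.near y hy))
    rcases hl with hl | hl
    · rcases lt_or_ge |x| l with hx | hx
      · exact Or.inr (Or.inl (hα.near x hx))
      · exact Or.inl ⟨hl'.trans hy, by linarith [Real.sqrt_nonneg |y|]⟩
    · refine Or.inl ⟨hl'.trans hy, ?_⟩
      have := Real.le_sqrt_of_sq_le (hl.trans hy)
      linarith [abs_nonneg x]
  have ne : ∀ y, s / κ ≤ |y| → y ≠ 0 := fun y hy h0 => by simp [h0] at hy; linarith
  have m0 : ∀ x y, s / κ ≤ |y| → r / κ ≤ |x| + √|y| → ‖M x y‖ ≤ A * κ ^ 2 / (r * s) := by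
    intro x y h1 h2
    refine (h.bound x y (ne y h1)).trans ?_
    calc A / ((|x| + √|y|) * |y|) ≤ A / ((r / κ) * (s / κ)) := by gcongr
      _ = _ := by field_simp
  have m1 : ∀ x y, s / κ ≤ |y| → r / κ ≤ |x| + √|y| →
      ‖deriv (fun x' => M x' y) x‖ ≤ A * κ ^ 3 / (r ^ 2 * s) := by
    intro x y h1 h2
    refine (h.bound_fst x y (ne y h1)).trans ?_
    calc A / ((|x| + √|y|) ^ 2 * |y|) ≤ A / ((r / κ) ^ 2 * (s / κ)) := by gcongr
      _ = _ := by field_simp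
  have m2 : ∀ x y, s / κ ≤ |y| → r / κ ≤ |x| + √|y| →
      ‖deriv (M x) y‖ ≤ A * κ ^ 3 / (r * s ^ 2) := by
    intro x y h1 h2
    refine (h.bound_snd x y (ne y h1)).trans ?_
    calc A / ((|x| + √|y|) * |y| ^ 2) ≤ A / ((r / κ) * (s / κ) ^ 2) := by gcongr
      _ = _ := by field_simp
  have nα : ∀ x, ‖(α x : ℂ)‖ ≤ B := fun x => by rw [Complex.norm_real]; exact hα.bound x
  have nβ : ∀ y, ‖(β y : ℂ)‖ ≤ B' := fun y => by rw [Complex.norm_real]; exact hβ.bound y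
  have nα' : ∀ x, ‖((deriv α x : ℝ) : ℂ)‖ ≤ B / r := fun x => by
    rw [Complex.norm_real]; exact hα.deriv_bound x
  have nβ' : ∀ y, ‖((deriv β y : ℝ) : ℂ)‖ ≤ B' / s := fun y => by
    rw [Complex.norm_real]; exact hβ.deriv_bound y
  have hκ23 : κ ^ 2 ≤ κ ^ 3 := pow_le_pow_right₀ hκ (by norm_num)
  refine ⟨?_, fun x y hne => ?_, fun x y => ?_, fun x x' y => ?_, fun x y y' => ?_⟩
  · have h1 := hα.differentiable.continuous
    have h2 := hβ.differentiable.continuous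
    have h3 := h.continuous
    fun_prop
  · simp only [ne_eq, mul_eq_zero, Complex.ofReal_eq_zero, not_or] at hne
    exact ⟨not_lt.1 fun hx => hne.1.1 (hα.far x hx), not_lt.1 fun hy => hne.1.2 (hβ.far y hy)⟩
  · rcases good x y with ⟨h1, h2⟩ | h1 | h1
    · rw [norm_mul, norm_mul]
      calc _ ≤ B * B' * (A * κ ^ 2 / (r * s)) := by gcongr; exacts [nα x, nβ y, m0 x y h1 h2]
        _ = A * B * B' * κ ^ 2 / (r * s) := by ring
        _ ≤ A * B * B' * κ ^ 3 / (r * s) := by gcongr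
        _ ≤ _ := by gcongr; linarith
    · simp only [h1.1, Complex.ofReal_zero, zero_mul, norm_zero]; positivity
    · simp only [h1.1, Complex.ofReal_zero, zero_mul, mul_zero, norm_zero]; positivity
  · have hd : ∀ x, HasDerivAt (fun x => (α x : ℂ) * (β y : ℂ) * M x y)
        (((deriv α x : ℝ) : ℂ) * (β y : ℂ) * M x y +
          (α x : ℂ) * (β y : ℂ) * deriv (fun x' => M x' y) x) x := fun x =>
      ((hα.hasDerivAt_ofReal x).mul_const _).mul (h.hasDerivAt_fst x y)
    have := convex_univ.norm_image_sub_le_of_norm_deriv_le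
      (C := 2 * A * B * B' * κ ^ 3 / (r * s) / r)
      (fun t _ => (hd t).differentiableAt) (fun t _ => ?_) (Set.mem_univ x') (Set.mem_univ x)
    · refine this.trans (le_of_eq ?_)
      rw [norm_eq_abs]; ring
    · rw [(hd t).deriv]
      rcases good t y with ⟨h1, h2⟩ | h1 | h1
      · refine (norm_add_le _ _).trans ?_
        rw [norm_mul, norm_mul, norm_mul, norm_mul]
        calc _ ≤ B / r * B' * (A * κ ^ 2 / (r * s)) + B * B' * (A * κ ^ 3 / (r ^ 2 * s)) := by
              gcongr
              exacts [nα' t, nβ y, m0 t y h1 h2, nα t, nβ y, m1 t y h1 h2]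
          _ ≤ B / r * B' * (A * κ ^ 3 / (r * s)) + B * B' * (A * κ ^ 3 / (r ^ 2 * s)) := by gcongr
          _ = _ := by field_simp; ring
      · simp only [h1.1, h1.2, Complex.ofReal_zero, zero_mul, add_zero, norm_zero]; positivity
      · simp only [h1.1, Complex.ofReal_zero, zero_mul, mul_zero, add_zero, norm_zero]; positivity
  · have hd : ∀ y, HasDerivAt (fun y => (α x : ℂ) * (β y : ℂ) * M x y)
        ((α x : ℂ) * ((deriv β y : ℝ) : ℂ) * M x y +
          (α x : ℂ) * (β y : ℂ) * deriv (M x) y) y := fun y =>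
      ((hβ.hasDerivAt_ofReal y).const_mul _).mul (h.hasDerivAt_snd x y)
    have := convex_univ.norm_image_sub_le_of_norm_deriv_le
      (C := 2 * A * B * B' * κ ^ 3 / (r * s) / s)
      (fun t _ => (hd t).differentiableAt) (fun t _ => ?_) (Set.mem_univ y') (Set.mem_univ y)
    · refine this.trans (le_of_eq ?_)
      rw [norm_eq_abs]; ring
    · rw [(hd t).deriv]
      rcases good x t with ⟨h1, h2⟩ | h1 | h1
      · refine (norm_add_le _ _).trans ?_
        rw [norm_mul, norm_mul, norm_mul, norm_mul]
        calc _ ≤ B * (B' / s) * (A * κ ^ 2 / (r * s)) + B * B' * (A * κ ^ 3 / (r * s ^ 2)) := by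
              gcongr
              exacts [nα x, nβ' t, m0 x t h1 h2, nα x, nβ t, m2 x t h1 h2]
          _ ≤ B * (B' / s) * (A * κ ^ 3 / (r * s)) + B * B' * (A * κ ^ 3 / (r * s ^ 2)) := by gcongr
          _ = _ := by field_simp; ring
      · simp only [h1.1, Complex.ofReal_zero, zero_mul, add_zero, norm_zero]; positivity
      · simp only [h1.1, h1.2, Complex.ofReal_zero, zero_mul, mul_zero, add_zero, norm_zero]
        positivity

theorem bump_avg (h : FlagCore A M) {B B' r s l l' κ t : ℝ} (hr : 0 < r) (hs : 0 < s) (hκ : 1 ≤ κ)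
    (ht : 0 < t) {α β : ℝ → ℝ} (hα : Cut B r l α) (hβ : Cut B' s l' β) (hl : r / κ ≤ l) :
    Bump (2 * A * B * κ ^ 2 / rhoI * B') r s
      fun x y => (α x : ℂ) * avg M t x / rhoI * ((β y : ℂ) / s) := by
  have hA := h.nonneg
  have hB := hα.nonneg
  have hI := rhoI_pos
  have hκ0 : 0 < κ := by linarith
  have hrκ : 0 < r / κ := by positivity
  have ne : ∀ x, l ≤ |x| → x ≠ 0 := fun x hx h0 => by simp [h0] at hx; linarith
  have nα : ∀ x, ‖(α x : ℂ)‖ ≤ B := fun x => by rw [Complex.norm_real]; exact hα.bound x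
  have nα' : ∀ x, ‖((deriv α x : ℝ) : ℂ)‖ ≤ B / r := fun x => by
    rw [Complex.norm_real]; exact hα.deriv_bound x
  have nI : ‖(rhoI : ℂ)‖ = rhoI := by rw [Complex.norm_real, norm_eq_abs, abs_of_pos hI]
  have m0 : ∀ x, l ≤ |x| → ‖avg M t x‖ ≤ A * κ / r := fun x hx => by
    refine (h.avg_bound t x ht (ne x hx)).trans ?_
    calc A / |x| ≤ A / (r / κ) := by gcongr; linarith
      _ = _ := by field_simp
  have m1 : ∀ x, l ≤ |x| → ‖deriv (avg M t) x‖ ≤ A * κ ^ 2 / r ^ 2 := fun x hx => by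
    refine (h.avg_deriv t x ht (ne x hx)).trans ?_
    calc A / |x| ^ 2 ≤ A / (r / κ) ^ 2 := by gcongr; linarith
      _ = _ := by field_simp
  have hκ12 : κ ≤ κ ^ 2 := by nlinarith
  refine bump_tensor hr hs (by positivity) (fun x hx => by simp [hα.far x hx]) (fun x => ?_)
    (fun x x' => ?_) hβ
  · rcases lt_or_ge |x| l with hx | hx
    · simp only [(hα.near x hx).1, Complex.ofReal_zero, zero_mul, zero_div, norm_zero]; positivity
    · rw [norm_div, norm_mul, nI]
      calc _ ≤ B * (A * κ / r) / rhoI := by gcongr; exacts [nα x, m0 x hx]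
        _ ≤ B * (A * κ ^ 2 / r) / rhoI := by gcongr
        _ ≤ 2 * (B * (A * κ ^ 2 / r) / rhoI) :=
            le_mul_of_one_le_left (by positivity) (by norm_num)
        _ = _ := by ring
  · have hd : ∀ x, HasDerivAt (fun x => (α x : ℂ) * avg M t x / rhoI)
        ((((deriv α x : ℝ) : ℂ) * avg M t x + (α x : ℂ) * deriv (avg M t) x) / rhoI) x := fun x =>
      ((hα.hasDerivAt_ofReal x).mul (h.differentiable_avg ht x).hasDerivAt).div_const _
    have := convex_univ.norm_image_sub_le_of_norm_deriv_le
      (C := 2 * A * B * κ ^ 2 / rhoI / r / r)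
      (fun t _ => (hd t).differentiableAt) (fun y _ => ?_) (Set.mem_univ x') (Set.mem_univ x)
    · refine this.trans (le_of_eq ?_)
      rw [norm_eq_abs]; ring
    · rw [(hd y).deriv]
      rcases lt_or_ge |y| l with hy | hy
      · simp only [hα.near y hy, Complex.ofReal_zero, zero_mul, add_zero, zero_div, norm_zero]
        positivity
      · rw [norm_div, nI]
        calc _ ≤ (B / r * (A * κ / r) + B * (A * κ ^ 2 / r ^ 2)) / rhoI := by
              gcongr
              refine (norm_add_le _ _).trans ?_
              rw [norm_mul, norm_mul]
              gcongr
              exacts [nα' y, m0 y hy, nα y, m1 y hy]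
          _ ≤ (B / r * (A * κ ^ 2 / r) + B * (A * κ ^ 2 / r ^ 2)) / rhoI := by gcongr
          _ = _ := by field_simp; ring

end FlagCore

theorem cut_rho_one {r : ℝ} (hr : 0 < r) : Cut rhoD r 0 fun x => rho (x / r) := by
  simpa only [one_mul] using cut_rho hr le_rfl

theorem continuous_rho_div (r : ℝ) : Continuous fun x : ℝ => rho (x / r) :=
  continuous_rho.comp (by fun_prop)

/-- A smooth cutoff to `|x| ≈ r`. -/
def annulus (r x : ℝ) : ℝ := rho (x / r) - rho (2 * x / r)

theorem cut_annulus {r : ℝ} (hr : 0 < r) : Cut (4 * rhoD) r (r / 4) (annulus r) := by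
  have := cut_rho_sub hr le_rfl one_le_two
  norm_num only [one_mul] at this
  exact this

theorem abs_annulus_le (r x : ℝ) : |annulus r x| ≤ 2 :=
  (abs_sub _ _).trans (by linarith [abs_rho_le_one (x / r), abs_rho_le_one (2 * x / r)])

/-- The part of `M` where `|x| ≈ r` and `|y| ≲ s`, corrected to have mean zero in `y`. -/
def peel (M : ℝ → ℝ → ℂ) (r s x y : ℝ) : ℂ :=
  (annulus r x : ℂ) * (rho (y / s) : ℂ) * (M x y - avg M s x / (rhoI * s))

/-- The part of `M` where `|x| ≲ r` and `|y| ≲ s`. -/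
def localize (M : ℝ → ℝ → ℂ) (r s x y : ℝ) : ℂ := (rho (x / r) : ℂ) * (rho (y / s) : ℂ) * M x y

/-- The mass of `localize M r s`. -/
def mass (M : ℝ → ℝ → ℂ) (r s : ℝ) : ℂ := ∫ x, avg M s x * (rho (x / r) : ℂ)

/-- A bump with the same mass as `localize M r s`. -/
def massBump (M : ℝ → ℝ → ℂ) (r s x y : ℝ) : ℂ :=
  mass M r s / rhoI ^ 2 * ((rho (x / r) : ℂ) / r) * ((rho (y / s) : ℂ) / s)

/-- `localize M r s`, corrected to have mean zero. -/
def centered (M : ℝ → ℝ → ℂ) (r s x y : ℝ) : ℂ := localize M r s x y - massBump M r s x y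

/-- The increment of `centered` between consecutive parabolic scales, without the part near
the `x`-axis. -/
def increment (M : ℝ → ℝ → ℂ) (r s x y : ℝ) : ℂ :=
  centered M r s x y - centered M (r / 2) (s / 4) x y - peel M r (s / 8) x y

theorem rho_div_eq_zero {s y : ℝ} (hs : 0 < s) (hy : s < |y|) : rho (y / s) = 0 :=
  (cut_rho_one hs).far y hy

theorem hasCompactSupport_of_eq_zero {r s : ℝ} {F : ℝ → ℝ → ℂ}
    (h1 : ∀ x y, r < |x| → F x y = 0) (h2 : ∀ x y, s < |y| → F x y = 0) :
    HasCompactSupport fun p : ℝ × ℝ => F p.1 p.2 := by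
  refine HasCompactSupport.intro
    ((isCompact_closedBall (0 : ℝ) r).prod (isCompact_closedBall (0 : ℝ) s)) fun p hp => ?_
  simp only [Set.mem_prod, Metric.mem_closedBall, dist_zero_right, norm_eq_abs, not_and_or,
    not_le] at hp
  exact hp.elim (h1 _ _) (h2 _ _)

namespace FlagCore

variable {A : ℝ} {M : ℝ → ℝ → ℂ}

theorem continuous_mul_rho (h : FlagCore A M) (s x : ℝ) :
    Continuous fun y => M x y * (rho (y / s) : ℂ) :=
  (h.continuous.comp (by fun_prop : Continuous fun y : ℝ => (x, y))).mul
    (Complex.continuous_ofReal.comp (continuous_rho_div s))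

theorem integrable_mul_rho (h : FlagCore A M) {s : ℝ} (hs : 0 < s) (x : ℝ) :
    Integrable fun y => M x y * (rho (y / s) : ℂ) :=
  (h.continuous_mul_rho s x).integrable_of_hasCompactSupport (HasCompactSupport.intro
    (isCompact_closedBall (0 : ℝ) s) fun y hy => by
      simp only [Metric.mem_closedBall, dist_zero_right, norm_eq_abs, not_le] at hy
      simp [rho_div_eq_zero hs hy])

end FlagCore

theorem integrable_rho_div {s : ℝ} (hs : 0 < s) : Integrable fun y : ℝ => (rho (y / s) : ℂ) :=
  (Complex.continuous_ofReal.comp (continuous_rho_div s)).integrable_of_hasCompactSupport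
    (HasCompactSupport.intro (isCompact_closedBall (0 : ℝ) s) fun y hy => by
      simp only [Metric.mem_closedBall, dist_zero_right, norm_eq_abs, not_le] at hy
      simp [rho_div_eq_zero hs hy])

theorem integral_rho_div_ofReal {s : ℝ} (hs : 0 < s) :
    ∫ y : ℝ, (rho (y / s) : ℂ) = rhoI * s := by
  rw [integral_complex_ofReal, integral_rho_div hs, Complex.ofReal_mul]

namespace FlagCore

variable {A : ℝ} {M : ℝ → ℝ → ℂ}

theorem peel_eq (r s x y : ℝ) : peel M r s x y = (annulus r x : ℂ) * (M x y * (rho (y / s) : ℂ)) -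
    (annulus r x : ℂ) * (avg M s x / (rhoI * s)) * (rho (y / s) : ℂ) := by
  unfold peel; ring

theorem integrable_peel (h : FlagCore A M) {r s : ℝ} (hs : 0 < s) (x : ℝ) :
    Integrable fun y => peel M r s x y := by
  simp_rw [peel_eq]
  exact ((h.integrable_mul_rho hs x).const_mul _).sub ((integrable_rho_div hs).const_mul _)

theorem integral_peel (h : FlagCore A M) {r s : ℝ} (hs : 0 < s) (x : ℝ) :
    ∫ y, peel M r s x y = 0 := by
  simp_rw [peel_eq]
  rw [integral_sub ((h.integrable_mul_rho hs x).const_mul _)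
    ((integrable_rho_div hs).const_mul _), integral_const_mul, integral_const_mul,
    integral_rho_div_ofReal hs, ← avg]
  have h1 : (rhoI : ℂ) ≠ 0 := by exact_mod_cast rhoI_pos.ne'
  have h2 : (s : ℂ) ≠ 0 := by exact_mod_cast hs.ne'
  field_simp
  ring

theorem continuous_peel (h : FlagCore A M) {r s : ℝ} (hr : 0 < r) (hs : 0 < s) :
    Continuous fun p : ℝ × ℝ => peel M r s p.1 p.2 := by
  have h1 := h.continuous
  have h2 := (h.differentiable_avg hs).continuous
  have h3 := continuous_rho
  have h4 := (cut_annulus hr).differentiable.continuous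
  unfold peel
  fun_prop

theorem peel_support {r s : ℝ} (hr : 0 < r) (hs : 0 < s) (x y : ℝ) (hne : peel M r s x y ≠ 0) :
    |x| ≤ r ∧ |y| ≤ s := by
  refine ⟨not_lt.1 fun hx => hne ?_, not_lt.1 fun hy => hne ?_⟩
  · simp [peel, (cut_annulus hr).far x hx]
  · simp [peel, rho_div_eq_zero hs hy]

theorem hasCompactSupport_peel {r s : ℝ} (hr : 0 < r) (hs : 0 < s) :
    HasCompactSupport fun p : ℝ × ℝ => peel M r s p.1 p.2 :=
  hasCompactSupport_of_eq_zero (r := r) (s := s)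
    (fun x y hx => by_contra fun hne => absurd (peel_support hr hs x y hne).1 (not_le.2 hx))
    (fun x y hy => by_contra fun hne => absurd (peel_support hr hs x y hne).2 (not_le.2 hy))

theorem integral_peel_prod (h : FlagCore A M) {r s : ℝ} (hr : 0 < r) (hs : 0 < s) :
    ∫ p : ℝ × ℝ, peel M r s p.1 p.2 = 0 := by
  rw [Measure.volume_eq_prod, integral_prod]
  · simp [h.integral_peel hs]
  · exact (h.continuous_peel hr hs).integrable_of_hasCompactSupport (hasCompactSupport_peel hr hs)

/-- Differences of consecutive peels are uniform bumps. -/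
theorem exists_bump_peel_sub (A : ℝ) (hA : 0 ≤ A) : ∃ C : ℝ, 0 ≤ C ∧ ∀ M : ℝ → ℝ → ℂ,
    FlagCore A M → ∀ r s : ℝ, 0 < r → 0 < s →
      Bump C r (8 * s) fun x y => peel M r s x y - peel M r (s / 2) x y := by
  have hD := rhoD_pos
  have hI := rhoI_pos
  apply Exists.intro
  refine ⟨?_, fun M h r s hr hs => ?_⟩
  rotate_left
  · have hα := cut_annulus hr
    have hβ := cut_annulus hs
    have b1 := h.bump_mul hr hs (κ := 4) (by norm_num) hα hβ le_rfl (Or.inl le_rfl)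
    have b2 := h.bump_avg hr hs (κ := 4) (by norm_num) hs hα (cut_rho_one hs) le_rfl
    have hs2 : 0 < s / 2 := by positivity
    have b3 := h.bump_avg hr hs2 (κ := 4) (by norm_num) hs2 hα (cut_rho_one hs2) le_rfl
    have b3' := b3.rescale hr hs2 (by positivity) (κ := 2) (s' := s) one_le_two le_rfl
      (by linarith) (by linarith) (by linarith)
    have b4 := ((b1.sub b2).add b3').rescale hr hs (by positivity) (κ := 8) (s' := 8 * s)
      (by norm_num) le_rfl (by linarith) (by linarith) le_rfl
    refine (congrArg (Bump _ r (8 * s)) ?_).mpr b4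
    funext x y
    have e1 : (rhoI : ℂ) ≠ 0 := by exact_mod_cast rhoI_pos.ne'
    have e2 : (s : ℂ) ≠ 0 := by exact_mod_cast hs.ne'
    have e3 : y / (s / 2) = 2 * y / s := by field_simp
    simp only [peel, e3]
    rw [annulus.eq_1 s y]
    push_cast
    field_simp
    ring
  · positivity

theorem norm_mass_le (h : FlagCore A M) {r s : ℝ} (hr : 0 < r) (hs : 0 < s) :
    ‖mass M r s‖ ≤ A := h.avg_avg r s hr hs

theorem bump_massBump (h : FlagCore A M) {r s : ℝ} (hr : 0 < r) (hs : 0 < s) :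
    Bump (A * rhoD / rhoI ^ 2 * rhoD) r s (massBump M r s) := by
  have hA := h.nonneg
  have hD := rhoD_pos
  have hI := rhoI_pos
  have hm : ‖mass M r s / rhoI ^ 2‖ ≤ A / rhoI ^ 2 := by
    rw [norm_div, norm_pow, Complex.norm_real, norm_eq_abs, abs_of_pos hI]
    gcongr
    exact h.norm_mass_le hr hs
  have hα := cut_rho_one hr
  have nr : ‖(r : ℂ)‖ = r := by rw [Complex.norm_real, norm_eq_abs, abs_of_pos hr]
  refine bump_tensor hr hs (by positivity) (fun x hx => by simp [hα.far x hx]) (fun x => ?_)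
    (fun x x' => ?_) (cut_rho_one hs)
  · rw [norm_mul, norm_div _ (r : ℂ), nr, Complex.norm_real, norm_eq_abs]
    calc _ ≤ A / rhoI ^ 2 * (rhoD / r) := by gcongr; exact hα.bound x
      _ = _ := by ring
  · rw [← mul_sub, ← _root_.sub_div, norm_mul, norm_div _ (r : ℂ), nr]
    calc _ ≤ A / rhoI ^ 2 * (rhoD / r * |x - x'| / r) := by gcongr; exact hα.dist_le x x'
      _ = _ := by ring

theorem continuous_localize (h : FlagCore A M) (r s : ℝ) :
    Continuous fun p : ℝ × ℝ => localize M r s p.1 p.2 := by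
  have h1 := h.continuous
  have h2 := continuous_rho
  unfold localize
  fun_prop

theorem localize_support {r s : ℝ} (hr : 0 < r) (hs : 0 < s) (x y : ℝ)
    (hne : localize M r s x y ≠ 0) : |x| ≤ r ∧ |y| ≤ s := by
  refine ⟨not_lt.1 fun hx => hne ?_, not_lt.1 fun hy => hne ?_⟩
  · simp [localize, rho_div_eq_zero hr hx]
  · simp [localize, rho_div_eq_zero hs hy]

theorem hasCompactSupport_localize {r s : ℝ} (hr : 0 < r) (hs : 0 < s) :
    HasCompactSupport fun p : ℝ × ℝ => localize M r s p.1 p.2 :=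
  hasCompactSupport_of_eq_zero (r := r) (s := s)
    (fun x y hx => by_contra fun hne => absurd (localize_support hr hs x y hne).1 (not_le.2 hx))
    (fun x y hy => by_contra fun hne => absurd (localize_support hr hs x y hne).2 (not_le.2 hy))

theorem integrable_localize (h : FlagCore A M) {r s : ℝ} (hr : 0 < r) (hs : 0 < s) :
    Integrable fun p : ℝ × ℝ => localize M r s p.1 p.2 :=
  (h.continuous_localize r s).integrable_of_hasCompactSupport (hasCompactSupport_localize hr hs)

theorem integral_localize (h : FlagCore A M) {r s : ℝ} (hr : 0 < r) (hs : 0 < s) :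
    ∫ p : ℝ × ℝ, localize M r s p.1 p.2 = mass M r s := by
  have hi := h.integrable_localize hr hs
  rw [Measure.volume_eq_prod] at hi ⊢
  rw [integral_prod _ hi, mass]
  refine integral_congr_ae (ae_of_all _ fun x => ?_)
  simp only [localize, avg]
  rw [← integral_mul_const]
  exact integral_congr_ae (ae_of_all _ fun y => by ring)

theorem integrable_massBump (h : FlagCore A M) {r s : ℝ} (hr : 0 < r) (hs : 0 < s) :
    Integrable fun p : ℝ × ℝ => massBump M r s p.1 p.2 := (h.bump_massBump hr hs).integrable

theorem integral_massBump {r s : ℝ} (hr : 0 < r) (hs : 0 < s) :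
    ∫ p : ℝ × ℝ, massBump M r s p.1 p.2 = mass M r s := by
  have e1 : (rhoI : ℂ) ≠ 0 := by exact_mod_cast rhoI_pos.ne'
  have e2 : (s : ℂ) ≠ 0 := by exact_mod_cast hs.ne'
  have e3 : (r : ℂ) ≠ 0 := by exact_mod_cast hr.ne'
  unfold massBump
  rw [Measure.volume_eq_prod, integral_prod_mul (fun x : ℝ => mass M r s / rhoI ^ 2 *
    ((rho (x / r) : ℂ) / r)) fun y : ℝ => (rho (y / s) : ℂ) / s, integral_const_mul,
    integral_div, integral_div, integral_rho_div_ofReal hr, integral_rho_div_ofReal hs]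
  field_simp

theorem integrable_centered (h : FlagCore A M) {r s : ℝ} (hr : 0 < r) (hs : 0 < s) :
    Integrable fun p : ℝ × ℝ => centered M r s p.1 p.2 :=
  (h.integrable_localize hr hs).sub (h.integrable_massBump hr hs)

theorem integral_centered (h : FlagCore A M) {r s : ℝ} (hr : 0 < r) (hs : 0 < s) :
    ∫ p : ℝ × ℝ, centered M r s p.1 p.2 = 0 := by
  unfold centered
  rw [integral_sub (h.integrable_localize hr hs) (h.integrable_massBump hr hs),
    h.integral_localize hr hs, integral_massBump hr hs, sub_self]

theorem integral_increment (h : FlagCore A M) {r s : ℝ} (hr : 0 < r) (hs : 0 < s) :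
    ∫ p : ℝ × ℝ, increment M r s p.1 p.2 = 0 := by
  have i1 := h.integrable_centered hr hs
  have i2 := h.integrable_centered (half_pos hr) (by positivity : 0 < s / 4)
  have i12 : Integrable fun p : ℝ × ℝ => centered M r s p.1 p.2 -
      centered M (r / 2) (s / 4) p.1 p.2 := i1.sub i2
  have i3 : Integrable fun p : ℝ × ℝ => peel M r (s / 8) p.1 p.2 :=
    (h.continuous_peel hr (by positivity)).integrable_of_hasCompactSupport
      (hasCompactSupport_peel hr (by positivity))
  unfold increment
  rw [integral_sub i12 i3, integral_sub i1 i2, h.integral_centered hr hs,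
    h.integral_centered (half_pos hr) (by positivity),
    h.integral_peel_prod hr (by positivity)]
  simp

/-- The increments are uniform bumps at parabolic scales. -/
theorem exists_bump_increment (A : ℝ) (hA : 0 ≤ A) : ∃ C : ℝ, 0 ≤ C ∧ ∀ M : ℝ → ℝ → ℂ,
    FlagCore A M → ∀ r s : ℝ, 0 < r → r ^ 2 = s → Bump C r s (increment M r s) := by
  have hD := rhoD_pos
  have hI := rhoI_pos
  apply Exists.intro
  refine ⟨?_, fun M h r s hr hrs => ?_⟩
  rotate_left
  · have hs : 0 < s := by rw [← hrs]; positivity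
    have hs8 : 0 < s / 8 := by positivity
    have hs4 : 0 < s / 4 := by positivity
    have hp : (r / 16) ^ 2 ≤ s / 16 := by rw [div_pow, hrs]; linarith
    have hb1 := cut_rho_sub (j := 1) (k := 8) hs (by norm_num) (by norm_num)
    have hb2 := cut_rho_sub (j := 4) (k := 8) hs (by norm_num) (by norm_num)
    norm_num only [one_mul] at hb1 hb2
    have b1 := h.bump_mul hr hs (κ := 16) (by norm_num) (cut_rho_one hr) hb1 le_rfl (Or.inr hp)
    have b2 := h.bump_mul hr hs (κ := 16) (by norm_num) (cut_rho hr one_le_two) hb2 le_rfl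
      (Or.inr hp)
    have b3 := (h.bump_avg hr hs8 (κ := 4) (by norm_num) hs8 (cut_annulus hr) (cut_rho_one hs8)
      le_rfl).rescale hr hs8 (by positivity) (κ := 8) (s' := s) (by norm_num) le_rfl
      (by linarith) (by linarith) (by linarith)
    have b4 := h.bump_massBump hr hs
    have b5 := (h.bump_massBump (half_pos hr) hs4).rescale (half_pos hr) hs4 (by positivity)
      (κ := 4) (r' := r) (s' := s) (by norm_num) (by linarith) (by linarith) (by linarith)
      (by linarith)
    have b6 := (((b1.sub b2).add b3).sub b4).add b5
    refine (congrArg (Bump _ r s) ?_).mpr b6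
    funext x y
    have e1 : (rhoI : ℂ) ≠ 0 := by exact_mod_cast rhoI_pos.ne'
    have e2 : (s : ℂ) ≠ 0 := by exact_mod_cast hs.ne'
    have e3 : y / (s / 8) = 8 * y / s := by field_simp
    have e4 : y / (s / 4) = 4 * y / s := by field_simp
    have e5 : x / (r / 2) = 2 * x / r := by field_simp
    simp only [increment, centered, peel, localize, e3, e4, e5]
    rw [annulus]
    push_cast
    field_simp
    ring
  · positivity

end FlagCore

/-- A continuous compactly supported kernel, bounded on `L^p` with constant `C`. -/
structure LpKernel (k : ℝ × ℝ → ℂ) (p C : ℝ) : Prop where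
  continuous : Continuous k
  hasCompactSupport : HasCompactSupport k
  nonneg : 0 ≤ C
  bound : LpBound k p C

namespace LpKernel

variable {k k' : ℝ × ℝ → ℂ} {p C C' : ℝ}

theorem mono (h : LpKernel k p C) (hC : C ≤ C') : LpKernel k p C' :=
  ⟨h.continuous, h.hasCompactSupport, h.nonneg.trans hC, fun f hf =>
    (h.bound f hf).trans (by gcongr)⟩

theorem integrable_mul (h : LpKernel k p C) {f : ℝ × ℝ → ℂ} (hf : Nice f) (z : ℝ × ℝ) :
    Integrable fun w => f (z - w) * k w :=
  Continuous.integrable_of_hasCompactSupport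
    ((hf.continuous.comp (by fun_prop)).mul h.continuous) h.hasCompactSupport.mul_left

theorem add (hp : 1 ≤ p) (h : LpKernel k p C) (h' : LpKernel k' p C') :
    LpKernel (fun z => k z + k' z) p (C + C') := by
  refine ⟨h.continuous.add h'.continuous, h.hasCompactSupport.add h'.hasCompactSupport,
    add_nonneg h.nonneg h'.nonneg, fun f hf => ?_⟩
  have e : cv (fun z => k z + k' z) f = cv k f + cv k' f := by
    funext z
    simp only [cv, Pi.add_apply, mul_add]
    exact integral_add (h.integrable_mul hf z) (h'.integrable_mul hf z)
  rw [e, ENNReal.ofReal_add h.nonneg h'.nonneg, add_mul]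
  refine (eLpNorm_add_le
    (measurable_cv h.continuous.measurable hf.continuous.measurable).aestronglyMeasurable
    (measurable_cv h'.continuous.measurable hf.continuous.measurable).aestronglyMeasurable
    (by rwa [← ENNReal.ofReal_one, ENNReal.ofReal_le_ofReal_iff (by linarith)])).trans ?_
  exact add_le_add (h.bound f hf) (h'.bound f hf)

theorem neg (h : LpKernel k p C) : LpKernel (fun z => -k z) p C := by
  refine ⟨h.continuous.neg, h.hasCompactSupport.neg, h.nonneg, fun f hf => ?_⟩
  have e : cv (fun z => -k z) f = -cv k f := by
    funext z
    simp only [cv, Pi.neg_apply, mul_neg]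
    exact integral_neg _
  rw [e, eLpNorm_neg]
  exact h.bound f hf

theorem sub (hp : 1 ≤ p) (h : LpKernel k p C) (h' : LpKernel k' p C') :
    LpKernel (fun z => k z - k' z) p (C + C') := by
  simpa only [sub_eq_add_neg] using h.add hp h'.neg

theorem sum (hp : 1 ≤ p) {ι : Type*} {k : ι → ℝ × ℝ → ℂ} {C : ι → ℝ}
    (h : ∀ i, LpKernel (k i) p (C i)) (S : Finset ι) :
    LpKernel (fun z => ∑ i ∈ S, k i z) p (∑ i ∈ S, C i) := by
  classical
  induction S using Finset.induction_on with
  | empty =>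
    refine ⟨by simpa using continuous_const, HasCompactSupport.zero, by simp,
      fun f hf => ?_⟩
    have : cv (fun z => ∑ i ∈ (∅ : Finset ι), k i z) f = 0 := by
      funext z; simp [cv]
    rw [this, eLpNorm_zero]
    exact zero_le
  | insert i S hi ih =>
    simp only [Finset.sum_insert hi]
    exact (h i).add hp ih

/-- Young's inequality. -/
theorem of_lintegral (hp : 1 ≤ p) (hC : 0 ≤ C) (hk : Continuous k) (hkc : HasCompactSupport k)
    (h : ∫⁻ z, ‖k z‖ₑ ≤ ENNReal.ofReal C) : LpKernel k p C :=
  ⟨hk, hkc, hC, fun _ hf =>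
    (eLpNorm_cv_le hk.measurable hf.continuous.measurable hp).trans (by gcongr)⟩

end LpKernel

/-- The shear `(x, y) ↦ (x, y - c x²)` as a homeomorphism. -/
def shearHomeomorph (c : ℝ) : ℝ × ℝ ≃ₜ ℝ × ℝ where
  toFun z := (z.1, z.2 - c * z.1 ^ 2)
  invFun z := (z.1, z.2 + c * z.1 ^ 2)
  left_inv z := by simp
  right_inv z := by simp
  continuous_toFun := by fun_prop
  continuous_invFun := by fun_prop

theorem LpKernel.shear_of_support {p c r s B : ℝ} {F : ℝ → ℝ → ℂ} (hp : 1 ≤ p) (hr : 0 ≤ r)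
    (hs : 0 ≤ s) (hB : 0 ≤ B) (hF : Continuous fun p : ℝ × ℝ => F p.1 p.2)
    (hFc : HasCompactSupport fun p : ℝ × ℝ => F p.1 p.2)
    (hFs : ∀ x y, F x y ≠ 0 → |x| ≤ r ∧ |y| ≤ s) (hFB : ∀ x y, ‖F x y‖ ≤ B) :
    LpKernel (shear c F) p (B * (4 * (r * s))) :=
  LpKernel.of_lintegral hp (by positivity)
    (hF.comp (shearHomeomorph c).continuous) (hFc.comp_homeomorph (shearHomeomorph c))
    (lintegral_shear_le_of_support hr hB hFs hFB)

theorem Finset.sum_Ioc_sub_int {E : Type*} [AddCommGroup E] (f : ℤ → E) {a b : ℤ} (hab : a ≤ b) :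
    ∑ J ∈ Finset.Ioc a b, (f J - f (J - 1)) = f b - f a := by
  induction b, hab using Int.leInduction with
  | base => simp
  | succ b hb ih =>
    have : Finset.Ioc a (b + 1) = insert (b + 1) (Finset.Ioc a b) := by
      ext; simp only [Finset.mem_Ioc, Finset.mem_insert]; omega
    rw [this, Finset.sum_insert (by simp), ih, add_sub_cancel_right]
    abel

namespace FlagCore

variable {A : ℝ} {M : ℝ → ℝ → ℂ}

theorem norm_avg_le {K : ℝ} (hK : ∀ x y, ‖M x y‖ ≤ K) {s : ℝ} (hs : 0 < s) (x : ℝ) :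
    ‖avg M s x‖ ≤ K * (rhoI * s) := by
  rw [← integral_rho_div hs, ← integral_const_mul]
  refine norm_integral_le_of_norm_le ((integrable_rho_div hs).re.const_mul K)
    (ae_of_all _ fun y => ?_)
  rw [norm_mul, Complex.norm_real, norm_eq_abs, abs_of_nonneg (rho_nonneg _)]
  exact mul_le_mul_of_nonneg_right (hK x y) (rho_nonneg _)

theorem norm_peel_le {K : ℝ} (hK : ∀ x y, ‖M x y‖ ≤ K) {r s : ℝ} (hs : 0 < s) (x y : ℝ) :
    ‖peel M r s x y‖ ≤ 4 * K := by
  have hI := rhoI_pos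
  have hK0 : 0 ≤ K := (norm_nonneg _).trans (hK 0 0)
  have h1 : ‖avg M s x / (rhoI * s)‖ ≤ K := by
    rw [norm_div, norm_mul, Complex.norm_real, Complex.norm_real, norm_eq_abs, norm_eq_abs,
      abs_of_pos hI, abs_of_pos hs, div_le_iff₀ (by positivity)]
    exact norm_avg_le hK hs x
  rw [peel, norm_mul, norm_mul, Complex.norm_real, Complex.norm_real]
  calc _ ≤ 2 * 1 * (K + K) := by
        gcongr
        exacts [abs_annulus_le r x, abs_rho_le_one _,
          (norm_sub_le _ _).trans (add_le_add (hK x y) h1)]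
    _ = _ := by ring

theorem norm_localize_le {K : ℝ} (hK : ∀ x y, ‖M x y‖ ≤ K) (r s x y : ℝ) :
    ‖localize M r s x y‖ ≤ K := by
  have hK0 : 0 ≤ K := (norm_nonneg _).trans (hK 0 0)
  rw [localize, norm_mul, norm_mul, Complex.norm_real, Complex.norm_real]
  calc _ ≤ 1 * 1 * K := by
        gcongr
        exacts [abs_rho_le_one _, abs_rho_le_one _, hK x y]
    _ = _ := by ring

/-- The multi-scale decomposition of a flag kernel. -/
theorem centered_sub_centered (M : ℝ → ℝ → ℂ) {a b : ℤ} (hab : a ≤ b) (N : ℕ) (x y : ℝ) :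
    centered M (2 ^ b) (4 ^ b) x y - centered M (2 ^ a) (4 ^ a) x y =
      ∑ J ∈ Finset.Ioc a b, increment M (2 ^ J) (4 ^ J) x y +
      ∑ n ∈ Finset.range N, ∑ J ∈ Finset.Ioc a b,
        (peel M (2 ^ J) (4 ^ J / 2 ^ (n + 3)) x y - peel M (2 ^ J) (4 ^ J / 2 ^ (n + 3) / 2) x y) +
      ∑ J ∈ Finset.Ioc a b, peel M (2 ^ J) (4 ^ J / 2 ^ (N + 3)) x y := by
  rw [← Finset.sum_Ioc_sub_int (fun J : ℤ => centered M (2 ^ J) (4 ^ J) x y) hab,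
    Finset.sum_comm, ← Finset.sum_add_distrib, ← Finset.sum_add_distrib]
  refine Finset.sum_congr rfl fun J _ => ?_
  have e : ∀ n : ℕ, (4 : ℝ) ^ J / 2 ^ (n + 3) / 2 = 4 ^ J / 2 ^ (n + 1 + 3) := fun n => by
    rw [div_div, ← pow_succ]
  simp only [e]
  rw [Finset.sum_range_sub' fun n : ℕ => peel M (2 ^ J) (4 ^ J / 2 ^ (n + 3)) x y, increment,
    zpow_sub_one₀ two_ne_zero, zpow_sub_one₀ four_ne_zero, ← div_eq_mul_inv, ← div_eq_mul_inv,
    show (2 : ℝ) ^ (0 + 3) = 8 by norm_num]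
  ring

theorem exists_lpBound (A : ℝ) {p c : ℝ} (hp : 1 < p) (hc : 0 < c) :
    ∃ C : ℝ, ∀ M, FlagCore A M → LpBound (shear c M) p C := by
  rcases lt_or_ge A 0 with hA | hA
  · exact ⟨0, fun M h => absurd h.nonneg (not_le.2 hA)⟩
  have hD := rhoD_pos
  have hI := rhoI_pos
  obtain ⟨C₁, hC₁, h₁⟩ := exists_bump_peel_sub A hA
  obtain ⟨C₂, hC₂, h₂⟩ := exists_bump_increment A hA
  obtain ⟨D₁, δ, hD₁, hδ, h₁'⟩ := exists_lpBound_sum_shear hp hC₁ hc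
  obtain ⟨D₂, hD₂, h₂'⟩ := exists_lpBound_sum_shear_of_mean_zero hp hC₂ hc
  set E := 4 * (A * rhoD / rhoI ^ 2 * rhoD) with hE
  have hE0 : 0 ≤ E := by positivity
  refine ⟨(D₂ + D₁ * (1 - 2 ^ (-δ))⁻¹ + 1) + 1 + E + E, fun M h => ?_⟩
  obtain ⟨K, hK'⟩ := h.hasCompactSupport.exists_bound_of_continuous h.continuous
  have hK : ∀ x y, ‖M x y‖ ≤ K := fun x y => hK' (x, y)
  have hK0 : 0 ≤ K := (norm_nonneg _).trans (hK 0 0)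
  obtain ⟨R, hR⟩ := h.hasCompactSupport.isCompact.isBounded.subset_closedBall (0 : ℝ × ℝ)
  have hMR : ∀ x y, M x y ≠ 0 → |x| ≤ R ∧ |y| ≤ R := fun x y hxy => by
    have := hR (subset_tsupport (fun p : ℝ × ℝ => M p.1 p.2) (a := (x, y)) hxy)
    simpa [Prod.norm_def] using this
  obtain ⟨i, hi⟩ := pow_unbounded_of_one_lt (2 * R) (one_lt_two (α := ℝ))
  obtain ⟨j, hj⟩ := pow_unbounded_of_one_lt (4 * K) (one_lt_two (α := ℝ))
  set a : ℤ := -(j : ℤ) with ha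
  set b : ℤ := (i : ℤ) with hb
  have hab : a ≤ b := by omega
  obtain ⟨N, hN⟩ := pow_unbounded_of_one_lt
    (∑ J ∈ Finset.Ioc a b, 4 * K * (4 * ((2 : ℝ) ^ J * 4 ^ J))) (one_lt_two (α := ℝ))
  have hloc : ∀ x y, localize M (2 ^ b) (4 ^ b) x y = M x y := fun x y => by
    by_cases hxy : M x y = 0
    · rw [localize, hxy, mul_zero]
    · obtain ⟨hx, hy⟩ := hMR x y hxy
      have h24 : (2 : ℝ) ^ i ≤ 4 ^ i := by gcongr; norm_num
      rw [localize, rho_eq_one, rho_eq_one]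
      · simp
      · rw [abs_div, hb, zpow_natCast, abs_of_pos (by positivity : (0 : ℝ) < 4 ^ i),
          div_le_iff₀ (by positivity)]
        linarith
      · rw [abs_div, hb, zpow_natCast, abs_of_pos (by positivity : (0 : ℝ) < 2 ^ i),
          div_le_iff₀ (by positivity)]
        linarith
  have p2 : ∀ J : ℤ, (0 : ℝ) < 2 ^ J := fun J => by positivity
  have p4 : ∀ J : ℤ, (0 : ℝ) < 4 ^ J := fun J => by positivity
  have k0 : LpKernel (shear c (localize M (2 ^ a) (4 ^ a))) p 1 := by
    refine (LpKernel.shear_of_support hp.le (p2 a).le (p4 a).le hK0 (h.continuous_localize _ _)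
      (hasCompactSupport_localize (p2 a) (p4 a)) (localize_support (p2 a) (p4 a))
      (norm_localize_le hK _ _)).mono ?_
    have h4 : (4 : ℝ) ^ a ≤ 1 := zpow_le_one_of_nonpos₀ (by norm_num) (by omega)
    have h2 : (2 : ℝ) ^ a * 2 ^ j = 1 := by
      rw [ha, zpow_neg, zpow_natCast, inv_mul_cancel₀ (by positivity)]
    calc K * (4 * (2 ^ a * 4 ^ a)) ≤ K * (4 * (2 ^ a * 1)) := by gcongr
      _ = 2 ^ a * (4 * K) := by ring
      _ ≤ 2 ^ a * 2 ^ j := by gcongr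
      _ = 1 := h2
  have kB : ∀ J : ℤ, LpKernel (shear c (massBump M (2 ^ J) (4 ^ J))) p E := fun J => by
    have hB := h.bump_massBump (p2 J) (p4 J)
    exact LpKernel.of_lintegral hp.le hE0 hB.continuous_shear (hB.hasCompactSupport_shear hc.le)
      (hB.lintegral_shear_le (p2 J) (p4 J) (by positivity))
  have kI : LpKernel (fun z => ∑ J ∈ Finset.Ioc a b, shear c (increment M (2 ^ J) (4 ^ J)) z)
      p D₂ := by
    have hB : ∀ J : ℤ, Bump C₂ (2 ^ J) (4 ^ J) (increment M (2 ^ J) (4 ^ J)) := fun J =>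
      h₂ M h _ _ (p2 J) (by rw [← zpow_natCast, zpow_comm]; norm_num)
    exact ⟨Bump.continuous_sum_shear hB _, Bump.hasCompactSupport_sum_shear hc.le hB _, hD₂,
      h₂' _ hB (fun J => h.integral_increment (p2 J) (p4 J)) _⟩
  have kP : ∀ n : ℕ, LpKernel (fun z => ∑ J ∈ Finset.Ioc a b, shear c
      (fun x y => peel M (2 ^ J) (4 ^ J / 2 ^ (n + 3)) x y -
        peel M (2 ^ J) (4 ^ J / 2 ^ (n + 3) / 2) x y) z) p (D₁ * 2 ^ (-δ * n)) := fun n => by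
    have hB : ∀ J : ℤ, Bump C₁ (2 ^ J) (4 ^ J / 2 ^ n)
        (fun x y => peel M (2 ^ J) (4 ^ J / 2 ^ (n + 3)) x y -
          peel M (2 ^ J) (4 ^ J / 2 ^ (n + 3) / 2) x y) := fun J => by
      have := h₁ M h (2 ^ J) (4 ^ J / 2 ^ (n + 3)) (p2 J) (by positivity)
      rwa [show 8 * ((4 : ℝ) ^ J / 2 ^ (n + 3)) = 4 ^ J / 2 ^ n by
        rw [pow_add]; field_simp; norm_num] at this
    refine ⟨Bump.continuous_sum_shear hB _, Bump.hasCompactSupport_sum_shear hc.le hB _,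
      by positivity, h₁' n _ hB (fun J x => ?_) _⟩
    rw [integral_sub (h.integrable_peel (by positivity) x) (h.integrable_peel (by positivity) x),
      h.integral_peel (by positivity), h.integral_peel (by positivity), sub_zero]
  have kP' := (LpKernel.sum hp.le kP (Finset.range N)).mono
    (C' := D₁ * (1 - 2 ^ (-δ))⁻¹) (by
      rw [← Finset.mul_sum]
      gcongr
      have h1 : (2 : ℝ) ^ (-δ) < 1 := Real.rpow_lt_one_of_one_lt_of_neg one_lt_two (by linarith)
      refine le_trans (le_of_eq ?_) (sum_geometric_le (Finset.range N)
        (by positivity : (0 : ℝ) ≤ 2 ^ (-δ)) h1)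
      exact Finset.sum_congr rfl fun n _ => by rw [Real.rpow_mul two_pos.le, Real.rpow_natCast])
  have kE : LpKernel (fun z => ∑ J ∈ Finset.Ioc a b,
      shear c (peel M (2 ^ J) (4 ^ J / 2 ^ (N + 3))) z) p 1 := by
    have hs : ∀ J : ℤ, (0 : ℝ) < 4 ^ J / 2 ^ (N + 3) := fun J => by positivity
    refine (LpKernel.sum hp.le (fun J : ℤ => LpKernel.shear_of_support hp.le (p2 J).le (hs J).le
      (by positivity) (h.continuous_peel (p2 J) (hs J)) (hasCompactSupport_peel (p2 J) (hs J))
      (peel_support (p2 J) (hs J)) (norm_peel_le hK (hs J))) _).mono ?_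
    calc ∑ J ∈ Finset.Ioc a b, 4 * K * (4 * ((2 : ℝ) ^ J * (4 ^ J / 2 ^ (N + 3))))
        = (∑ J ∈ Finset.Ioc a b, 4 * K * (4 * ((2 : ℝ) ^ J * 4 ^ J))) / 2 ^ (N + 3) := by
          rw [Finset.sum_div]
          exact Finset.sum_congr rfl fun J _ => by ring
      _ ≤ 2 ^ N / 2 ^ (N + 3) := by gcongr
      _ ≤ 1 := by
          rw [div_le_one (by positivity)]
          exact pow_le_pow_right₀ one_le_two (by omega)
  have key := (((((kI.add hp.le kP').add hp.le kE).add hp.le k0).sub hp.le (kB a)).add hp.le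
    (kB b)).bound
  convert key using 2 with z
  have := centered_sub_centered M hab N z.1 (z.2 - c * z.1 ^ 2)
  simp only [shear]
  rw [← this, centered, centered, hloc]
  ring

end FlagCore

theorem SchwartzMap.nice (f : SchwartzMap (ℝ × ℝ) ℂ) : Nice f := by
  obtain ⟨C, -, hC⟩ := f.decay 0 0
  exact ⟨f.continuous, f.integrable, C, fun z => by simpa using hC z⟩

/-- `L^p` boundedness, `1 < p < ∞`, of convolution with the curved flag
kernel `K(x,y) = M(x, y - c₀x²)`, with operator norm depending only on `p`, `c₀` and the
flag seminorm constants of `M`. -/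
theorem curved_flag_kernel_Lp_bounded (p c₀ : ℝ) (hp : 1 < p) (hc₀ : 0 < c₀)
    (Cab : ℕ → ℕ → ℝ) (C1 : ℕ → ℝ) (C2 : ℝ) :
    ∃ Cp : ℝ, ∀ M : ℝ → ℝ → ℂ, FlagF1FunBounds Cab C1 C2 M →
      ∀ f : SchwartzMap (ℝ × ℝ) ℂ,
        eLpNorm
            (fun z : ℝ × ℝ => ∫ w : ℝ × ℝ, f (z - w) * M w.1 (w.2 - c₀ * w.1 ^ 2))
            (ENNReal.ofReal p) volume
          ≤ ENNReal.ofReal Cp * eLpNorm (fun z : ℝ × ℝ => f z) (ENNReal.ofReal p) volume := by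
  obtain ⟨C, hC⟩ := FlagCore.exists_lpBound (coreConst Cab C1 C2) hp hc₀
  exact ⟨C, fun M hM f => hC M hM.core f f.nice⟩
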